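/- There exists a unique family (ψ_m)_{m ∈ ℕ^d, |m| ≥ 2} of ℂ^d-valued polynomials in x of degree at most S with the following property: setting ψ(x,w) = Σ_{|m| ≥ 2} ψ_m(x) w^m (a formal power series in w), the system du/dx = A(x) u + Q(x)^{−1} f(x,u) is formally equivalent to the normal form dw/dx = A(x) w + Q(x)^{−1} ψ(x,w) via a change of variable u = w + h(x,w) = w + Σ_{|m| ≥ 2} h_m(x) w^m with each h_m analytic on D; that is, there exist ℂ^d-valued functions h_m analytic on D such that the identity ∂_x h + (d_w h)(A(x) w + Q(x)^{−1} ψ(x,w)) = A(x) h + Q(x)^{−1}[ f(x, w + h(x,w)) − ψ(x,w) ] holds order by order (in each homogeneous degree of the formal power-series variable w). -/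

import Mathlib

open Matrix Set Filter Topology Asymptotics

/-- A matrix is nonlinearly nonresonant if its eigenvalues `λ₁, …, λ_d` (with
multiplicity) satisfy `k + m·λ − λᵢ ≠ 0` for all `k ∈ ℕ`, `m ∈ ℕᵈ` with `|m| ≥ 2`,
`1 ≤ i ≤ d`. -/
def NonlinearlyNonresonant (d : ℕ) (M : Matrix (Fin d) (Fin d) ℂ) : Prop :=
  ∃ lam : Fin d → ℂ,
    M.charpoly = ∏ i, (Polynomial.X - Polynomial.C (lam i)) ∧
    ∀ (k : ℕ) (m : Fin d → ℕ) (i : Fin d), 2 ≤ ∑ j, m j →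
      (k : ℂ) + (∑ j, (m j : ℂ) * lam j) - lam i ≠ 0

/-- The truncation to total degree `≤ n` of the formal series
`Σ_{|m| ≥ 2} H_m(x) w^m` : `Σ_{2 ≤ |m| ≤ n} H_m(x) w^m`. -/
noncomputable def truncSeries (d n : ℕ) (H : (Fin d → ℕ) → ℂ → Fin d → ℂ)
    (x : ℂ) (w : Fin d → ℂ) : Fin d → ℂ :=
  ∑ m ∈ (Finset.Iic (fun _ => n : Fin d → ℕ)).filter
      (fun m => 2 ≤ ∑ i, m i ∧ ∑ i, m i ≤ n),
    (∏ i, w i ^ m i) • H m x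

/-! ### Part 1: compact perturbations of the identity -/

section Fredholm

variable {X : Type*} [NormedAddCommGroup X] [NormedSpace ℂ X]

/-- closed range: `1 - K` with dense range is surjective. -/
theorem surjective_of_denseRange (K : X →L[ℂ] X) (hK : IsCompactOperator K)
    (hd : DenseRange (fun x => x - K x)) : Function.Surjective (fun x => x - K x) := by
  set T : X →L[ℂ] X := ContinuousLinearMap.id ℂ X - K with hT
  have hTa : ∀ x, T x = x - K x := fun x => by simp [hT]
  intro y
  -- approximants
  obtain ⟨u, hu⟩ : ∃ u : ℕ → X, Tendsto (fun n => T (u n)) atTop (𝓝 y) := by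
    have hy : y ∈ closure (range (fun x => x - K x)) := hd y
    obtain ⟨v, hv, hvy⟩ := mem_closure_iff_seq_limit.1 hy
    choose u hu using hv
    refine ⟨u, ?_⟩
    have : (fun n => T (u n)) = v := by
      funext n; rw [hTa]; exact hu n
    rw [this]; exact hvy
  set N : Submodule ℂ X := T.ker with hN
  -- adjust by kernel elements
  have hadj : ∀ n, ∃ x : X, T x = T (u n) ∧ ∀ k ∈ N, ‖x‖ ≤ 2 * ‖x - k‖ := by
    intro n
    by_cases h0 : u n ∈ N
    · refine ⟨0, ?_, ?_⟩
      · have : T (u n) = 0 := h0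
        simp [this]
      · intro k hk; simp
    · have hcl : IsClosed (N : Set X) := T.isClosed_ker
      have hpos : 0 < Metric.infDist (u n) (N : Set X) :=
        (hcl.notMem_iff_infDist_pos ⟨0, N.zero_mem⟩).1 h0
      obtain ⟨k, hk, hkd⟩ := (Metric.infDist_lt_iff ⟨0, N.zero_mem⟩).1
        (show Metric.infDist (u n) (N : Set X) < 2 * Metric.infDist (u n) (N : Set X) by linarith)
      refine ⟨u n - k, ?_, ?_⟩
      · have : T k = 0 := hk
        simp [this]
      · intro k' hk'
        have h1 : Metric.infDist (u n) (N : Set X) ≤ dist (u n) (k + k') :=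
          Metric.infDist_le_dist_of_mem (N.add_mem hk hk')
        rw [dist_eq_norm] at h1 hkd
        have : u n - (k + k') = u n - k - k' := by abel
        rw [this] at h1
        linarith
  choose x hx hxk using hadj
  have hxy : Tendsto (fun n => T (x n)) atTop (𝓝 y) := by simpa [hx] using hu
  by_cases hb : ∃ R, ∃ᶠ n in atTop, ‖x n‖ ≤ R
  · obtain ⟨R, hR⟩ := hb
    obtain ⟨φ, hφ, hφR⟩ := extraction_of_frequently_atTop hR
    obtain ⟨C, hC, hC'⟩ := hK.image_closedBall_subset_compact R
    obtain ⟨z, hz, ψ, hψ, hψz⟩ := hC.tendsto_subseq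
      (x := fun n => K (x (φ n))) (fun n => hC' ⟨x (φ n), by simpa using hφR n, rfl⟩)
    have h1 : Tendsto (fun n => T (x (φ (ψ n)))) atTop (𝓝 y) :=
      hxy.comp (hφ.tendsto_atTop.comp hψ.tendsto_atTop)
    have h2 : Tendsto (fun n => x (φ (ψ n))) atTop (𝓝 (y + z)) := by
      have := h1.add hψz
      refine this.congr (fun n => ?_)
      simp [hTa]
    refine ⟨y + z, ?_⟩
    have h3 := (T.continuous.tendsto (y + z)).comp h2
    have := tendsto_nhds_unique h3 h1
    rw [hTa] at this; exact this
  · exfalso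
    push Not at hb
    have hnorm : Tendsto (fun n => ‖x n‖) atTop atTop := by
      rw [tendsto_atTop]
      intro b
      filter_upwards [hb b] with n hn using hn.le
    set v : ℕ → X := fun n => ((‖x n‖ : ℂ)⁻¹) • x n with hv
    have hv1 : ∀ n, ‖v n‖ ≤ 1 := by
      intro n
      simp only [hv, norm_smul, norm_inv, Complex.norm_real, norm_norm]
      by_cases h : ‖x n‖ = 0
      · simp [h]
      · rw [inv_mul_cancel₀ h]
    obtain ⟨C, hC, hC'⟩ := hK.image_closedBall_subset_compact 1
    obtain ⟨z, hz, ψ, hψ, hψz⟩ := hC.tendsto_subseq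
      (x := fun n => K (v n)) (fun n => hC' ⟨v n, by simpa using hv1 n, rfl⟩)
    have hTv : Tendsto (fun n => T (v n)) atTop (𝓝 0) := by
      have h1 : Tendsto (fun n => ((‖x n‖ : ℂ)⁻¹)) atTop (𝓝 0) := by
        have := (tendsto_inv_atTop_zero.comp hnorm)
        have h2 := (Complex.continuous_ofReal.tendsto 0).comp this
        simpa [Function.comp_def] using h2
      have := h1.smul hxy
      simpa [hv] using this
    have h2 : Tendsto (fun n => v (ψ n)) atTop (𝓝 z) := by
      have := (hTv.comp hψ.tendsto_atTop).add hψz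
      rw [zero_add] at this
      refine this.congr (fun n => ?_)
      simp [hTa]
    have hTz : T z = 0 :=
      tendsto_nhds_unique ((T.continuous.tendsto z).comp h2) (hTv.comp hψ.tendsto_atTop)
    have h4 : Tendsto (fun n => ‖v (ψ n) - z‖) atTop (𝓝 0) := by
      have := (h2.sub_const z).norm
      simpa using this
    have h5 : ∀ᶠ n in atTop, (1/2 : ℝ) ≤ ‖v (ψ n) - z‖ := by
      filter_upwards [hψ.tendsto_atTop.eventually (hb 1)] with n hn
      have hne : (‖x (ψ n)‖ : ℂ) ≠ 0 := by
        simp only [ne_eq, Complex.ofReal_eq_zero]; linarith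
      have hmem : (‖x (ψ n)‖ : ℂ) • z ∈ N := N.smul_mem _ hTz
      have := hxk (ψ n) _ hmem
      have h6 : v (ψ n) - z = ((‖x (ψ n)‖ : ℂ)⁻¹) • (x (ψ n) - (‖x (ψ n)‖ : ℂ) • z) := by
        rw [smul_sub, smul_smul, inv_mul_cancel₀ hne, one_smul]
      rw [h6, norm_smul, norm_inv, Complex.norm_real, norm_norm]
      have hp : 0 < ‖x (ψ n)‖ := by linarith
      rw [inv_mul_eq_div, le_div_iff₀ hp]
      linarith
    have := le_of_tendsto_of_tendsto tendsto_const_nhds h4 h5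
    linarith

theorem injective_of_surjective_compact (K : X →L[ℂ] X) (hK : IsCompactOperator K)
    (hs : Function.Surjective (fun x => x - K x)) : ∀ x, x - K x = 0 → x = 0 := by
  set T : X →L[ℂ] X := ContinuousLinearMap.id ℂ X - K with hT
  have hTa : ∀ x, T x = x - K x := fun x => by simp [hT]
  by_contra hcon
  push Not at hcon
  obtain ⟨x0, hx0, hx0n⟩ := hcon
  have hs' : Function.Surjective T := fun y => by
    obtain ⟨x, hx⟩ := hs y
    exact ⟨x, by rw [hTa]; exact hx⟩
  let V : ℕ → Submodule ℂ X := fun n => (T ^ n).ker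
  have hVmem : ∀ n x, x ∈ V n ↔ (T ^ n) x = 0 := fun n x => Iff.rfl
  have hVsucc : ∀ n x, x ∈ V (n + 1) ↔ T x ∈ V n := by
    intro n x
    rw [hVmem, hVmem, pow_succ]; rfl
  have hmono : ∀ n, V n ≤ V (n + 1) := by
    intro n x hx
    rw [hVmem] at *
    rw [pow_succ']
    change T ((T ^ n) x) = 0
    rw [hx, map_zero]
  have hmono' : Monotone V := monotone_nat_of_le_succ hmono
  have hstrict : ∀ n, ∃ x ∈ V (n + 1), x ∉ V n := by
    intro n
    obtain ⟨y, hy⟩ : ∃ y, (T ^ n) y = x0 := by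
      have : Function.Surjective (T ^ n : X →L[ℂ] X) := by
        intro z; obtain ⟨y, hy⟩ := hs'.iterate n z; exact ⟨y, by rw [← hy]; exact congrFun (FunLike.coe_pow_eq_iterate T n) y⟩
      exact this x0
    refine ⟨y, ?_, ?_⟩
    · rw [hVmem, pow_succ']
      change T ((T ^ n) y) = 0
      rw [hy, hTa, hx0]
    · rw [hVmem, hy]; exact hx0n
  have hf : ∀ n, ∃ x ∈ V (n + 1), ‖x‖ ≤ 3 ∧ ∀ y ∈ V n, 1 ≤ ‖x - y‖ := by
    intro n
    have h₁ : IsClosed ((V n).comap (V (n + 1)).subtype : Set (V (n + 1))) := by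
      have : IsClosed (V n : Set X) := (T ^ n).isClosed_ker
      exact this.preimage continuous_subtype_val
    have h₂ : ∃ x : V (n + 1), x ∉ (V n).comap (V (n + 1)).subtype := by
      obtain ⟨x, hx, hxn⟩ := hstrict n
      exact ⟨⟨x, hx⟩, hxn⟩
    obtain ⟨⟨x, hx⟩, hxn, hxy⟩ := riesz_lemma_of_norm_lt (c := (2 : ℂ)) (R := 3) (by simp)
      (by simp; norm_num) h₁ h₂
    refine ⟨x, hx, hxn, fun y hy => ?_⟩
    exact hxy ⟨y, hmono n hy⟩ hy
  choose f hfm hfn hfd using hf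
  have hsep : ∀ m n, m < n → 1 ≤ ‖K (f n) - K (f m)‖ := by
    intro m n hmn
    have hK' : ∀ x, K x = x - T x := fun x => by rw [hTa]; abel
    have h1 : K (f n) - K (f m) = f n - (T (f n) + f m - T (f m)) := by
      rw [hK', hK']; abel
    rw [h1]
    apply hfd
    have ha : T (f n) ∈ V n := (hVsucc n _).1 (hfm n)
    have hb : f m ∈ V n := hmono' (by omega : m + 1 ≤ n) (hfm m)
    have hc : T (f m) ∈ V n := hmono' (by omega : m ≤ n) ((hVsucc m _).1 (hfm m))
    exact (V n).sub_mem ((V n).add_mem ha hb) hc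
  obtain ⟨C, hC, hC'⟩ := hK.image_closedBall_subset_compact 3
  obtain ⟨z, hz, ψ, hψ, hψz⟩ := hC.tendsto_subseq
    (x := fun n => K (f n)) (fun n => hC' ⟨f n, by simpa using hfn n, rfl⟩)
  have hc := hψz.cauchySeq
  rw [Metric.cauchySeq_iff'] at hc
  obtain ⟨M, hM⟩ := hc 1 one_pos
  have h1 := hM (M + 1) (by omega)
  rw [dist_eq_norm] at h1
  have h2 := hsep (ψ M) (ψ (M + 1)) (hψ (by omega))
  simp only [Function.comp] at h1
  linarith

end Fredholm

/-! ### Part 2: Runge approximation -/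

section Runge

theorem no_log_on_circle (a : ℂ) (ρ : ℝ) (hρ : 0 < ρ) (Λ : ℂ → ℂ) (hc : Continuous Λ)
    (h : ∀ z, ‖z - a‖ = ρ → Complex.exp (Λ z) = z - a) : False := by
  set c : ℝ → ℂ := fun t => a + ρ * Complex.exp (t * Complex.I) with hcdef
  set m : ℝ → ℂ := fun t => Λ (c t) - t * Complex.I with hm
  have hexp : ∀ t, Complex.exp (m t) = ρ := by
    intro t
    have h1 : ‖c t - a‖ = ρ := by
      simp [hcdef, Complex.norm_exp_ofReal_mul_I, abs_of_pos hρ]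
    have h2 := h (c t) h1
    simp only [hm, Complex.exp_sub, h2]
    simp [hcdef]
  have hcont : Continuous fun t => ((m t).im - (m 0).im) / (2 * Real.pi) := by
    simp only [hm, hcdef]; fun_prop
  have hInt0 : ∀ t, ∃ n : ℤ, m t = m 0 + n * (2 * Real.pi * Complex.I) := fun t =>
    Complex.exp_eq_exp_iff_exists_int.1 ((hexp t).trans (hexp 0).symm)
  have hval : ∀ t, ∃ n : ℤ, ((m t).im - (m 0).im) / (2 * Real.pi) = n := by
    intro t
    obtain ⟨n, hn⟩ := hInt0 t
    refine ⟨n, ?_⟩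
    rw [hn]
    have := Real.pi_pos
    simp
  -- continuous integer valued function is constant
  have hconst : ∀ t, ((m t).im - (m 0).im) / (2 * Real.pi) = 0 := by
    choose n hn using hval
    have hcn : Continuous (fun t => (n t : ℝ)) := by
      have : (fun t => (n t : ℝ)) = fun t => ((m t).im - (m 0).im) / (2 * Real.pi) := by
        funext t; rw [hn]
      rw [this]; exact hcont
    have hcn' : Continuous n := by
      have := Int.isClosedEmbedding_coe_real.isInducing.continuous_iff (f := n)
      exact this.2 hcn
    intro t
    have h0 : n t = n 0 := PreconnectedSpace.constant inferInstance hcn'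
    have h00 := hn 0
    rw [hn t, h0, ← h00]; simp
  have h2 := hconst (2 * Real.pi)
  have hc2 : c (2 * Real.pi) = c 0 := by
    simp [hcdef]
  have hpi := Real.pi_pos
  simp only [hm, hc2] at h2
  simp at h2

variable (L : Set ℂ) [CompactSpace L]

/-- closed algebra generated by polynomials on a compact set -/
noncomputable abbrev PA : Subalgebra ℂ C(L, ℂ) := (polynomialFunctions L).topologicalClosure

instance PA_closed : IsClosed ((PA L : Subalgebra ℂ C(L, ℂ)) : Set C(L, ℂ)) :=
  Subalgebra.isClosed_topologicalClosure _

instance PA_complete : CompleteSpace (PA L) := (PA_closed L).completeSpace_coe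

theorem poly_mem_PA (q : Polynomial ℂ) : Polynomial.toContinuousMapOn q L ∈ PA L :=
  Subalgebra.le_topologicalClosure _ ⟨q, trivial, rfl⟩

/-- coordinate function -/
noncomputable def xA : PA L := ⟨Polynomial.toContinuousMapOn Polynomial.X L, poly_mem_PA L _⟩

theorem xA_val (y : L) : (xA L : C(L, ℂ)) y = y := by
  simp [xA]

theorem L_sub_spectrum : L ⊆ spectrum ℂ (xA L) := by
  intro y hy
  rw [spectrum.mem_iff]
  intro hu
  obtain ⟨b, hb⟩ := hu.exists_right_inv
  have := congrArg (fun g : PA L => (g : C(L, ℂ)) ⟨y, hy⟩) hb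
  simp [xA_val] at this

theorem frontier_sub : frontier (spectrum ℂ (xA L)) ⊆ L := by
  refine (Subalgebra.frontier_spectrum (𝕜 := ℂ) (PA L) (xA L)).trans ?_
  rw [ContinuousMap.spectrum_eq_range]
  rintro _ ⟨y, rfl⟩
  rw [xA_val]; exact y.2

theorem spectrum_sub_D (D : Set ℂ) (hD : IsOpen D) (hsc : SimplyConnectedSpace D) (hLD : L ⊆ D) :
    spectrum ℂ (xA L) ⊆ D := by
  classical
  intro a ha
  by_contra haD
  have hLc : IsCompact L := isCompact_iff_compactSpace.2 inferInstance
  obtain ⟨F, hFc, hF⟩ := Complex.exists_continuousOn_eqOn_exp_comp (X := ℂ) (U := D) hsc hD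
    (g := fun x => x - a) (by fun_prop) (by
      rintro ⟨z, hz, h0⟩
      exact haD (by rwa [← sub_eq_zero.1 h0]))
  obtain ⟨G, hG⟩ := ContinuousMap.exists_restrict_eq hLc.isClosed
    (⟨L.domRestrict F, (hFc.mono hLD).domRestrict⟩ : C(L, ℂ))
  have hG' : ∀ y ∈ L, G y = F y := fun y hy => by
    have := congrArg (fun g : C(L, ℂ) => g ⟨y, hy⟩) hG
    exact this
  set Sg := spectrum ℂ (xA L)
  set φ : ℂ → ℂ := piecewise Sg (fun x => Complex.exp (G x)) (fun x => x - a) with hφ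
  have hφc : Continuous φ := by
    refine Continuous.piecewise ?_ (by fun_prop) (by fun_prop)
    intro y hy
    have hyL := frontier_sub L hy
    simp only [hG' y hyL]
    exact hF (hLD hyL)
  have hφ0 : ∀ x, φ x ≠ 0 := by
    intro x
    by_cases hx : x ∈ Sg
    · simp [hφ, hx]
    · simp only [hφ, piecewise_eq_of_notMem _ _ _ hx]
      intro h
      exact hx (by rw [sub_eq_zero.1 h]; exact ha)
  have huniv : IsSimplyConnected (univ : Set ℂ) := by
    have : ContractibleSpace (univ : Set ℂ) := convex_univ.contractibleSpace ⟨0, trivial⟩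
    show SimplyConnectedSpace _
    infer_instance
  obtain ⟨Λ, hΛc, hΛ⟩ := Complex.exists_continuousOn_eqOn_exp_comp (X := ℂ) (U := univ) huniv
    isOpen_univ (g := φ) hφc.continuousOn (by rintro ⟨z, -, h0⟩; exact hφ0 z h0)
  have hb : Bornology.IsBounded Sg := (spectrum.isCompact (xA L)).isBounded
  obtain ⟨ρ, hρ⟩ := hb.subset_ball a
  have hρ0 : 0 < ρ := by
    by_contra h
    have := hρ ha
    rw [Metric.ball_eq_empty.2 (not_lt.1 h)] at this
    exact this
  refine no_log_on_circle a ρ hρ0 Λ (by rwa [← continuousOn_univ]) ?_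
  intro z hz
  have h1 := hΛ (mem_univ z)
  have : z ∉ Sg := fun h => by
    have := hρ h
    rw [Metric.mem_ball, dist_eq_norm] at this
    linarith
  simpa [hφ, this] using h1

end Runge
theorem log_sub_log_neg_of_im_pos {c : ℂ} (h : 0 < c.im) :
    Complex.log c - Complex.log (-c) = Real.pi * Complex.I := by
  rw [Complex.log, Complex.log, Complex.arg_neg_eq_arg_sub_pi_of_im_pos h, norm_neg]
  push_cast; ring

theorem log_sub_log_neg_of_im_neg {c : ℂ} (h : c.im < 0) :
    Complex.log c - Complex.log (-c) = -(Real.pi * Complex.I) := by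
  rw [Complex.log, Complex.log, Complex.arg_neg_eq_arg_add_pi_of_im_neg h, norm_neg]
  push_cast; ring

/-- horizontal or vertical side of the rectangle -/
theorem side_integral (e c v : ℂ) (he : e ≠ 0) (M : ℝ) (hv : v ≠ 0)
    (hs : ∀ t ∈ uIcc (-M) M, e * (c + t * v) ∈ Complex.slitPlane) :
    v * ∫ t in (-M)..M, (c + (t : ℂ) * v)⁻¹ =
      Complex.log (e * (c + M * v)) - Complex.log (e * (c + (-M : ℝ) * v)) := by
  rw [← intervalIntegral.integral_const_mul]
  rw [intervalIntegral.integral_eq_sub_of_hasDerivAt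
    (f := fun t : ℝ => Complex.log (e * (c + t * v)))]
  · intro t ht
    have h1 : HasDerivAt (fun t : ℝ => e * (c + (t : ℂ) * v)) (e * (1 * v)) t := by
      have := ((((hasDerivAt_id (t : ℂ)).mul_const v).const_add c).const_mul e).comp_ofReal
      simpa using this
    have h2 := h1.clog_real (hs t ht)
    refine h2.congr_deriv ?_
    have hne : c + t * v ≠ 0 := fun h => by
      have := Complex.slitPlane_ne_zero (hs t ht)
      rw [h] at this; simp at this
    show e * (1 * v) / (e * (c + t * v)) = v * (c + t * v)⁻¹
    rw [one_mul, mul_div_mul_left _ _ he, div_eq_mul_inv]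
  · apply ContinuousOn.intervalIntegrable
    intro t ht
    have hne : c + t * v ≠ 0 := fun h => by
      have := Complex.slitPlane_ne_zero (hs t ht)
      rw [h] at this; simp at this
    apply ContinuousAt.continuousWithinAt
    exact (continuousAt_const.mul (ContinuousAt.inv₀ (by fun_prop) hne))

theorem rect_integral_inv (y : ℂ) (M : ℝ) (h1 : |y.re| < M) (h2 : |y.im| < M) :
    (∫ x : ℝ in (-M)..M, ((x : ℂ) + (-M : ℝ) * Complex.I - y)⁻¹)
      - (∫ x : ℝ in (-M)..M, ((x : ℂ) + (M : ℝ) * Complex.I - y)⁻¹)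
      + Complex.I * (∫ t : ℝ in (-M)..M, ((M : ℝ) + (t : ℂ) * Complex.I - y)⁻¹)
      - Complex.I * (∫ t : ℝ in (-M)..M, ((-M : ℝ) + (t : ℂ) * Complex.I - y)⁻¹)
      = 2 * Real.pi * Complex.I := by
  have ⟨h1a, h1b⟩ := abs_lt.1 h1
  have ⟨h2a, h2b⟩ := abs_lt.1 h2
  have hbot := side_integral 1 ((-M : ℝ) * Complex.I - y) 1 one_ne_zero M one_ne_zero (by
    intro t _; right; simp; intro h; linarith)
  have htop := side_integral 1 ((M : ℝ) * Complex.I - y) 1 one_ne_zero M one_ne_zero (by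
    intro t _; right; simp; intro h; linarith)
  have hright := side_integral 1 ((M : ℝ) - y) Complex.I one_ne_zero M Complex.I_ne_zero (by
    intro t _; left; simp; linarith)
  have hleft := side_integral (-1) ((-M : ℝ) - y) Complex.I (by simp) M Complex.I_ne_zero (by
    intro t _; left; simp; linarith)
  have e1 := log_sub_log_neg_of_im_pos (c := -M + M * Complex.I - y) (by simp; linarith)
  have e2 := log_sub_log_neg_of_im_neg (c := -M - M * Complex.I - y) (by simp; linarith)
  have r1 : ∀ x : ℝ, (x : ℂ) + (-M : ℝ) * Complex.I - y = (-M : ℝ) * Complex.I - y + x * 1 := by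
    intro x; ring
  have r2 : ∀ x : ℝ, (x : ℂ) + (M : ℝ) * Complex.I - y = (M : ℝ) * Complex.I - y + x * 1 := by
    intro x; ring
  have r3 : ∀ x : ℝ, (M : ℝ) + (x : ℂ) * Complex.I - y = (M : ℝ) - y + x * Complex.I := by
    intro x; ring
  have r4 : ∀ x : ℝ, (-M : ℝ) + (x : ℂ) * Complex.I - y = (-M : ℝ) - y + x * Complex.I := by
    intro x; ring
  simp only [r1, r2, r3, r4]
  rw [hright, hleft]
  rw [one_mul] at hbot htop
  rw [hbot, htop]
  have a1 : (1 : ℂ) * ((-M : ℝ) * Complex.I - y + M * 1) = M - M * Complex.I - y := by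
    push_cast; ring
  have a2 : (1 : ℂ) * ((-M : ℝ) * Complex.I - y + (-M : ℝ) * 1) = -M - M * Complex.I - y := by
    push_cast; ring
  have a3 : (1 : ℂ) * ((M : ℝ) * Complex.I - y + M * 1) = M + M * Complex.I - y := by
    ring
  have a4 : (1 : ℂ) * ((M : ℝ) * Complex.I - y + (-M : ℝ) * 1) = -M + M * Complex.I - y := by
    push_cast; ring
  have a5 : (1 : ℂ) * ((M : ℝ) - y + M * Complex.I) = M + M * Complex.I - y := by
    ring
  have a6 : (1 : ℂ) * ((M : ℝ) - y + (-M : ℝ) * Complex.I) = M - M * Complex.I - y := by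
    push_cast; ring
  have a7 : (-1 : ℂ) * ((-M : ℝ) - y + M * Complex.I) = -(-M + M * Complex.I - y) := by
    push_cast; ring
  have a8 : (-1 : ℂ) * ((-M : ℝ) - y + (-M : ℝ) * Complex.I) = -(-M - M * Complex.I - y) := by
    push_cast; ring
  rw [a1, a2, a3, a4, a5, a6, a7, a8]
  linear_combination e1 - e2

open Complex in
/-- Cauchy-Pompeiu with a cut-off function -/
theorem cauchy_pompeiu (u : ℂ → ℂ) (u' : ℂ → ℂ →L[ℝ] ℂ) (M : ℝ)
    (hu : ∀ z, HasFDerivAt u (u' z) z) (φ : ℂ → ℂ) (hφ : ∀ z, φ z = I * u' z 1 - u' z I)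
    (hφc : Continuous φ) (y : ℂ) (hM1 : |y.re| < M) (hM2 : |y.im| < M)
    (hsupp : ∀ z, M ≤ ‖z‖ → u z = 0) (hy : DifferentiableAt ℂ u y) (hφy : ∀ᶠ z in 𝓝 y, φ z = 0) :
    ∫ x : ℝ in (-M)..M, ∫ t : ℝ in (-M)..M, φ (x + t * I) * ((x + t * I : ℂ) - y)⁻¹ =
      - (u y * (2 * Real.pi * I)) := by
  have ⟨h1a, h1b⟩ := abs_lt.1 hM1
  have ⟨h2a, h2b⟩ := abs_lt.1 hM2
  have hM : 0 < M := by linarith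
  set F := dslope u y with hF
  set F' : ℂ → ℂ →L[ℝ] ℂ := fun z => (z - y)⁻¹ • u' z -
    ((u z - u y) * ((z - y) ^ 2)⁻¹) • (1 : ℂ →L[ℝ] ℂ) with hF'
  have hFd : ∀ z, z ≠ y → HasFDerivAt F (F' z) z := by
    intro z hz
    have hzy : z - y ≠ 0 := sub_ne_zero.2 hz
    have e : F =ᶠ[𝓝 z] fun z => (z - y)⁻¹ * (u z - u y) := by
      filter_upwards [isOpen_ne.mem_nhds hz] with w hw
      rw [hF, dslope_of_ne _ hw, slope_def_field]; ring
    refine HasFDerivAt.congr_of_eventuallyEq ?_ e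
    have hi : HasFDerivAt (fun z : ℂ => (z - y)⁻¹)
        ((-((z - y) ^ 2)⁻¹) • (1 : ℂ →L[ℝ] ℂ)) z := by
      have := ((hasDerivAt_id z).sub_const y).inv hzy
      have h2 := this.hasFDerivAt.restrictScalars ℝ
      refine HasFDerivAt.congr_fderiv (f := fun z : ℂ => (z - y)⁻¹) h2 ?_
      ext; simp [neg_div, mul_comm]
    refine HasFDerivAt.congr_fderiv (f := fun z : ℂ => (z - y)⁻¹ * (u z - u y))
      (hi.mul ((hu z).sub_const (u y))) ?_
    ext; simp [hF']; ring
  have hκ : ∀ z, I • F' z 1 - F' z I = φ z * (z - y)⁻¹ := by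
    intro z
    simp only [hF', hφ]
    simp
    ring
  have hcont : Continuous fun z => φ z * (z - y)⁻¹ := by
    rw [continuous_iff_continuousAt]
    intro z
    by_cases hz : z = y
    · subst hz
      have : (fun z' => φ z' * (z' - z)⁻¹) =ᶠ[𝓝 z] fun _ => 0 := by
        filter_upwards [hφy] with w hw
        simp [hw]
      exact (continuousAt_congr this).2 continuousAt_const
    · exact hφc.continuousAt.mul (ContinuousAt.inv₀ (by fun_prop) (sub_ne_zero.2 hz))
  have key := Complex.integral_boundary_rect_of_hasFDerivAt_real_off_countable F F'
    ((-M : ℝ) + (-M : ℝ) * I) (M + M * I) {y} (countable_singleton y)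
    (by
      intro z _
      apply ContinuousAt.continuousWithinAt
      by_cases hz : z = y
      · subst hz; exact continuousAt_dslope_same.2 hy
      · exact (hFd z hz).continuousAt)
    (by rintro z ⟨-, hz⟩; exact hFd z hz)
    (by
      simp only [hκ]
      apply hcont.continuousOn.integrableOn_compact
      exact (isCompact_uIcc.reProdIm isCompact_uIcc))
  simp only [hκ] at key
  have hre1 : ((-M : ℝ) + (-M : ℝ) * I : ℂ).re = -M := by simp
  have him1 : ((-M : ℝ) + (-M : ℝ) * I : ℂ).im = -M := by simp
  have hre2 : (M + M * I : ℂ).re = M := by simp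
  have him2 : (M + M * I : ℂ).im = M := by simp
  rw [hre1, him1, hre2, him2] at key
  rw [← key]
  have hFb : ∀ z : ℂ, (|z.re| = M ∨ |z.im| = M) → F z = -u y * (z - y)⁻¹ := by
    intro z hz
    have hzM : M ≤ ‖z‖ := by
      rcases hz with h | h
      · rw [← h]; exact abs_re_le_norm z
      · rw [← h]; exact abs_im_le_norm z
    have hzy : z ≠ y := by
      rintro rfl
      rcases hz with h | h <;> linarith
    rw [hF, dslope_of_ne _ hzy, slope_def_field, hsupp z hzM]; ring
  have b1 : ∀ x : ℝ, F (x + (-M : ℝ) * I) = -u y * (x + (-M : ℝ) * I - y)⁻¹ := fun x =>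
    hFb _ (by right; simp [abs_of_pos hM])
  have b2 : ∀ x : ℝ, F (x + (M : ℝ) * I) = -u y * (x + (M : ℝ) * I - y)⁻¹ := fun x =>
    hFb _ (by right; simp [abs_of_pos hM])
  have b3 : ∀ x : ℝ, F ((M : ℝ) + x * I) = -u y * ((M : ℝ) + x * I - y)⁻¹ := fun x =>
    hFb _ (by left; simp [abs_of_pos hM])
  have b4 : ∀ x : ℝ, F ((-M : ℝ) + x * I) = -u y * ((-M : ℝ) + x * I - y)⁻¹ := fun x =>
    hFb _ (by left; simp [abs_of_pos hM])
  simp only [b1, b2, b3, b4, intervalIntegral.integral_const_mul]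
  have := rect_integral_inv y M hM1 hM2
  simp only [smul_eq_mul]
  linear_combination (-u y) * this

open Complex in
theorem runge (L : Set ℂ) [CompactSpace L] (D : Set ℂ) (hD : IsOpen D)
    (hsc : SimplyConnectedSpace D) (hLD : L ⊆ D) (f : ℂ → ℂ) (hf : DifferentiableOn ℂ f D) :
    ∃ g ∈ PA L, ∀ y : L, g y = f y := by
  set Sg := spectrum ℂ (xA L) with hSg
  have hSgc : IsCompact Sg := spectrum.isCompact _
  have hSD : Sg ⊆ D := spectrum_sub_D L D hD hsc hLD
  have hLS : L ⊆ Sg := L_sub_spectrum L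
  obtain ⟨t, htc, hSt, htD⟩ := exists_compact_between hSgc hD hSD
  obtain ⟨χ, hχ1, hχ0, -⟩ := exists_contMDiffMap_one_nhds_of_subset_interior
    (n := 1) (modelWithCornersSelf ℝ ℂ) hSgc.isClosed hSt
  have hχd : ContDiff ℝ 1 χ := χ.contMDiff.contDiff
  have hχdiff : Differentiable ℝ χ := hχd.differentiable (by simp)
  obtain ⟨U, hUo, hSU, hU1⟩ := eventually_nhdsSet_iff_exists.1 hχ1
  obtain ⟨M, hM⟩ := htc.isBounded.subset_ball 0
  have htco : IsOpen tᶜ := htc.isClosed.isOpen_compl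
  have hχD : ∀ z, z ∈ tᶜ → ∀ᶠ w in 𝓝 z, χ w = 0 := fun z hz => by
    filter_upwards [htco.mem_nhds hz] with w hw using hχ0 w hw
  set κ : ℂ → ℂ := fun z => I * (fderiv ℝ χ z 1 : ℝ) - (fderiv ℝ χ z I : ℝ) with hκ
  have hκc : Continuous κ := by
    have h1 : Continuous (fderiv ℝ χ) := hχd.continuous_fderiv (by simp)
    simp only [hκ]
    fun_prop
  have hκt : ∀ z ∈ tᶜ, κ z = 0 := fun z hz => by
    have : χ =ᶠ[𝓝 z] fun _ => (0 : ℝ) := hχD z hz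
    simp [hκ, this.fderiv_eq]
  have hκU : ∀ z ∈ U, κ z = 0 := fun z hz => by
    have : χ =ᶠ[𝓝 z] fun _ => (1 : ℝ) := by
      filter_upwards [hUo.mem_nhds hz] with w hw using hU1 w hw
    simp [hκ, this.fderiv_eq]
  set u : ℂ → ℂ := fun z => (χ z : ℂ) * f z with hu
  set u' : ℂ → ℂ →L[ℝ] ℂ := fun z => fderiv ℝ u z with hu'
  have hfd : ∀ z ∈ D, HasDerivAt f (deriv f z) z := fun z hz =>
    (hf.differentiableAt (hD.mem_nhds hz)).hasDerivAt
  have hfr : ∀ z ∈ D, HasFDerivAt f (((1 : ℂ →L[ℂ] ℂ).smulRight (deriv f z)).restrictScalars ℝ) z :=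
    fun z hz => (hfd z hz).hasFDerivAt.restrictScalars ℝ
  have huD : ∀ z ∈ D, HasFDerivAt u ((χ z : ℂ) •
      (((1 : ℂ →L[ℂ] ℂ).smulRight (deriv f z)).restrictScalars ℝ)
      + f z • (ofRealCLM.comp (fderiv ℝ χ z))) z := fun z hz => by
    have h1 : HasFDerivAt (fun z => (χ z : ℂ)) (ofRealCLM.comp (fderiv ℝ χ z)) z :=
      ofRealCLM.hasFDerivAt.comp z (hχdiff z).hasFDerivAt
    exact h1.mul (hfr z hz)
  have hut : ∀ z ∈ tᶜ, u =ᶠ[𝓝 z] fun _ => 0 := fun z hz => by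
    filter_upwards [hχD z hz] with w hw
    simp [hu, hw]
  have hDt : ∀ z, z ∈ D ∨ z ∈ tᶜ := fun z => by
    by_cases h : z ∈ t
    · exact Or.inl (htD h)
    · exact Or.inr h
  have hud : ∀ z, HasFDerivAt u (u' z) z := by
    intro z
    rcases hDt z with hz | hz
    · exact (huD z hz).differentiableAt.hasFDerivAt
    · have : DifferentiableAt ℝ u z :=
        (differentiableAt_const (0 : ℂ)).congr_of_eventuallyEq (hut z hz)
      exact this.hasFDerivAt
  set φ : ℂ → ℂ := fun z => κ z * f z with hφ
  have hφu : ∀ z, φ z = I * u' z 1 - u' z I := by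
    intro z
    rcases hDt z with hz | hz
    · simp only [hu', (huD z hz).fderiv]
      simp [hφ, hκ]
      ring
    · have : u' z = 0 := by
        simp only [hu', (hut z hz).fderiv_eq]; simp
      simp [this, hφ, hκt z hz]
  have hφc : Continuous φ := by
    rw [continuous_iff_continuousAt]
    intro z
    rcases hDt z with hz | hz
    · exact hκc.continuousAt.mul (hfd z hz).continuousAt
    · have : φ =ᶠ[𝓝 z] fun _ => 0 := by
        filter_upwards [htco.mem_nhds hz] with w hw
        simp [hφ, hκt w hw]
      exact (continuousAt_congr this).2 continuousAt_const
  have hφU : ∀ z ∈ U, φ z = 0 := fun z hz => by simp [hφ, hκU z hz]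
  set Φ : ℂ → PA L := fun z => φ z • resolvent (xA L) z with hΦ
  have hΦc : Continuous Φ := by
    rw [continuous_iff_continuousAt]
    intro z
    by_cases hz : z ∈ Sg
    · have : Φ =ᶠ[𝓝 z] fun _ => 0 := by
        filter_upwards [hUo.mem_nhds (hSU hz)] with w hw
        simp [hΦ, hφU w hw]
      exact (continuousAt_congr this).2 continuousAt_const
    · exact hφc.continuousAt.smul (spectrum.hasDerivAt_resolvent_const_left
        (spectrum.notMem_iff.1 hz)).continuousAt
  set J : PA L := ∫ x : ℝ in (-M)..M, ∫ s : ℝ in (-M)..M, Φ (x + s * I) with hJ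
  refine ⟨((-(2 * Real.pi * I)⁻¹) • J : PA L), (((-(2 * Real.pi * I)⁻¹) • J : PA L)).2, ?_⟩
  intro y
  set ev : PA L →L[ℂ] ℂ := (ContinuousMap.evalCLM ℂ y).comp (PA L).toSubmodule.subtypeL with hev
  have hevΦ : ∀ z, ev (Φ z) = φ z * (z - y)⁻¹ := by
    intro z
    by_cases hz : z ∈ Sg
    · simp [hΦ, hφU z (hSU hz)]
    · have hr : z ∈ resolventSet ℂ (xA L) := spectrum.notMem_iff.1 hz
      have h1 : (algebraMap ℂ (PA L) z - xA L) * resolvent (xA L) z = 1 := by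
        rw [resolvent]
        exact Ring.mul_inverse_cancel _ hr
      have h2 := congrArg (fun g : PA L => (g : C(L, ℂ)) y) h1
      have h3 : (z - y) * ((resolvent (xA L) z : PA L) : C(L, ℂ)) y = 1 := by
        simpa [xA_val] using h2
      have h4 : ((resolvent (xA L) z : PA L) : C(L, ℂ)) y = (z - y)⁻¹ :=
        eq_inv_of_mul_eq_one_right h3
      rw [← h4]
      rfl
  have hinner : ∀ x : ℝ, ev (∫ s : ℝ in (-M)..M, Φ (x + s * I)) =
      ∫ s : ℝ in (-M)..M, φ (x + s * I) * ((x + s * I : ℂ) - y)⁻¹ := by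
    intro x
    rw [← ev.intervalIntegral_comp_comm]
    · simp only [hevΦ]
    · exact (by fun_prop : Continuous fun s : ℝ => Φ (x + s * I)).intervalIntegrable _ _
  have hevJ : ev J = ∫ x : ℝ in (-M)..M, ∫ s : ℝ in (-M)..M,
      φ (x + s * I) * ((x + s * I : ℂ) - y)⁻¹ := by
    rw [hJ, ← ev.intervalIntegral_comp_comm]
    · simp only [hinner]
    · apply Continuous.intervalIntegrable
      apply intervalIntegral.continuous_parametric_intervalIntegral_of_continuous'
      fun_prop
  have hyS : (y : ℂ) ∈ Sg := hLS y.2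
  have hyt : (y : ℂ) ∈ t := interior_subset (hSt hyS)
  have hyM : ‖(y : ℂ)‖ < M := by simpa using hM hyt
  have hχy : χ y = 1 := hU1 y (hSU hyS)
  rw [cauchy_pompeiu u u' M hud φ hφu hφc y ((abs_re_le_norm _).trans_lt hyM)
    ((abs_im_le_norm _).trans_lt hyM) ?_ ?_ ?_] at hevJ
  · have : ((-(2 * Real.pi * I)⁻¹) • J : PA L).1 y = -(2 * Real.pi * I)⁻¹ * ev J := rfl
    rw [this, hevJ]
    have hpi : (Real.pi : ℂ) ≠ 0 := by exact_mod_cast Real.pi_ne_zero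
    simp only [hu, hχy]
    field_simp
    simp
  · intro z hz
    have : z ∉ t := fun h => by
      have := hM h
      simp at this
      linarith
    simp [hu, hχ0 z this]
  · have : u =ᶠ[𝓝 (y : ℂ)] f := by
      filter_upwards [hUo.mem_nhds (hSU hyS)] with w hw
      simp [hu, hU1 w hw]
    exact (hfd y (hSD hyS)).differentiableAt.congr_of_eventuallyEq this
  · filter_upwards [hUo.mem_nhds (hSU hyS)] with w hw using hφU w hw

/-! ### Part 3: the scalar integral operator -/

section Scalar

open Polynomial in
/-- The polynomial with simple roots at the singular points. -/
noncomputable def nodQ {n : ℕ} (p : Fin n → ℂ) : ℂ[X] := ∏ j, (X - C (p j))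

open Polynomial in
theorem nodQ_monic {n : ℕ} (p : Fin n → ℂ) : (nodQ p).Monic :=
  monic_prod_of_monic _ _ fun j _ => monic_X_sub_C (p j)

open Polynomial in
theorem nodQ_natDegree {n : ℕ} (p : Fin n → ℂ) : (nodQ p).natDegree = n := by
  rw [nodQ, natDegree_prod_of_monic _ _ fun j _ => monic_X_sub_C (p j)]
  simp

open Polynomial in
theorem nodQ_eval {n : ℕ} (p : Fin n → ℂ) (x : ℂ) : (nodQ p).eval x = ∏ j, (x - p j) := by
  simp [nodQ, eval_prod]

open Polynomial in
/-- division by `Q` as a linear map -/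
noncomputable def divQ {n : ℕ} (p : Fin n → ℂ) : ℂ[X] →ₗ[ℂ] ℂ[X] where
  toFun v := v /ₘ nodQ p
  map_add' a b := by
    refine (div_modByMonic_unique (f := a + b) (a /ₘ nodQ p + b /ₘ nodQ p) (a %ₘ nodQ p + b %ₘ nodQ p) (nodQ_monic p) ⟨?_, ?_⟩).1
    · linear_combination modByMonic_add_div a (nodQ p) + modByMonic_add_div b (nodQ p)
    · exact (degree_add_le _ _).trans_lt (max_lt (degree_modByMonic_lt _ (nodQ_monic p))
        (degree_modByMonic_lt _ (nodQ_monic p)))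
  map_smul' c a := by
    refine (div_modByMonic_unique (f := c • a) (c • (a /ₘ nodQ p)) (c • (a %ₘ nodQ p)) (nodQ_monic p) ⟨?_, ?_⟩).1
    · rw [mul_smul_comm, ← smul_add, modByMonic_add_div a (nodQ p)]
    · exact (degree_smul_le _ _).trans_lt (degree_modByMonic_lt _ (nodQ_monic p))

open Polynomial in
/-- interpolation polynomial -/
noncomputable def rpoly {n : ℕ} (p : Fin n → ℂ) : (Fin n → ℂ) →ₗ[ℂ] ℂ[X] :=
  Lagrange.interpolate Finset.univ p

open Polynomial in
theorem rpoly_degree {n : ℕ} (p : Fin n → ℂ) (hp : Function.Injective p) (c : Fin n → ℂ) :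
    (rpoly p c).degree < n := by
  have := Lagrange.degree_interpolate_lt (s := Finset.univ) (v := p) c hp.injOn
  rw [Finset.card_univ, Fintype.card_fin] at this
  exact this

open Polynomial in
theorem rpoly_eval {n : ℕ} (p : Fin n → ℂ) (hp : Function.Injective p) (c : Fin n → ℂ) (j : Fin n) :
    (rpoly p c).eval (p j) = c j :=
  Lagrange.eval_interpolate_at_node c hp.injOn (Finset.mem_univ j)

open Polynomial in
theorem eq_rpoly {n : ℕ} (p : Fin n → ℂ) (hp : Function.Injective p) (c : Fin n → ℂ) (f : ℂ[X])
    (hd : f.degree < n) (h : ∀ j, f.eval (p j) = c j) : f = rpoly p c :=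
  Lagrange.eq_interpolate_of_eval_eq c hp.injOn (by simpa using hd) (fun j _ => h j)

open Polynomial in
theorem div_decomp {n : ℕ} (p : Fin n → ℂ) (hp : Function.Injective p) (v : ℂ[X]) :
    v = rpoly p (fun j => v.eval (p j)) + nodQ p * divQ p v := by
  have h := modByMonic_add_div v (nodQ p)
  have : v %ₘ nodQ p = rpoly p (fun j => v.eval (p j)) := by
    apply eq_rpoly p hp
    · have := degree_modByMonic_lt v (nodQ_monic p)
      rwa [degree_eq_natDegree (nodQ_monic p).ne_zero, nodQ_natDegree] at this
    · intro j
      have h2 := congrArg (eval (p j)) h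
      rw [eval_add, eval_mul, nodQ_eval, Finset.prod_eq_zero (Finset.mem_univ j) (sub_self _)] at h2
      simpa using h2
  rw [← this]
  exact h.symm

open Polynomial in
theorem div_unique {n : ℕ} (p : Fin n → ℂ) (q r : ℂ[X]) (hd : r.degree < n) :
    divQ p (nodQ p * q + r) = q := by
  refine (div_modByMonic_unique q r (nodQ_monic p) ⟨by ring, ?_⟩).1
  rwa [degree_eq_natDegree (nodQ_monic p).ne_zero, nodQ_natDegree]

open Polynomial in
/-- a primitive of a polynomial -/
noncomputable def prim0 : ℂ[X] →ₗ[ℂ] ℂ[X] :=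
  Polynomial.lsum fun n => ((n : ℂ) + 1)⁻¹ • Polynomial.monomial (n + 1)

open Polynomial in
theorem derivative_prim0 (q : ℂ[X]) : derivative (prim0 q) = q := by
  have : derivative.comp prim0 = LinearMap.id (R := ℂ) (M := ℂ[X]) := by
    apply Polynomial.lhom_ext'
    intro n
    ext
    simp [prim0]
    have : (n : ℂ) + 1 ≠ 0 := Nat.cast_add_one_ne_zero n
    field_simp
    simp only [coeff_monomial]
    split_ifs <;> simp
  exact LinearMap.congr_fun this q

open Polynomial in
/-- primitive vanishing at a base point -/
noncomputable def primP (a : ℂ) : ℂ[X] →ₗ[ℂ] ℂ[X] :=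
  prim0 - (monomial 0).comp ((Polynomial.leval a).comp prim0)

open Polynomial in
theorem derivative_primP (a : ℂ) (q : ℂ[X]) : derivative (primP a q) = q := by
  simp [primP, derivative_prim0]

open Polynomial in
theorem primP_eval (a : ℂ) (q : ℂ[X]) : (primP a q).eval a = 0 := by
  simp [primP, Polynomial.leval]

open Polynomial in
theorem primP_derivative (a : ℂ) (q : ℂ[X]) : primP a (derivative q) = q - C (q.eval a) := by
  have h : derivative (primP a (derivative q) - q) = 0 := by
    rw [derivative_sub, derivative_primP, sub_self]
  have h2 := Polynomial.derivative_eq_zero.1 h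
  rw [natDegree_eq_zero] at h2
  obtain ⟨c, hc⟩ := h2
  have h3 := congrArg (eval a) hc
  rw [eval_sub, primP_eval, eval_C] at h3
  rw [h3] at hc
  have : primP a (derivative q) = q + (primP a (derivative q) - q) := by ring
  rw [this, ← hc]; simp [sub_eq_add_neg]

open Polynomial in
/-- the operator on polynomials -/
noncomputable def G0 {S : ℕ} (p : Fin (S + 2) → ℂ) : ℂ[X] →ₗ[ℂ] ℂ[X] :=
  (primP (p 0)).comp (divQ p) +
    (monomial 0).comp ((lcoeff ℂ (S + 1)).comp ((rpoly p).comp (LinearMap.pi fun j => leval (p j))))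

open Polynomial in
/-- top coefficient of the interpolation polynomial -/
noncomputable def topc {S : ℕ} (p : Fin (S + 2) → ℂ) : (Fin (S + 2) → ℂ) →ₗ[ℂ] ℂ :=
  (lcoeff ℂ (S + 1)).comp (rpoly p)

open Polynomial in
theorem G0_apply {S : ℕ} (p : Fin (S + 2) → ℂ) (v : ℂ[X]) :
    G0 p v = primP (p 0) (divQ p v) + C (topc p fun j => v.eval (p j)) := by
  simp [G0, topc]
  rfl

/-- Nice compact sets. -/
structure Nice {n : ℕ} (D : Set ℂ) (p : Fin n → ℂ) (L : Set ℂ) : Prop where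
  compact : IsCompact L
  preconn : IsPreconnected L
  sub : L ⊆ D
  pin : ∀ j, p j ∈ interior L
  seg : ∀ x ∈ L, ∃ ε > 0, ∀ y ∈ L, dist y x < ε → segment ℝ x y ⊆ L

theorem seg_bound {L : Set ℂ} {w : ℂ → ℂ} (hw : ∀ x ∈ L, DifferentiableAt ℂ w x) {M : ℝ}
    (hM : ∀ x ∈ L, ‖deriv w x‖ ≤ M) {x y : ℂ} (hs : segment ℝ x y ⊆ L) :
    ‖w y - w x‖ ≤ M * ‖y - x‖ :=
  Convex.norm_image_sub_le_of_norm_hasDerivWithin_le (s := segment ℝ x y)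
    (fun z hz => (hw z (hs hz)).hasDerivAt.hasDerivWithinAt) (fun z hz => hM z (hs hz))
    (convex_segment x y) (left_mem_segment ℝ x y) (right_mem_segment ℝ x y)

theorem Nice.prim_bound {n : ℕ} {D : Set ℂ} {p : Fin n → ℂ} {L : Set ℂ} (hL : Nice D p L) (a : ℂ)
    (ha : a ∈ L) :
    ∃ C : ℝ, 0 ≤ C ∧ ∀ (w : ℂ → ℂ) (M : ℝ), (∀ x ∈ L, DifferentiableAt ℂ w x) →
      (∀ x ∈ L, ‖deriv w x‖ ≤ M) → ∀ x ∈ L, ‖w x - w a‖ ≤ C * M := by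
  have hM0 : ∀ (w : ℂ → ℂ) (M : ℝ), (∀ x ∈ L, ‖deriv w x‖ ≤ M) → 0 ≤ M := fun w M h =>
    (norm_nonneg _).trans (h a ha)
  set P : ℂ → ℂ → Prop := fun x y => ∃ C : ℝ, 0 ≤ C ∧ ∀ (w : ℂ → ℂ) (M : ℝ),
    (∀ x ∈ L, DifferentiableAt ℂ w x) → (∀ x ∈ L, ‖deriv w x‖ ≤ M) → ‖w y - w x‖ ≤ C * M with hP
  have hPall : ∀ x ∈ L, ∀ y ∈ L, P x y := by
    intro x hx y hy
    refine hL.preconn.induction₂' P ?_ ?_ hx hy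
    · intro x hx
      obtain ⟨ε, hε, h⟩ := hL.seg x hx
      filter_upwards [self_mem_nhdsWithin, mem_nhdsWithin_of_mem_nhds (Metric.ball_mem_nhds x hε)]
        with y hy hyx
      have hs := h y hy hyx
      refine ⟨⟨‖y - x‖, norm_nonneg _, fun w M hw hM => ?_⟩,
        ⟨‖y - x‖, norm_nonneg _, fun w M hw hM => ?_⟩⟩
      · rw [mul_comm]; exact seg_bound hw hM hs
      · rw [mul_comm, norm_sub_rev]; exact seg_bound hw hM hs
    · rintro x y z - - - ⟨C1, h1, hC1⟩ ⟨C2, h2, hC2⟩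
      refine ⟨C1 + C2, by positivity, fun w M hw hM => ?_⟩
      calc ‖w z - w x‖ = ‖(w y - w x) + (w z - w y)‖ := by congr 1; ring
        _ ≤ C1 * M + C2 * M := (norm_add_le _ _).trans (add_le_add (hC1 w M hw hM) (hC2 w M hw hM))
        _ = _ := by ring
  -- compactness
  refine hL.compact.induction_on (p := fun K => ∃ C : ℝ, 0 ≤ C ∧ ∀ (w : ℂ → ℂ) (M : ℝ),
      (∀ x ∈ L, DifferentiableAt ℂ w x) →
      (∀ x ∈ L, ‖deriv w x‖ ≤ M) → ∀ x ∈ K, ‖w x - w a‖ ≤ C * M) ?_ ?_ ?_ ?_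
  · exact ⟨0, le_rfl, fun w M _ _ x hx => absurd hx (notMem_empty x)⟩
  · rintro s t hst ⟨C, h0, h⟩
    exact ⟨C, h0, fun w M h1 h2 x hx => h w M h1 h2 x (hst hx)⟩
  · rintro s t ⟨C, h0, h⟩ ⟨C', h0', h'⟩
    refine ⟨max C C', le_max_of_le_left h0, fun w M h1 h2 x hx => ?_⟩
    have := hM0 w M h2
    rcases hx with hx | hx
    · exact (h w M h1 h2 x hx).trans (by gcongr; exact le_max_left _ _)
    · exact (h' w M h1 h2 x hx).trans (by gcongr; exact le_max_right _ _)
  · intro x hx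
    obtain ⟨ε, hε, h⟩ := hL.seg x hx
    obtain ⟨C, h0, hC⟩ := hPall a ha x hx
    refine ⟨L ∩ Metric.ball x ε, inter_mem_nhdsWithin _ (Metric.ball_mem_nhds x hε), C + ε,
      by positivity, fun w M hw hM y hy => ?_⟩
    have hs := h y hy.1 hy.2
    have h3 := seg_bound hw hM hs
    have hMn := hM0 w M hM
    have h4 : ‖y - x‖ ≤ ε := by rw [← dist_eq_norm]; exact (Metric.mem_ball.1 hy.2).le
    calc ‖w y - w a‖ = ‖(w x - w a) + (w y - w x)‖ := by congr 1; ring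
      _ ≤ C * M + M * ε := (norm_add_le _ _).trans (add_le_add (hC w M hw hM)
          (h3.trans (by gcongr)))
      _ = _ := by ring

end Scalar

section ScalarBounds

theorem poly_bdd {L : Set ℂ} (hL : IsCompact L) (q : Polynomial ℂ) :
    ∃ C : ℝ, 0 ≤ C ∧ ∀ x ∈ L, ‖q.eval x‖ ≤ C := by
  obtain ⟨C, hC⟩ := hL.exists_bound_of_continuousOn q.continuous.continuousOn
  exact ⟨max C 0, le_max_right _ _, fun x hx => (hC x hx).trans (le_max_left _ _)⟩

theorem rpoly_bound {n : ℕ} (p : Fin n → ℂ) {L : Set ℂ} (hL : IsCompact L) :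
    ∃ C : ℝ, 0 ≤ C ∧ ∀ (c : Fin n → ℂ) (M : ℝ), (∀ j, ‖c j‖ ≤ M) →
      ∀ x ∈ L, ‖(rpoly p c).eval x‖ ≤ C * M := by
  choose C hC0 hC using fun j => poly_bdd hL (Lagrange.basis Finset.univ p j)
  refine ⟨∑ j, C j, Finset.sum_nonneg fun j _ => hC0 j, fun c M hc x hx => ?_⟩
  rw [rpoly, Lagrange.interpolate_apply, Polynomial.eval_finsetSum, Finset.sum_mul]
  refine (norm_sum_le _ _).trans (Finset.sum_le_sum fun j _ => ?_)
  rw [Polynomial.eval_mul, Polynomial.eval_C, norm_mul, mul_comm]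
  exact mul_le_mul (hC j x hx) (hc j) (norm_nonneg _) (hC0 j)

theorem topc_bound {S : ℕ} (p : Fin (S + 2) → ℂ) :
    ∃ C : ℝ, 0 ≤ C ∧ ∀ (c : Fin (S + 2) → ℂ) (M : ℝ), (∀ j, ‖c j‖ ≤ M) →
      ‖topc p c‖ ≤ C * M := by
  refine ⟨‖LinearMap.toContinuousLinearMap (topc p)‖, norm_nonneg _, fun c M hc => ?_⟩
  have h := (LinearMap.toContinuousLinearMap (topc p)).le_opNorm c
  refine h.trans ?_
  gcongr
  exact (pi_norm_le_iff_of_nonneg ((norm_nonneg _).trans (hc 0))).2 hc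

theorem exists_delta {n : ℕ} (p : Fin n → ℂ) (hp : Function.Injective p) {L : Set ℂ}
    (hin : ∀ j, p j ∈ interior L) :
    ∃ δ : ℝ, 0 < δ ∧ (∀ j, Metric.closedBall (p j) δ ⊆ L) ∧
      ∀ i j, i ≠ j → 2 * δ ≤ dist (p i) (p j) := by
  have h1 : ∀ j, ∀ᶠ δ in 𝓝[>] (0 : ℝ), Metric.closedBall (p j) δ ⊆ L := by
    intro j
    obtain ⟨ε, hε, h⟩ := Metric.nhds_basis_closedBall.mem_iff.1 (mem_interior_iff_mem_nhds.1 (hin j))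
    filter_upwards [Ioo_mem_nhdsGT hε] with δ hδ
    exact (Metric.closedBall_subset_closedBall hδ.2.le).trans h
  have h2 : ∀ i j, ∀ᶠ δ in 𝓝[>] (0 : ℝ), i ≠ j → 2 * δ ≤ dist (p i) (p j) := by
    intro i j
    by_cases hij : i = j
    · simp [hij]
    have : 0 < dist (p i) (p j) / 2 := by
      have := dist_pos.2 (hp.ne hij); positivity
    filter_upwards [Ioo_mem_nhdsGT this] with δ hδ _
    have := hδ.2
    linarith
  have h3 := ((eventually_all.2 h1).and (eventually_all.2 fun i => eventually_all.2 (h2 i))).and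
    (self_mem_nhdsWithin (a := (0:ℝ)) (s := Ioi 0))
  obtain ⟨δ, ⟨ha, hb⟩, hc⟩ := h3.exists
  exact ⟨δ, hc, ha, hb⟩

theorem divQ_bound {n : ℕ} (p : Fin n → ℂ) (hp : Function.Injective p) {L : Set ℂ}
    (hL : IsCompact L) (hin : ∀ j, p j ∈ interior L) :
    ∃ C : ℝ, 0 ≤ C ∧ ∀ (v : Polynomial ℂ) (M : ℝ), (∀ x ∈ L, ‖v.eval x‖ ≤ M) →
      ∀ x ∈ L, ‖(divQ p v).eval x‖ ≤ C * M := by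
  obtain ⟨δ, hδ, hb, hs⟩ := exists_delta p hp hin
  obtain ⟨C, hC0, hC⟩ := rpoly_bound p hL
  refine ⟨(1 + C) / δ ^ n, by positivity, fun v M hv => ?_⟩
  have key : ∀ x ∈ L, (∀ j, δ ≤ dist x (p j)) → ‖(divQ p v).eval x‖ ≤ (1 + C) / δ ^ n * M := by
    intro x hx hd
    have h1 := congrArg (Polynomial.eval x) (div_decomp p hp v)
    rw [Polynomial.eval_add, Polynomial.eval_mul, nodQ_eval] at h1
    have h2 : δ ^ n ≤ ‖∏ j, (x - p j)‖ := by
      rw [norm_prod]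
      calc δ ^ n = ∏ j : Fin n, δ := by simp
        _ ≤ _ := Finset.prod_le_prod (fun _ _ => hδ.le) fun j _ => by
          rw [← dist_eq_norm]; exact hd j
    have h3 : ‖∏ j, (x - p j)‖ * ‖(divQ p v).eval x‖ ≤ (1 + C) * M := by
      rw [← norm_mul]
      have : (∏ j, (x - p j)) * (divQ p v).eval x =
        v.eval x - (rpoly p fun j => v.eval (p j)).eval x := by rw [h1]; ring
      rw [this]
      refine (norm_sub_le _ _).trans ?_
      rw [add_mul, one_mul]
      exact add_le_add (hv x hx) (hC _ M (fun j => hv _ (interior_subset (hin j))) x hx)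
    have hpos : 0 < δ ^ n := by positivity
    rw [div_mul_eq_mul_div, le_div_iff₀ hpos, mul_comm]
    exact (mul_le_mul_of_nonneg_right h2 (norm_nonneg _)).trans h3
  intro x hx
  by_cases hfar : ∀ j, δ ≤ dist x (p j)
  · exact key x hx hfar
  push Not at hfar
  obtain ⟨j, hj⟩ := hfar
  refine Complex.norm_le_of_forall_mem_frontier_norm_le (U := Metric.ball (p j) δ)
    (f := fun x => (divQ p v).eval x) Metric.isBounded_ball
    (divQ p v).differentiable.diffContOnCl ?_ (subset_closure hj)
  intro z hz
  rw [frontier_ball _ hδ.ne'] at hz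
  have hz' : dist z (p j) = δ := hz
  refine key z (hb j (Metric.sphere_subset_closedBall hz)) fun i => ?_
  by_cases hij : i = j
  · rw [hij, hz']
  · have h1 := hs i j hij
    have h2 := dist_triangle_left (p i) (p j) z
    linarith

theorem derivative_G0 {S : ℕ} (p : Fin (S + 2) → ℂ) (v : Polynomial ℂ) :
    (G0 p v).derivative = divQ p v := by
  rw [G0_apply, Polynomial.derivative_add, derivative_primP, Polynomial.derivative_C, add_zero]

theorem G0_eval_zero {S : ℕ} (p : Fin (S + 2) → ℂ) (v : Polynomial ℂ) :
    (G0 p v).eval (p 0) = topc p fun j => v.eval (p j) := by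
  rw [G0_apply, Polynomial.eval_add, primP_eval, Polynomial.eval_C, zero_add]

theorem Nice.G0_bound {S : ℕ} {D : Set ℂ} {p : Fin (S + 2) → ℂ} (hp : Function.Injective p)
    {L : Set ℂ} (hL : Nice D p L) :
    ∃ C : ℝ, 0 ≤ C ∧ ∀ (v : Polynomial ℂ) (M : ℝ), (∀ x ∈ L, ‖v.eval x‖ ≤ M) →
      ∀ x ∈ L, ‖(G0 p v).eval x‖ ≤ C * M ∧ ‖(divQ p v).eval x‖ ≤ C * M := by
  obtain ⟨C1, h1, hC1⟩ := divQ_bound p hp hL.compact hL.pin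
  obtain ⟨C2, h2, hC2⟩ := hL.prim_bound (p 0) (interior_subset (hL.pin 0))
  obtain ⟨C3, h3, hC3⟩ := topc_bound p
  refine ⟨C1 + C2 * C1 + C3, by positivity, fun v M hv x hx => ?_⟩
  have hM : 0 ≤ M := (norm_nonneg _).trans (hv x hx)
  have a1 := hC1 v M hv x hx
  have a2 := hC2 (fun x => (G0 p v).eval x) (C1 * M) (fun x _ => (G0 p v).differentiableAt)
    (fun x hx => by rw [Polynomial.deriv, derivative_G0]; exact hC1 v M hv x hx) x hx
  have a3 := hC3 (fun j => v.eval (p j)) M fun j => hv _ (interior_subset (hL.pin j))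
  rw [← G0_eval_zero] at a3
  constructor
  · calc ‖(G0 p v).eval x‖ = ‖((G0 p v).eval x - (G0 p v).eval (p 0)) + (G0 p v).eval (p 0)‖ := by
          congr 1; ring
      _ ≤ C2 * (C1 * M) + C3 * M := (norm_add_le _ _).trans (add_le_add a2 a3)
      _ ≤ _ := by nlinarith [mul_nonneg h1 hM]
  · refine a1.trans ?_
    gcongr
    nlinarith [mul_nonneg h2 h1]

end ScalarBounds

section Gop

/-- polynomials as elements of the closed algebra -/
noncomputable def ePA (L : Set ℂ) [CompactSpace L] : Polynomial ℂ →ₗ[ℂ] PA L where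
  toFun q := ⟨Polynomial.toContinuousMapOn q L, poly_mem_PA L q⟩
  map_add' a b := by ext; simp
  map_smul' c a := by ext; simp

theorem ePA_apply (L : Set ℂ) [CompactSpace L] (q : Polynomial ℂ) (x : L) :
    (ePA L q : C(L, ℂ)) x = q.eval (x : ℂ) := rfl

theorem ePA_mul (L : Set ℂ) [CompactSpace L] (q r : Polynomial ℂ) :
    ePA L (q * r) = ePA L q * ePA L r := by
  ext x; simp [ePA_apply]

theorem ePA_dense (L : Set ℂ) [CompactSpace L] : DenseRange (ePA L) := by
  intro v
  rw [Metric.mem_closure_iff]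
  intro ε hε
  have hv : (v : C(L, ℂ)) ∈ closure (polynomialFunctions L : Set C(L, ℂ)) := v.2
  rw [Metric.mem_closure_iff] at hv
  obtain ⟨b, hb, hd⟩ := hv ε hε
  rw [polynomialFunctions_coe] at hb
  obtain ⟨q, rfl⟩ := hb
  exact ⟨ePA L q, mem_range_self q, hd⟩

theorem PA_norm_le (L : Set ℂ) [CompactSpace L] (v : PA L) {M : ℝ} (hM : 0 ≤ M)
    (h : ∀ x : L, ‖(v : C(L, ℂ)) x‖ ≤ M) : ‖v‖ ≤ M :=
  (ContinuousMap.norm_le (v : C(L, ℂ)) hM).2 h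

theorem PA_le_norm (L : Set ℂ) [CompactSpace L] (v : PA L) (x : L) :
    ‖(v : C(L, ℂ)) x‖ ≤ ‖v‖ :=
  ContinuousMap.norm_coe_le_norm (v : C(L, ℂ)) x

/-- point evaluation -/
noncomputable def evPA (L : Set ℂ) [CompactSpace L] (x : L) : PA L →L[ℂ] ℂ :=
  LinearMap.mkContinuous
    { toFun := fun v => (v : C(L, ℂ)) x
      map_add' := fun _ _ => rfl
      map_smul' := fun _ _ => rfl } 1 (fun v => by rw [one_mul]; exact PA_le_norm L v x)

theorem evPA_apply (L : Set ℂ) [CompactSpace L] (x : L) (v : PA L) :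
    evPA L x v = (v : C(L, ℂ)) x := rfl

variable {S : ℕ} {D : Set ℂ} {p : Fin (S + 2) → ℂ}

/-- the integral operator on the closed algebra -/
noncomputable def Gop (p : Fin (S + 2) → ℂ) (L : Set ℂ) [CompactSpace L] : PA L →L[ℂ] PA L :=
  LinearMap.extendOfNorm ((ePA L).comp (G0 p)) (ePA L)

theorem Gop_bound (hp : Function.Injective p) {L : Set ℂ} [CompactSpace L] (hL : Nice D p L) :
    ∃ C : ℝ, 0 ≤ C ∧ (∀ v, ‖((ePA L).comp (G0 p)) v‖ ≤ C * ‖ePA L v‖) ∧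
      ∀ (v : Polynomial ℂ), ∀ x ∈ L, ‖(divQ p v).eval x‖ ≤ C * ‖ePA L v‖ := by
  obtain ⟨C, h0, hC⟩ := hL.G0_bound hp
  have := fun (v : Polynomial ℂ) => hC v ‖ePA L v‖ fun x hx => PA_le_norm L (ePA L v) ⟨x, hx⟩
  refine ⟨C, h0, fun v => PA_norm_le L _ (by positivity) fun x => (this v x x.2).1,
    fun v x hx => (this v x hx).2⟩

theorem Gop_ePA (hp : Function.Injective p) {L : Set ℂ} [CompactSpace L] (hL : Nice D p L)
    (q : Polynomial ℂ) : Gop p L (ePA L q) = ePA L (G0 p q) := by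
  obtain ⟨C, h0, hC, -⟩ := Gop_bound hp hL
  exact LinearMap.extendOfNorm_eq (ePA_dense L) ⟨C, hC⟩ q

theorem Gop_lip (hp : Function.Injective p) {L : Set ℂ} [CompactSpace L] (hL : Nice D p L) :
    ∃ C : ℝ, 0 ≤ C ∧ ∀ (v : PA L) (x y : L), segment ℝ (x : ℂ) y ⊆ L →
      ‖(Gop p L v : C(L, ℂ)) y - (Gop p L v : C(L, ℂ)) x‖ ≤ C * ‖v‖ * ‖(y : ℂ) - x‖ := by
  obtain ⟨C, h0, hC, hC2⟩ := Gop_bound hp hL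
  refine ⟨C, h0, fun v x y hs => ?_⟩
  refine (ePA_dense L).induction_on (p := fun v => ‖(Gop p L v : C(L, ℂ)) y -
    (Gop p L v : C(L, ℂ)) x‖ ≤ C * ‖v‖ * ‖(y : ℂ) - x‖) v ?_ ?_
  · have e1 : Continuous fun v => evPA L y (Gop p L v) := (evPA L y).continuous.comp (Gop p L).continuous
    have e2 : Continuous fun v => evPA L x (Gop p L v) := (evPA L x).continuous.comp (Gop p L).continuous
    exact isClosed_le (e1.sub e2).norm ((continuous_const.mul continuous_norm).mul continuous_const)
  · intro q
    rw [Gop_ePA hp hL]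
    exact seg_bound (w := fun z => (G0 p q).eval z) (fun z _ => (G0 p q).differentiableAt)
      (fun z hz => by rw [Polynomial.deriv, derivative_G0]; exact hC2 q z hz) hs

theorem Gop_compact (hp : Function.Injective p) {L : Set ℂ} [CompactSpace L] (hL : Nice D p L) :
    IsCompactOperator (Gop p L) := by
  obtain ⟨C, h0, hC⟩ := Gop_lip hp hL
  set T : Set (PA L) := Gop p L '' Metric.closedBall 0 1 with hT
  let Φ : PA L → BoundedContinuousFunction L ℂ := fun v =>
    ContinuousMap.isometryEquivBoundedOfCompact L ℂ (v : C(L, ℂ))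
  have hΦv : ∀ v x, Φ v x = (v : C(L, ℂ)) x := fun v x => rfl
  have hΦi : Isometry Φ :=
    (ContinuousMap.isometryEquivBoundedOfCompact L ℂ).isometry.comp isometry_subtype_coe
  have hΦc : IsClosedEmbedding Φ := hΦi.isClosedEmbedding
  have hcomp : IsCompact (closure (Φ '' T)) := by
    refine BoundedContinuousFunction.arzela_ascoli (Metric.closedBall 0 ‖Gop p L‖)
      (isCompact_closedBall _ _) _ ?_ ?_
    · rintro _ x ⟨_, ⟨v, hv, rfl⟩, rfl⟩
      rw [hΦv, mem_closedBall_zero_iff]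
      refine (PA_le_norm L _ x).trans ?_
      refine ((Gop p L).le_opNorm v).trans ?_
      have h3 : ‖v‖ ≤ 1 := mem_closedBall_zero_iff.1 hv
      exact mul_le_of_le_one_right (norm_nonneg _) h3
    · intro x
      obtain ⟨ε, hε, hseg⟩ := hL.seg x x.2
      rw [Metric.equicontinuousAt_iff]
      intro η hη
      refine ⟨min ε (η / (C + 1)), lt_min hε (by positivity), ?_⟩
      rintro y hy ⟨_, ⟨_, ⟨v, hv, rfl⟩, rfl⟩⟩
      have h1 := hC v x y (hseg y y.2 (lt_of_lt_of_le hy (min_le_left _ _)))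
      have h2 : ‖(y : ℂ) - x‖ < η / (C + 1) := by
        rw [← dist_eq_norm]; exact lt_of_lt_of_le hy (min_le_right _ _)
      have h3 : ‖v‖ ≤ 1 := mem_closedBall_zero_iff.1 hv
      rw [lt_div_iff₀ (by positivity)] at h2
      simp only [hΦv]
      rw [dist_comm, dist_eq_norm]
      refine h1.trans_lt (lt_of_le_of_lt ?_ h2)
      have h4 := norm_nonneg ((y : ℂ) - x)
      have : C * ‖v‖ ≤ C + 1 := (mul_le_of_le_one_right h0 h3).trans (by linarith)
      rw [mul_comm ‖(y : ℂ) - x‖]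
      exact mul_le_mul_of_nonneg_right this h4
  refine ⟨Φ ⁻¹' closure (Φ '' T), hΦc.isCompact_preimage hcomp, ?_⟩
  refine mem_of_superset (Metric.closedBall_mem_nhds 0 one_pos) fun v hv => ?_
  exact subset_closure (mem_image_of_mem _ (mem_image_of_mem _ hv))

end Gop

section GopSpec

open Classical in
/-- extension by zero -/
noncomputable def exPA (L : Set ℂ) [CompactSpace L] (v : PA L) (x : ℂ) : ℂ :=
  if h : x ∈ L then (v : C(L, ℂ)) ⟨x, h⟩ else 0

theorem exPA_apply {L : Set ℂ} [CompactSpace L] (v : PA L) {x : ℂ} (h : x ∈ L) :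
    exPA L v x = (v : C(L, ℂ)) ⟨x, h⟩ := by
  simp [exPA, h]

theorem exPA_ePA {L : Set ℂ} [CompactSpace L] (q : Polynomial ℂ) {x : ℂ} (h : x ∈ L) :
    exPA L (ePA L q) x = q.eval x := by
  rw [exPA_apply _ h, ePA_apply]

theorem exPA_add {L : Set ℂ} [CompactSpace L] (v w : PA L) {x : ℂ} :
    exPA L (v + w) x = exPA L v x + exPA L w x := by
  by_cases h : x ∈ L
  · simp only [exPA_apply _ h]; rfl
  · simp [exPA, h]

theorem PA_seq {L : Set ℂ} [CompactSpace L] (v : PA L) :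
    ∃ q : ℕ → Polynomial ℂ, Tendsto (fun k => ePA L (q k)) atTop (𝓝 v) := by
  obtain ⟨s, hs, hv⟩ := mem_closure_iff_seq_limit.1 (ePA_dense L v)
  choose q hq using hs
  refine ⟨q, ?_⟩
  have : (fun k => ePA L (q k)) = s := funext hq
  rwa [this]

theorem PA_tu {L : Set ℂ} [CompactSpace L] {u : PA L} {q : ℕ → Polynomial ℂ}
    (h : Tendsto (fun k => ePA L (q k)) atTop (𝓝 u)) :
    TendstoUniformlyOn (fun k x => (q k).eval x) (exPA L u) atTop L := by
  rw [Metric.tendstoUniformlyOn_iff]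
  intro ε hε
  rw [Metric.tendsto_nhds] at h
  filter_upwards [h ε hε] with k hk x hx
  refine lt_of_le_of_lt ?_ hk
  rw [exPA_apply _ hx, dist_comm]
  exact ContinuousMap.dist_apply_le_dist (f := (ePA L (q k) : C(L, ℂ))) (g := (u : C(L, ℂ))) ⟨x, hx⟩

theorem PA_diff {L : Set ℂ} [CompactSpace L] (u : PA L) :
    DifferentiableOn ℂ (exPA L u) (interior L) := by
  obtain ⟨q, hq⟩ := PA_seq u
  exact ((PA_tu hq).mono interior_subset).tendstoLocallyUniformlyOn.differentiableOn
    (Eventually.of_forall fun k => (q k).differentiable.differentiableOn) isOpen_interior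

theorem PA_deriv {L : Set ℂ} [CompactSpace L] {u : PA L} {q : ℕ → Polynomial ℂ}
    (h : Tendsto (fun k => ePA L (q k)) atTop (𝓝 u)) {x : ℂ} (hx : x ∈ interior L) :
    Tendsto (fun k => (q k).derivative.eval x) atTop (𝓝 (deriv (exPA L u) x)) := by
  have := (((PA_tu h).mono interior_subset).tendstoLocallyUniformlyOn.deriv
    (Eventually.of_forall fun k => (q k).differentiable.differentiableOn) isOpen_interior).tendsto_at hx
  refine this.congr fun k => ?_
  simp [Polynomial.deriv]

theorem PA_ev {L : Set ℂ} [CompactSpace L] {u : PA L} {q : ℕ → Polynomial ℂ}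
    (h : Tendsto (fun k => ePA L (q k)) atTop (𝓝 u)) {x : ℂ} (hx : x ∈ L) :
    Tendsto (fun k => (q k).eval x) atTop (𝓝 (exPA L u x)) :=
  (PA_tu h).tendsto_at hx

variable {S : ℕ} {D : Set ℂ} {p : Fin (S + 2) → ℂ}

theorem Gop_spec (hp : Function.Injective p) {L : Set ℂ} [CompactSpace L] (hL : Nice D p L)
    (v : PA L) {x : ℂ} (hx : x ∈ interior L) :
    exPA L v x = (rpoly p fun j => exPA L v (p j)).eval x +
      (nodQ p).eval x * deriv (exPA L (Gop p L v)) x := by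
  obtain ⟨q, hq⟩ := PA_seq v
  have h1 : Tendsto (fun k => ePA L (G0 p (q k))) atTop (𝓝 (Gop p L v)) := by
    have := ((Gop p L).continuous.tendsto v).comp hq
    refine this.congr fun k => ?_
    exact Gop_ePA hp hL _
  have h2 := PA_deriv h1 hx
  have h3 := PA_ev hq (interior_subset hx)
  have h4 : Tendsto (fun k => fun j => (q k).eval (p j)) atTop (𝓝 fun j => exPA L v (p j)) :=
    tendsto_pi_nhds.2 fun j => PA_ev hq (interior_subset (hL.pin j))
  have hc : Continuous fun c => ((Polynomial.leval x).comp (rpoly p)) c :=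
    LinearMap.continuous_of_finiteDimensional _
  have h5 := (hc.tendsto _).comp h4
  have h6 := h5.add (h2.const_mul ((nodQ p).eval x))
  refine tendsto_nhds_unique h3 (h6.congr fun k => ?_)
  rw [derivative_G0]
  have := congrArg (Polynomial.eval x) (div_decomp p hp (q k))
  rw [Polynomial.eval_add, Polynomial.eval_mul] at this
  exact this.symm

theorem Gop_zero (hp : Function.Injective p) {L : Set ℂ} [CompactSpace L] (hL : Nice D p L)
    (v : PA L) : exPA L (Gop p L v) (p 0) = topc p fun j => exPA L v (p j) := by
  obtain ⟨q, hq⟩ := PA_seq v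
  have h1 : Tendsto (fun k => ePA L (G0 p (q k))) atTop (𝓝 (Gop p L v)) := by
    have := ((Gop p L).continuous.tendsto v).comp hq
    refine this.congr fun k => ?_
    exact Gop_ePA hp hL _
  have h3 := PA_ev h1 (interior_subset (hL.pin 0))
  have h4 : Tendsto (fun k => fun j => (q k).eval (p j)) atTop (𝓝 fun j => exPA L v (p j)) :=
    tendsto_pi_nhds.2 fun j => PA_ev hq (interior_subset (hL.pin j))
  have hc : Continuous (topc p) := LinearMap.continuous_of_finiteDimensional _
  refine tendsto_nhds_unique h3 (((hc.tendsto _).comp h4).congr fun k => ?_)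
  simp only [Function.comp, G0_eval_zero]

/-- restriction to a smaller set as a ring homomorphism on continuous functions -/
theorem res_mem {L L' : Set ℂ} [CompactSpace L] [CompactSpace L'] (h : L ⊆ L') (v : PA L') :
    (v : C(L', ℂ)).comp ⟨Set.inclusion h, continuous_inclusion h⟩ ∈ PA L := by
  refine (ePA_dense L').induction_on (p := fun v : PA L' =>
    (v : C(L', ℂ)).comp ⟨Set.inclusion h, continuous_inclusion h⟩ ∈ PA L) v ?_ ?_
  · refine (PA_closed L).preimage ?_
    exact (ContinuousMap.continuous_precomp _).comp continuous_subtype_val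
  · intro q
    exact (ePA L q).2

/-- restriction to a smaller set -/
noncomputable def resPA {L L' : Set ℂ} [CompactSpace L] [CompactSpace L'] (h : L ⊆ L') (v : PA L') :
    PA L := ⟨_, res_mem h v⟩

theorem resPA_continuous {L L' : Set ℂ} [CompactSpace L] [CompactSpace L'] (h : L ⊆ L') :
    Continuous (resPA h) :=
  ((ContinuousMap.continuous_precomp _).comp continuous_subtype_val).subtype_mk _

theorem exPA_res {L L' : Set ℂ} [CompactSpace L] [CompactSpace L'] (h : L ⊆ L') (v : PA L')
    {x : ℂ} (hx : x ∈ L) : exPA L (resPA h v) x = exPA L' v x := by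
  rw [exPA_apply _ hx, exPA_apply _ (h hx)]; rfl

theorem PA_ext {L : Set ℂ} [CompactSpace L] {v w : PA L} (h : ∀ x ∈ L, exPA L v x = exPA L w x) :
    v = w := by
  ext x
  have := h x x.2
  rwa [exPA_apply _ x.2, exPA_apply _ x.2] at this

theorem Gop_res (hp : Function.Injective p) {L L' : Set ℂ} [CompactSpace L] [CompactSpace L']
    (hL : Nice D p L) (hL' : Nice D p L') (h : L ⊆ L') (v : PA L') :
    resPA h (Gop p L' v) = Gop p L (resPA h v) := by
  refine (ePA_dense L').induction_on (p := fun v : PA L' =>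
    resPA h (Gop p L' v) = Gop p L (resPA h v)) v ?_ ?_
  · exact isClosed_eq ((resPA_continuous h).comp (Gop p L').continuous)
      ((Gop p L).continuous.comp (resPA_continuous h))
  · intro q
    have : ∀ q, resPA h (ePA L' q) = ePA L q := fun q => rfl
    rw [Gop_ePA hp hL', this, this, Gop_ePA hp hL]

end GopSpec

section NiceExist

theorem exists_nice {n : ℕ} (p : Fin (n + 1) → ℂ) {D : Set ℂ} (hD : IsOpen D)
    (hsc : SimplyConnectedSpace D) (hpD : ∀ j, p j ∈ D) {K : Set ℂ} (hK : IsCompact K)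
    (hKD : K ⊆ D) : ∃ L, Nice D p L ∧ K ⊆ interior L := by
  have hr : ∀ z, ∃ r : ℝ, 0 < r ∧ (z ∈ D → Metric.closedBall z r ⊆ D) := by
    intro z
    by_cases hz : z ∈ D
    · obtain ⟨r, h1, h2⟩ := Metric.nhds_basis_closedBall.mem_iff.1 (hD.mem_nhds hz)
      exact ⟨r, h1, fun _ => h2⟩
    · exact ⟨1, one_pos, fun h => absurd h hz⟩
  choose r hr0 hrD using hr
  have hpc : IsPathConnected D := isPathConnected_iff_pathConnectedSpace.2 inferInstance
  -- first step: enlarge to a connected compact set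
  have hK1 : IsCompact (K ∪ range p) := hK.union (finite_range p).isCompact
  have hK1D : K ∪ range p ⊆ D := union_subset hKD (by rintro _ ⟨j, rfl⟩; exact hpD j)
  obtain ⟨t, ht, hcov⟩ := hK1.elim_nhds_subcover (fun z => Metric.closedBall z (r z))
    fun z _ => Metric.closedBall_mem_nhds z (hr0 z)
  have hγ : ∀ z, ∃ Γ : Set ℂ, IsCompact Γ ∧ IsPreconnected Γ ∧ p 0 ∈ Γ ∧ (z ∈ D → z ∈ Γ) ∧ Γ ⊆ D := by
    intro z
    by_cases hz : z ∈ D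
    · obtain ⟨γ, hγ⟩ := hpc.joinedIn (p 0) (hpD 0) z hz
      refine ⟨range γ, isCompact_range γ.continuous, isPreconnected_range γ.continuous,
        ⟨0, γ.source⟩, fun _ => ⟨1, γ.target⟩, ?_⟩
      rintro _ ⟨s, rfl⟩; exact hγ s
    · exact ⟨{p 0}, isCompact_singleton, isPreconnected_singleton, rfl, fun h => absurd h hz,
        singleton_subset_iff.2 (hpD 0)⟩
  choose Γ hΓc hΓp hΓ0 hΓz hΓD using hγ
  set K2 : Set ℂ := ⋃ z ∈ t, (Γ z ∪ Metric.closedBall z (r z)) with hK2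
  have htD : ∀ z ∈ t, z ∈ D := fun z hz => hK1D (ht z hz)
  have hK2c : IsCompact K2 := t.isCompact_biUnion fun z _ => (hΓc z).union (isCompact_closedBall _ _)
  have hK12 : K ∪ range p ⊆ K2 := hcov.trans (iUnion₂_mono fun z _ => subset_union_right)
  have hK2D : K2 ⊆ D := iUnion₂_subset fun z hz => union_subset (hΓD z) (hrD z (htD z hz))
  have hK2p : IsPreconnected K2 := by
    have : K2 = ⋃ z : t, (Γ z ∪ Metric.closedBall (z : ℂ) (r z)) := by
      rw [hK2]; exact biUnion_eq_iUnion (s := (t : Set ℂ)) _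
    rw [this]
    refine isPreconnected_iUnion ⟨p 0, mem_iInter.2 fun z => Or.inl (hΓ0 z)⟩ ?_
    · exact fun z => (hΓp z).union (z : ℂ) (hΓz z (htD z z.2)) (Metric.mem_closedBall_self (hr0 z).le)
        (convex_closedBall _ _).isPreconnected
  -- second step
  obtain ⟨t', ht', hcov'⟩ := hK2c.elim_nhds_subcover (fun z => Metric.ball z (r z))
    fun z _ => Metric.ball_mem_nhds z (hr0 z)
  set L : Set ℂ := ⋃ z ∈ t', Metric.closedBall z (r z) with hLdef
  have hbL : (⋃ z ∈ t', Metric.ball z (r z)) ⊆ interior L :=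
    interior_maximal (iUnion₂_mono fun z _ => Metric.ball_subset_closedBall)
      (isOpen_biUnion fun z _ => Metric.isOpen_ball)
  have hK2i : K2 ⊆ interior L := hcov'.trans hbL
  have hK2L : K2 ⊆ L := hK2i.trans interior_subset
  have hLeq : L = ⋃ z : t', (K2 ∪ Metric.closedBall (z : ℂ) (r z)) := by
    apply Subset.antisymm
    · rw [hLdef]
      exact iUnion₂_subset fun z hz => subset_iUnion_of_subset ⟨z, hz⟩ subset_union_right
    · exact iUnion_subset fun z => union_subset hK2L
        (subset_biUnion_of_mem (u := fun z => Metric.closedBall z (r z)) z.2)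
  have hp0 : p 0 ∈ K2 := hK12 (Or.inr ⟨0, rfl⟩)
  refine ⟨L, ⟨t'.isCompact_biUnion fun z _ => isCompact_closedBall _ _, ?_,
    iUnion₂_subset fun z hz => hrD z (hK2D (ht' z hz)), fun j => hK2i (hK12 (Or.inr ⟨j, rfl⟩)), ?_⟩,
    subset_union_left.trans (hK12.trans hK2i)⟩
  · rw [hLeq]
    refine isPreconnected_iUnion ⟨p 0, mem_iInter.2 fun z => Or.inl hp0⟩ fun z => ?_
    exact hK2p.union (z : ℂ) (ht' z z.2) (Metric.mem_closedBall_self (hr0 z).le)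
        (convex_closedBall _ _).isPreconnected
  · intro x hx
    have h1 : ∀ᶠ y in 𝓝 x, ∀ z ∈ t', x ∉ Metric.closedBall z (r z) → y ∉ Metric.closedBall z (r z) := by
      rw [Finset.eventually_all]
      intro z hz
      by_cases hxz : x ∈ Metric.closedBall z (r z)
      · exact Eventually.of_forall fun y h => absurd hxz h
      · filter_upwards [Metric.isClosed_closedBall.isOpen_compl.mem_nhds hxz] with y hy _
        exact hy
    obtain ⟨ε, hε, h2⟩ := Metric.eventually_nhds_iff.1 h1
    refine ⟨ε, hε, fun y hy hyx => ?_⟩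
    obtain ⟨z, hz, hyz⟩ := mem_iUnion₂.1 hy
    have hxz : x ∈ Metric.closedBall z (r z) := by
      by_contra hc
      exact h2 hyx z hz hc hyz
    exact ((convex_closedBall z (r z)).segment_subset hxz hyz).trans
      (subset_biUnion_of_mem (u := fun z => Metric.closedBall z (r z)) hz)

end NiceExist

section PolySolve

variable {ι : Type*} [Fintype ι] {S : ℕ}

open Polynomial in
/-- `Q A` as polynomial matrix -/
noncomputable def Rp (p : Fin (S + 2) → ℂ) (B : Fin (S + 2) → Matrix ι ι ℂ) (i k : ι) : ℂ[X] :=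
  ∑ j, C (B j i k) * ∏ l ∈ Finset.univ.erase j, (X - C (p l))

open Polynomial in
theorem Rp_term_monic (p : Fin (S + 2) → ℂ) (j : Fin (S + 2)) :
    (∏ l ∈ Finset.univ.erase j, (X - C (p l))).Monic ∧
    (∏ l ∈ Finset.univ.erase j, (X - C (p l))).natDegree = S + 1 := by
  refine ⟨monic_prod_of_monic _ _ fun l _ => monic_X_sub_C (p l), ?_⟩
  rw [natDegree_prod_of_monic _ _ fun l _ => monic_X_sub_C (p l)]
  simp

open Polynomial in
theorem Rp_natDegree (p : Fin (S + 2) → ℂ) (B : Fin (S + 2) → Matrix ι ι ℂ) (i k : ι) :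
    (Rp p B i k).natDegree ≤ S + 1 := by
  refine natDegree_sum_le_of_forall_le _ _ fun j _ => ?_
  refine (natDegree_C_mul_le _ _).trans ?_
  rw [(Rp_term_monic p j).2]

open Polynomial in
theorem Rp_coeff (p : Fin (S + 2) → ℂ) (B : Fin (S + 2) → Matrix ι ι ℂ) (i k : ι) :
    (Rp p B i k).coeff (S + 1) = (∑ j, B j) i k := by
  rw [Rp, finsetSum_coeff, Matrix.sum_apply]
  refine Finset.sum_congr rfl fun j _ => ?_
  have h := Rp_term_monic p j
  rw [coeff_C_mul]
  have h1 := h.1.coeff_natDegree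
  rw [h.2] at h1
  rw [h1, mul_one]

open Polynomial in
theorem poly_solve (p : Fin (S + 2) → ℂ) (B : Fin (S + 2) → Matrix ι ι ℂ)
    (hB : ∀ (k : ℕ) (a : ι → ℂ), (k : ℂ) • a - (∑ j, B j) *ᵥ a = 0 → a = 0) (N : ℕ) :
    ∀ g : ι → ℂ[X], (∀ i, (g i).degree < ((S + 1 + N : ℕ) : WithBot ℕ)) →
    ∃ h ψ : ι → ℂ[X], (∀ i, (ψ i).degree < ((S + 1 : ℕ) : WithBot ℕ)) ∧
      ∀ i, nodQ p * derivative (h i) - ∑ k, Rp p B i k * h k + ψ i = g i := by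
  induction N with
  | zero => exact fun g hg => ⟨0, g, hg, fun i => by simp⟩
  | succ N ih =>
    intro g hg
    -- leading coefficients
    let T : (ι → ℂ) →ₗ[ℂ] (ι → ℂ) := (N : ℂ) • LinearMap.id - Matrix.mulVecLin (∑ j, B j)
    have hT : Function.Injective T := by
      rw [← LinearMap.ker_eq_bot, LinearMap.ker_eq_bot']
      intro a ha
      exact hB N a ha
    obtain ⟨a, ha⟩ := (LinearMap.injective_iff_surjective.1 hT) fun i => (g i).coeff (S + 1 + N)
    have ha' : ∀ i, (N : ℂ) * a i - ∑ k, (∑ j, B j) i k * a k = (g i).coeff (S + 1 + N) := by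
      intro i
      have := congrFun ha i
      exact this
    let g1 : ι → ℂ[X] := fun i => nodQ p * derivative (C (a i) * X ^ N) -
      ∑ k, Rp p B i k * (C (a k) * X ^ N)
    have e1 : ∀ i, (∑ k, Rp p B i k * (C (a k) * X ^ N)) = (∑ k, Rp p B i k * C (a k)) * X ^ N := by
      intro i; rw [Finset.sum_mul]; exact Finset.sum_congr rfl fun k _ => by ring
    have d1 : ∀ i, (∑ k, Rp p B i k * C (a k)).natDegree ≤ S + 1 := by
      intro i
      refine natDegree_sum_le_of_forall_le _ _ fun k _ => ?_
      exact (natDegree_mul_C_le _ _).trans (Rp_natDegree p B i k)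
    have d2 : ∀ i, (∑ k, Rp p B i k * (C (a k) * X ^ N)).natDegree ≤ S + 1 + N := by
      intro i
      rw [e1]
      exact natDegree_mul_le.trans (add_le_add (d1 i) (natDegree_X_pow N).le)
    have c2 : ∀ i, (∑ k, Rp p B i k * (C (a k) * X ^ N)).coeff (S + 1 + N) =
        ∑ k, (∑ j, B j) i k * a k := by
      intro i
      rw [e1, coeff_mul_X_pow, finsetSum_coeff]
      exact Finset.sum_congr rfl fun k _ => by rw [coeff_mul_C, Rp_coeff]
    have d3 : ∀ i, (nodQ p * derivative (C (a i) * X ^ N)).natDegree ≤ S + 1 + N ∧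
        (nodQ p * derivative (C (a i) * X ^ N)).coeff (S + 1 + N) = N * a i := by
      intro i
      rcases N with _ | M
      · simp
      · have e3 : nodQ p * derivative (C (a i) * X ^ (M + 1)) =
            (nodQ p * C (((M + 1 : ℕ) : ℂ) * a i)) * X ^ M := by
          rw [derivative_C_mul_X_pow]
          rw [Nat.add_sub_cancel, mul_comm (a i)]; ring
        rw [e3]
        constructor
        · refine natDegree_mul_le.trans ?_
          have := natDegree_mul_C_le (nodQ p) (((M + 1 : ℕ) : ℂ) * a i)
          rw [nodQ_natDegree] at this
          rw [natDegree_X_pow]; omega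
        · rw [show S + 1 + (M + 1) = (S + 2) + M by ring, coeff_mul_X_pow, coeff_mul_C]
          have := (nodQ_monic p).coeff_natDegree
          rw [nodQ_natDegree] at this
          rw [this, one_mul]
    have hg1 : ∀ i, (g i - g1 i).degree < ((S + 1 + N : ℕ) : WithBot ℕ) := by
      intro i
      rw [degree_lt_iff_coeff_zero]
      intro m hm
      rcases Nat.lt_or_ge (S + 1 + N) m with h | h
      · rw [coeff_sub, coeff_sub, coeff_eq_zero_of_natDegree_lt ((d3 i).1.trans_lt h),
          coeff_eq_zero_of_natDegree_lt ((d2 i).trans_lt h),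
          (degree_lt_iff_coeff_zero _ _).1 (hg i) m (by omega)]
        simp
      · obtain rfl : m = S + 1 + N := by omega
        rw [coeff_sub, coeff_sub, (d3 i).2, c2, ha']
        ring
    obtain ⟨h, ψ, hψ, hh⟩ := ih (fun i => g i - g1 i) hg1
    refine ⟨fun i => h i + C (a i) * X ^ N, ψ, hψ, fun i => ?_⟩
    have := hh i
    simp only [derivative_add, mul_add, Finset.sum_add_distrib]
    simp only [g1] at this
    linear_combination this

open Polynomial in
theorem poly_solve' (p : Fin (S + 2) → ℂ) (hp : Function.Injective p)
    (B : Fin (S + 2) → Matrix ι ι ℂ)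
    (hB : ∀ (k : ℕ) (a : ι → ℂ), (k : ℂ) • a - (∑ j, B j) *ᵥ a = 0 → a = 0) (y : ι → ℂ[X]) :
    ∃ h : ι → ℂ[X], ∀ i, h i - C ((h i).eval (p 0)) - G0 p (∑ k, Rp p B i k * h k) = y i := by
  set g : ι → ℂ[X] := fun i => nodQ p * derivative (y i) + C ((y i).eval (p 0)) * X ^ (S + 1) with hg
  obtain ⟨h, ψ, hψ, hh⟩ := poly_solve p B hB (Finset.univ.sup fun i => (g i).natDegree + 1) g (by
    intro i
    refine degree_le_natDegree.trans_lt ?_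
    have : (g i).natDegree + 1 ≤ Finset.univ.sup fun i => (g i).natDegree + 1 :=
      Finset.le_sup (f := fun i => (g i).natDegree + 1) (Finset.mem_univ i)
    exact_mod_cast by omega)
  refine ⟨h, fun i => ?_⟩
  set r : ℂ[X] := ψ i - C ((y i).eval (p 0)) * X ^ (S + 1) with hr
  have hrd : r.degree < ((S + 2 : ℕ) : WithBot ℕ) := by
    refine (degree_sub_le _ _).trans_lt (max_lt ((hψ i).trans ?_) ?_)
    · exact_mod_cast Nat.lt_succ_self _
    · exact (degree_C_mul_X_pow_le _ _).trans_lt (by exact_mod_cast Nat.lt_succ_self _)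
  have e : ∑ k, Rp p B i k * h k = nodQ p * (derivative (h i - y i)) + r := by
    have := hh i
    rw [derivative_sub]
    simp only [hg, hr] at this ⊢
    linear_combination -this
  have e2 : divQ p (∑ k, Rp p B i k * h k) = derivative (h i - y i) := by
    rw [e]; exact div_unique p _ r hrd
  have e3 : r = rpoly p fun j => (∑ k, Rp p B i k * h k).eval (p j) := by
    refine eq_rpoly p hp _ r hrd fun j => ?_
    rw [e, eval_add, eval_mul, nodQ_eval, Finset.prod_eq_zero (Finset.mem_univ j) (sub_self _)]
    ring
  have e4 : topc p (fun j => (∑ k, Rp p B i k * h k).eval (p j)) = - (y i).eval (p 0) := by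
    show (rpoly p _).coeff (S + 1) = _
    rw [← e3, hr, coeff_sub, (degree_lt_iff_coeff_zero _ _).1 (hψ i) _ le_rfl, coeff_C_mul,
      coeff_X_pow]
    simp
  rw [G0_apply, e2, e4, primP_derivative, eval_sub]
  simp only [C_sub, C_neg]
  ring

end PolySolve

section SystemL

theorem isCompactOperator_pi {ι X Y : Type*} [Fintype ι] [Zero X] [TopologicalSpace X]
    [TopologicalSpace Y] {f : X → ι → Y} (h : ∀ i, IsCompactOperator fun x => f x i) :
    IsCompactOperator f := by
  choose K hK hf using h
  refine ⟨Set.pi univ K, isCompact_univ_pi hK, ?_⟩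
  have := Filter.iInter_mem.2 hf
  refine mem_of_superset this fun x hx i _ => mem_iInter.1 hx i

variable {ι : Type*} [Fintype ι] {S : ℕ} {D : Set ℂ} {p : Fin (S + 2) → ℂ}

/-- matrix multiplication part -/
noncomputable def mulPA (p : Fin (S + 2) → ℂ) (B : Fin (S + 2) → Matrix ι ι ℂ) (L : Set ℂ)
    [CompactSpace L] (i : ι) : (ι → PA L) →L[ℂ] PA L :=
  ∑ k, (ContinuousLinearMap.mul ℂ (PA L) (ePA L (Rp p B i k))).comp (ContinuousLinearMap.proj k)

theorem mulPA_apply (p : Fin (S + 2) → ℂ) (B : Fin (S + 2) → Matrix ι ι ℂ) (L : Set ℂ)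
    [CompactSpace L] (i : ι) (h : ι → PA L) :
    mulPA p B L i h = ∑ k, ePA L (Rp p B i k) * h k := by
  simp [mulPA]

/-- evaluation at the base point followed by inclusion of constants -/
noncomputable def cstPA (L : Set ℂ) [CompactSpace L] (a : L) : PA L →L[ℂ] PA L :=
  (ContinuousLinearMap.toSpanSingleton ℂ (ePA L 1)).comp (evPA L a)

theorem cstPA_apply (L : Set ℂ) [CompactSpace L] (a : L) (v : PA L) :
    cstPA L a v = ePA L (Polynomial.C ((v : C(L, ℂ)) a)) := by
  show (v : C(L, ℂ)) a • ePA L 1 = _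
  rw [← map_smul, Polynomial.smul_eq_C_mul, mul_one]

theorem cstPA_compact (L : Set ℂ) [CompactSpace L] (a : L) : IsCompactOperator (cstPA L a) :=
  (isCompactOperator_of_locallyCompactSpace_dom (evPA L a)).clm_comp
    (ContinuousLinearMap.toSpanSingleton ℂ (ePA L 1))

/-- the full operator -/
noncomputable def Kop (p : Fin (S + 2) → ℂ) (B : Fin (S + 2) → Matrix ι ι ℂ) (L : Set ℂ)
    [CompactSpace L] (a : L) : (ι → PA L) →L[ℂ] (ι → PA L) :=
  ContinuousLinearMap.pi fun i =>
    (cstPA L a).comp (ContinuousLinearMap.proj i) + (Gop p L).comp (mulPA p B L i)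

theorem Kop_apply (p : Fin (S + 2) → ℂ) (B : Fin (S + 2) → Matrix ι ι ℂ) (L : Set ℂ)
    [CompactSpace L] (a : L) (h : ι → PA L) (i : ι) :
    Kop p B L a h i = cstPA L a (h i) + Gop p L (mulPA p B L i h) := rfl

theorem Kop_compact (hp : Function.Injective p) (B : Fin (S + 2) → Matrix ι ι ℂ) {L : Set ℂ}
    [CompactSpace L] (hL : Nice D p L) (a : L) : IsCompactOperator (Kop p B L a) := by
  refine isCompactOperator_pi fun i => ?_
  have h1 := (cstPA_compact L a).comp_clm (ContinuousLinearMap.proj (R := ℂ) (φ := fun _ : ι => PA L) i)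
  have h2 := (Gop_compact hp hL).comp_clm (mulPA p B L i)
  exact h1.add h2

theorem Kop_surj (hp : Function.Injective p) (B : Fin (S + 2) → Matrix ι ι ℂ)
    (hB : ∀ (k : ℕ) (a : ι → ℂ), (k : ℂ) • a - (∑ j, B j) *ᵥ a = 0 → a = 0) {L : Set ℂ}
    [CompactSpace L] (hL : Nice D p L) (a : L) (ha : (a : ℂ) = p 0) :
    Function.Surjective fun h => h - Kop p B L a h := by
  refine surjective_of_denseRange _ (Kop_compact hp B hL a) ?_
  have hd : DenseRange (Pi.map fun (_ : ι) => ePA L) := DenseRange.piMap fun _ => ePA_dense L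
  refine Dense.mono ?_ hd
  rintro _ ⟨y, rfl⟩
  obtain ⟨h, hh⟩ := poly_solve' p hp B hB y
  refine ⟨fun i => ePA L (h i), ?_⟩
  funext i
  show ePA L (h i) - Kop p B L a (fun i => ePA L (h i)) i = ePA L (y i)
  rw [Kop_apply, cstPA_apply, mulPA_apply]
  have e1 : ∑ k, ePA L (Rp p B i k) * ePA L (h k) = ePA L (∑ k, Rp p B i k * h k) := by
    rw [map_sum]; exact Finset.sum_congr rfl fun k _ => (ePA_mul L _ _).symm
  rw [e1, Gop_ePA hp hL, ePA_apply, ha, ← hh i, map_sub, map_sub]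
  abel

/-- solutions of the integral equation -/
def SolL (p : Fin (S + 2) → ℂ) (B : Fin (S + 2) → Matrix ι ι ℂ) (L : Set ℂ)
    [CompactSpace L] (g h : ι → PA L) : Prop :=
  ∀ i, h i = ePA L (Polynomial.C (exPA L (h i) (p 0))) +
    Gop p L (∑ k, ePA L (Rp p B i k) * h k + g i)

theorem SolL_exists (hp : Function.Injective p) (B : Fin (S + 2) → Matrix ι ι ℂ)
    (hB : ∀ (k : ℕ) (a : ι → ℂ), (k : ℂ) • a - (∑ j, B j) *ᵥ a = 0 → a = 0) {L : Set ℂ}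
    [CompactSpace L] (hL : Nice D p L) (g : ι → PA L) : ∃ h, SolL p B L g h := by
  have hm := interior_subset (hL.pin 0)
  obtain ⟨h, hh⟩ := Kop_surj hp B hB hL ⟨p 0, hm⟩ rfl fun i => Gop p L (g i)
  refine ⟨h, fun i => ?_⟩
  have h1 : h i - Kop p B L ⟨p 0, hm⟩ h i = Gop p L (g i) := congrFun hh i
  rw [Kop_apply, cstPA_apply, mulPA_apply] at h1
  rw [map_add, exPA_apply _ hm, ← h1]
  abel

theorem SolL_sub {B : Fin (S + 2) → Matrix ι ι ℂ} {L : Set ℂ}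
    [CompactSpace L] {g h h' : ι → PA L} (hm : p 0 ∈ L)
    (H : SolL p B L g h) (H' : SolL p B L g h') : SolL p B L 0 (h - h') := by
  intro i
  have e1 := H i
  have e2 := H' i
  have e3 : exPA L ((h - h') i) (p 0) = exPA L (h i) (p 0) - exPA L (h' i) (p 0) := by
    simp only [exPA_apply _ hm]; rfl
  have e4 : ∑ k, ePA L (Rp p B i k) * (h - h') k =
      (∑ k, ePA L (Rp p B i k) * h k + g i) - (∑ k, ePA L (Rp p B i k) * h' k + g i) := by
    rw [add_sub_add_right_eq_sub, ← Finset.sum_sub_distrib]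
    exact Finset.sum_congr rfl fun k _ => mul_sub _ _ _
  rw [e3, e4, Pi.zero_apply, add_zero, map_sub (Gop p L), Polynomial.C_sub, map_sub (ePA L),
    Pi.sub_apply]
  conv_lhs => rw [e1, e2]
  abel

theorem SolL_zero (hp : Function.Injective p) {B : Fin (S + 2) → Matrix ι ι ℂ}
    (hB : ∀ (k : ℕ) (a : ι → ℂ), (k : ℂ) • a - (∑ j, B j) *ᵥ a = 0 → a = 0) {L : Set ℂ}
    [CompactSpace L] (hL : Nice D p L) {h : ι → PA L} (H : SolL p B L 0 h) : h = 0 := by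
  have hm := interior_subset (hL.pin 0)
  refine injective_of_surjective_compact (Kop p B L ⟨p 0, hm⟩) (Kop_compact hp B hL _)
    (Kop_surj hp B hB hL ⟨p 0, hm⟩ rfl) h ?_
  funext i
  show h i - Kop p B L ⟨p 0, hm⟩ h i = 0
  rw [Kop_apply, cstPA_apply, mulPA_apply]
  have h1 := H i
  rw [exPA_apply _ hm, Pi.zero_apply, add_zero] at h1
  exact sub_eq_zero.2 h1

theorem SolL_unique (hp : Function.Injective p) {B : Fin (S + 2) → Matrix ι ι ℂ}
    (hB : ∀ (k : ℕ) (a : ι → ℂ), (k : ℂ) • a - (∑ j, B j) *ᵥ a = 0 → a = 0) {L : Set ℂ}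
    [CompactSpace L] (hL : Nice D p L) {g h h' : ι → PA L} (H : SolL p B L g h)
    (H' : SolL p B L g h') : h = h' :=
  sub_eq_zero.1 (SolL_zero hp hB hL (SolL_sub (interior_subset (hL.pin 0)) H H'))

theorem resPA_add {L L' : Set ℂ} [CompactSpace L] [CompactSpace L'] (h : L ⊆ L') (v w : PA L') :
    resPA h (v + w) = resPA h v + resPA h w := rfl

theorem resPA_mul {L L' : Set ℂ} [CompactSpace L] [CompactSpace L'] (h : L ⊆ L') (v w : PA L') :
    resPA h (v * w) = resPA h v * resPA h w := rfl

theorem resPA_ePA {L L' : Set ℂ} [CompactSpace L] [CompactSpace L'] (h : L ⊆ L')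
    (q : Polynomial ℂ) : resPA h (ePA L' q) = ePA L q := rfl

theorem resPA_sum {L L' : Set ℂ} [CompactSpace L] [CompactSpace L'] (h : L ⊆ L') {κ : Type*}
    (s : Finset κ) (v : κ → PA L') :
    resPA h (∑ k ∈ s, v k) = ∑ k ∈ s, resPA h (v k) :=
  map_sum (AddMonoidHom.mk' (resPA h) fun _ _ => rfl) v s

theorem SolL_res (hp : Function.Injective p) {B : Fin (S + 2) → Matrix ι ι ℂ} {L L' : Set ℂ}
    [CompactSpace L] [CompactSpace L'] (hL : Nice D p L) (hL' : Nice D p L') (hs : L ⊆ L')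
    {g h : ι → PA L'} (H : SolL p B L' g h) :
    SolL p B L (fun i => resPA hs (g i)) (fun i => resPA hs (h i)) := by
  intro i
  have h1 := congrArg (resPA hs) (H i)
  rw [resPA_add, Gop_res hp hL hL', resPA_add, resPA_ePA, resPA_sum,
    ← exPA_res hs _ (interior_subset (hL.pin 0))] at h1
  exact h1

end SystemL

section Linear

variable {ι : Type*} [Fintype ι] {S : ℕ} {D : Set ℂ} {p : Fin (S + 2) → ℂ}

theorem exPA_mul {L : Set ℂ} [CompactSpace L] (v w : PA L) {x : ℂ} :
    exPA L (v * w) x = exPA L v x * exPA L w x := by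
  by_cases h : x ∈ L
  · simp only [exPA_apply _ h]; rfl
  · simp [exPA, h]

theorem exPA_sum {L : Set ℂ} [CompactSpace L] {κ : Type*} (s : Finset κ) (v : κ → PA L) {x : ℂ} :
    exPA L (∑ k ∈ s, v k) x = ∑ k ∈ s, exPA L (v k) x :=
  map_sum (AddMonoidHom.mk' (fun v => exPA L v x) fun _ _ => exPA_add _ _) v s

/-- `h` restricted to `L` solves the integral equation with right hand side `g` -/
def IsSolOn (p : Fin (S + 2) → ℂ) (B : Fin (S + 2) → Matrix ι ι ℂ) (g : ι → ℂ → ℂ) (L : Set ℂ)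
    (h : ι → ℂ → ℂ) : Prop :=
  ∃ (_ : CompactSpace L) (gL hL : ι → PA L), (∀ i, ∀ x ∈ L, exPA L (gL i) x = g i x) ∧
    SolL p B L gL hL ∧ ∀ i, ∀ x ∈ L, h i x = exPA L (hL i) x

theorem IsSolOn.mono (hp : Function.Injective p) {B : Fin (S + 2) → Matrix ι ι ℂ} {g h : ι → ℂ → ℂ}
    {L L' : Set ℂ} (hL : Nice D p L) (hL' : Nice D p L') (hs : L ⊆ L') (H : IsSolOn p B g L' h) :
    IsSolOn p B g L h := by
  have : CompactSpace L := isCompact_iff_compactSpace.1 hL.compact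
  obtain ⟨_, gL, hL1, h1, h2, h3⟩ := H
  refine ⟨inferInstance, fun i => resPA hs (gL i), fun i => resPA hs (hL1 i), fun i x hx => ?_,
    SolL_res hp hL hL' hs h2, fun i x hx => ?_⟩
  · rw [exPA_res hs _ hx, h1 i x (hs hx)]
  · rw [exPA_res hs _ hx, h3 i x (hs hx)]

theorem IsSolOn.unique (hp : Function.Injective p) {B : Fin (S + 2) → Matrix ι ι ℂ}
    (hB : ∀ (k : ℕ) (a : ι → ℂ), (k : ℂ) • a - (∑ j, B j) *ᵥ a = 0 → a = 0) {g h h' : ι → ℂ → ℂ}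
    {L : Set ℂ} (hL : Nice D p L) (H : IsSolOn p B g L h) (H' : IsSolOn p B g L h') (i : ι) {x : ℂ}
    (hx : x ∈ L) : h i x = h' i x := by
  obtain ⟨_, gL, hL1, h1, h2, h3⟩ := H
  obtain ⟨_, gL', hL1', h1', h2', h3'⟩ := H'
  have hg : gL = gL' := funext fun i => PA_ext fun x hx => (h1 i x hx).trans (h1' i x hx).symm
  subst hg
  rw [h3 i x hx, h3' i x hx, SolL_unique hp hB hL h2 h2']

/-- the right hand side polynomial -/
noncomputable def psiOf (p : Fin (S + 2) → ℂ) (B : Fin (S + 2) → Matrix ι ι ℂ) (g h : ι → ℂ → ℂ)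
    (i : ι) : Polynomial ℂ :=
  rpoly p fun j => ∑ k, (Rp p B i k).eval (p j) * h k (p j) + g i (p j)

theorem IsSolOn.spec (hp : Function.Injective p) {B : Fin (S + 2) → Matrix ι ι ℂ}
    {g h : ι → ℂ → ℂ} {L : Set ℂ} (hL : Nice D p L) (H : IsSolOn p B g L h) :
    (∀ i, DifferentiableOn ℂ (h i) (interior L)) ∧
    (∀ i, (psiOf p B g h i).degree < ((S + 1 : ℕ) : WithBot ℕ)) ∧
    ∀ i, ∀ x ∈ interior L, (nodQ p).eval x * deriv (h i) x =
      ∑ k, (Rp p B i k).eval x * h k x + g i x - (psiOf p B g h i).eval x := by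
  obtain ⟨_, gL, hL1, h1, h2, h3⟩ := H
  have hpL : ∀ j, p j ∈ L := fun j => interior_subset (hL.pin j)
  have hv : ∀ i, ∀ x ∈ L, exPA L (∑ k, ePA L (Rp p B i k) * hL1 k + gL i) x =
      ∑ k, (Rp p B i k).eval x * h k x + g i x := by
    intro i x hx
    rw [exPA_add, exPA_sum, h1 i x hx]
    congr 1
    exact Finset.sum_congr rfl fun k _ => by rw [exPA_mul, exPA_ePA _ hx, h3 k x hx]
  have hpsi : ∀ i, psiOf p B g h i =
      rpoly p fun j => exPA L (∑ k, ePA L (Rp p B i k) * hL1 k + gL i) (p j) := by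
    intro i
    rw [psiOf]
    congr 1
    funext j
    rw [hv i _ (hpL j)]
  refine ⟨fun i => (PA_diff (hL1 i)).congr fun x hx => h3 i x (interior_subset hx), fun i => ?_,
    fun i x hx => ?_⟩
  · have ht : topc p (fun j => exPA L (∑ k, ePA L (Rp p B i k) * hL1 k + gL i) (p j)) = 0 := by
      rw [← Gop_zero hp hL]
      have e := congrArg (fun v => exPA L v (p 0)) (h2 i)
      simp only [exPA_add] at e
      rw [exPA_ePA _ (hpL 0), Polynomial.eval_C] at e
      have e' := left_eq_add.1 e
      exact e'
    have hd := rpoly_degree p hp (fun j => exPA L (∑ k, ePA L (Rp p B i k) * hL1 k + gL i) (p j))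
    rw [← hpsi] at hd
    have ht' : (psiOf p B g h i).coeff (S + 1) = 0 := by rw [hpsi]; exact ht
    rw [Polynomial.degree_lt_iff_coeff_zero] at hd ⊢
    intro m hm
    rcases Nat.eq_or_lt_of_le hm with rfl | hlt
    · exact ht'
    · exact hd m hlt
  · have hs := Gop_spec hp hL (∑ k, ePA L (Rp p B i k) * hL1 k + gL i) hx
    rw [← hpsi, hv i x (interior_subset hx)] at hs
    have hd : deriv (h i) x = deriv (exPA L (Gop p L (∑ k, ePA L (Rp p B i k) * hL1 k + gL i))) x := by
      have : h i =ᶠ[𝓝 x] fun y => exPA L (hL1 i) (p 0) +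
          exPA L (Gop p L (∑ k, ePA L (Rp p B i k) * hL1 k + gL i)) y := by
        filter_upwards [isOpen_interior.mem_nhds hx] with y hy
        have hyL := interior_subset hy
        rw [h3 i y hyL]
        conv_lhs => rw [h2 i]
        rw [exPA_add, exPA_ePA _ hyL, Polynomial.eval_C]
      rw [this.deriv_eq, deriv_const_add]
    rw [hd, hs]
    ring

theorem IsSolOn.exists' (hp : Function.Injective p) {B : Fin (S + 2) → Matrix ι ι ℂ}
    (hB : ∀ (k : ℕ) (a : ι → ℂ), (k : ℂ) • a - (∑ j, B j) *ᵥ a = 0 → a = 0) (hD : IsOpen D)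
    (hsc : SimplyConnectedSpace D) {g : ι → ℂ → ℂ} (hg : ∀ i, DifferentiableOn ℂ (g i) D)
    {L : Set ℂ} (hL : Nice D p L) : ∃ h, IsSolOn p B g L h := by
  have : CompactSpace L := isCompact_iff_compactSpace.1 hL.compact
  have := fun i => runge L D hD hsc hL.sub (g i) (hg i)
  choose gL hgm hgL using this
  obtain ⟨h, hh⟩ := SolL_exists hp B hB hL fun i => ⟨gL i, hgm i⟩
  refine ⟨fun i => exPA L (h i), inferInstance, _, h, fun i x hx => ?_, hh, fun _ _ _ => rfl⟩
  rw [exPA_apply _ hx]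
  exact hgL i ⟨x, hx⟩

theorem linear_exists (hp : Function.Injective p) (B : Fin (S + 2) → Matrix ι ι ℂ)
    (hB : ∀ (k : ℕ) (a : ι → ℂ), (k : ℂ) • a - (∑ j, B j) *ᵥ a = 0 → a = 0) (hD : IsOpen D)
    (hsc : SimplyConnectedSpace D) (hpD : ∀ j, p j ∈ D) (g : ι → ℂ → ℂ)
    (hg : ∀ i, DifferentiableOn ℂ (g i) D) :
    ∃ (h : ι → ℂ → ℂ) (ψ : ι → Polynomial ℂ), (∀ i, DifferentiableOn ℂ (h i) D) ∧
      (∀ i, (ψ i).degree < ((S + 1 : ℕ) : WithBot ℕ)) ∧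
      ∀ i, ∀ x ∈ D, (nodQ p).eval x * deriv (h i) x =
        ∑ k, (Rp p B i k).eval x * h k x + g i x - (ψ i).eval x := by
  classical
  have hH : ∀ L : Set ℂ, ∃ h : ι → ℂ → ℂ, Nice D p L → IsSolOn p B g L h := by
    intro L
    by_cases hL : Nice D p L
    · obtain ⟨h, hh⟩ := IsSolOn.exists' hp hB hD hsc hg hL
      exact ⟨h, fun _ => hh⟩
    · exact ⟨0, fun h => absurd h hL⟩
  choose H hH using hH
  have hN : ∀ x : ℂ, ∃ L : Set ℂ, x ∈ D → Nice D p L ∧ x ∈ interior L := by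
    intro x
    by_cases hx : x ∈ D
    · obtain ⟨L, h1, h2⟩ := exists_nice p hD hsc hpD (K := {x}) isCompact_singleton
        (singleton_subset_iff.2 hx)
      exact ⟨L, fun _ => ⟨h1, singleton_subset_iff.1 h2⟩⟩
    · exact ⟨∅, fun h => absurd h hx⟩
  choose N hN using hN
  set h : ι → ℂ → ℂ := fun i x => H (N x) i x with hh
  have hsol : ∀ L, Nice D p L → IsSolOn p B g L h := by
    intro L hL
    have : ∀ i, ∀ x ∈ L, h i x = H L i x := by
      intro i x hx
      obtain ⟨hNn, hNi⟩ := hN x (hL.sub hx)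
      obtain ⟨L3, h3, hs3⟩ := exists_nice p hD hsc hpD (hL.compact.union hNn.compact)
        (union_subset hL.sub hNn.sub)
      have hs3' := hs3.trans interior_subset
      have sol3 := hH L3 h3
      have e1 := (hH L hL).unique hp hB hL (sol3.mono hp hL h3 (subset_union_left.trans hs3')) i hx
      have e2 := (hH (N x) hNn).unique hp hB hNn
        (sol3.mono hp hNn h3 (subset_union_right.trans hs3')) i (interior_subset hNi)
      rw [e1]; exact e2
    obtain ⟨c, gL, hL1, h1, h2, h3⟩ := hH L hL
    exact ⟨c, gL, hL1, h1, h2, fun i x hx => (this i x hx).trans (h3 i x hx)⟩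
  refine ⟨h, psiOf p B g h, fun i x hx => ?_, ?_, fun i x hx => ?_⟩
  · obtain ⟨hNn, hNi⟩ := hN x hx
    exact (((hsol _ hNn).spec hp hNn).1 i |>.differentiableAt
      (isOpen_interior.mem_nhds hNi)).differentiableWithinAt
  · obtain ⟨hNn, hNi⟩ := hN (p 0) (hpD 0)
    exact ((hsol _ hNn).spec hp hNn).2.1
  · obtain ⟨hNn, hNi⟩ := hN x hx
    exact ((hsol _ hNn).spec hp hNn).2.2 i x hNi

end Linear

section LinearUniq

variable {ι : Type*} [Fintype ι] {S : ℕ} {D : Set ℂ} {p : Fin (S + 2) → ℂ}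

theorem G0_special (hp : Function.Injective p) (s ψ : Polynomial ℂ)
    (hψ : ψ.degree < ((S + 1 : ℕ) : WithBot ℕ)) :
    G0 p (nodQ p * s + ψ) = primP (p 0) s := by
  have hd : ψ.degree < ((S + 2 : ℕ) : WithBot ℕ) := hψ.trans (by exact_mod_cast Nat.lt_succ_self _)
  have e3 : ψ = rpoly p fun j => (nodQ p * s + ψ).eval (p j) := by
    refine eq_rpoly p hp _ ψ hd fun j => ?_
    rw [Polynomial.eval_add, Polynomial.eval_mul, nodQ_eval,
      Finset.prod_eq_zero (Finset.mem_univ j) (sub_self _)]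
    ring
  have e4 : topc p (fun j => (nodQ p * s + ψ).eval (p j)) = 0 := by
    show (rpoly p _).coeff (S + 1) = _
    rw [← e3, (Polynomial.degree_lt_iff_coeff_zero _ _).1 hψ _ le_rfl]
  rw [G0_apply, div_unique p s ψ hd, e4, map_zero, add_zero]

theorem Gop_of_deriv (hp : Function.Injective p) (hD : IsOpen D) (hsc : SimplyConnectedSpace D)
    {L : Set ℂ} [CompactSpace L] (hL : Nice D p L) (h : ℂ → ℂ) (hh : DifferentiableOn ℂ h D)
    (ψ : Polynomial ℂ) (hψ : ψ.degree < ((S + 1 : ℕ) : WithBot ℕ)) (u v : PA L)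
    (hu : ∀ x ∈ L, exPA L u x = h x)
    (hv : ∀ x ∈ L, exPA L v x = (nodQ p).eval x * deriv h x + ψ.eval x) :
    u = ePA L (Polynomial.C (h (p 0))) + Gop p L v := by
  have hp0 : p 0 ∈ L := interior_subset (hL.pin 0)
  obtain ⟨s', hs', hs⟩ := runge L D hD hsc hL.sub (deriv h) (hh.deriv hD)
  set s : PA L := ⟨s', hs'⟩ with hsdef
  have hsx : ∀ x ∈ L, exPA L s x = deriv h x := fun x hx => by
    rw [exPA_apply _ hx]; exact hs ⟨x, hx⟩
  obtain ⟨q, hq⟩ := PA_seq s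
  obtain ⟨C, hC0, hC⟩ := hL.prim_bound (p 0) hp0
  -- primitives converge
  have h1 : Tendsto (fun k => ePA L (primP (p 0) (q k)) + ePA L (Polynomial.C (h (p 0)))) atTop (𝓝 u) := by
    rw [tendsto_iff_norm_sub_tendsto_zero]
    have hq' := tendsto_iff_norm_sub_tendsto_zero.1 hq
    have hq2 := hq'.const_mul C
    rw [mul_zero] at hq2
    refine squeeze_zero (fun _ => norm_nonneg _) (fun k => ?_) hq2
    refine PA_norm_le L _ (by positivity) fun x => ?_
    have key := hC (fun y => (primP (p 0) (q k)).eval y - h y) ‖ePA L (q k) - s‖ (fun y hy =>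
      ((primP (p 0) (q k)).differentiableAt).sub (hh.differentiableAt (hD.mem_nhds (hL.sub hy))))
      (fun y hy => by
        have hd : deriv (fun y => (primP (p 0) (q k)).eval y - h y) y = (q k).eval y - deriv h y := by
          have := ((primP (p 0) (q k)).hasDerivAt y).sub
            (hh.differentiableAt (hD.mem_nhds (hL.sub hy))).hasDerivAt
          rw [derivative_primP] at this
          exact this.deriv
        rw [hd, ← hsx y hy, ← exPA_ePA (L := L) (q k) hy, exPA_apply _ hy, exPA_apply _ hy]
        exact PA_le_norm L (ePA L (q k) - s) ⟨y, hy⟩) x x.2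
    simp only [primP_eval] at key
    refine le_trans (le_of_eq ?_) key
    have := hu x x.2
    rw [exPA_apply _ x.2] at this
    show ‖((primP (p 0) (q k)).eval (x : ℂ) + (Polynomial.C (h (p 0))).eval (x : ℂ)) - (u : C(L, ℂ)) x‖ = _
    rw [this, Polynomial.eval_C]
    congr 1; ring
  have h2 : Tendsto (fun k => ePA L (nodQ p * q k + ψ)) atTop (𝓝 v) := by
    have : v = ePA L (nodQ p) * s + ePA L ψ := PA_ext fun x hx => by
      rw [hv x hx, exPA_add, exPA_mul, exPA_ePA _ hx, exPA_ePA _ hx, hsx x hx]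
    rw [this]
    refine ((hq.const_mul (ePA L (nodQ p))).add_const (ePA L ψ)).congr fun k => ?_
    rw [map_add, ePA_mul]
  have h3 := ((Gop p L).continuous.tendsto v).comp h2
  have h4 : Tendsto (fun k => ePA L (primP (p 0) (q k)) + ePA L (Polynomial.C (h (p 0)))) atTop
      (𝓝 (Gop p L v + ePA L (Polynomial.C (h (p 0))))) := by
    refine (h3.add_const _).congr fun k => ?_
    simp only [Function.comp]
    rw [Gop_ePA hp hL, G0_special hp _ _ hψ]
  rw [add_comm]
  exact tendsto_nhds_unique h1 h4

theorem linear_unique (hp : Function.Injective p) (B : Fin (S + 2) → Matrix ι ι ℂ)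
    (hB : ∀ (k : ℕ) (a : ι → ℂ), (k : ℂ) • a - (∑ j, B j) *ᵥ a = 0 → a = 0) (hD : IsOpen D)
    (hsc : SimplyConnectedSpace D) (hpD : ∀ j, p j ∈ D) (h : ι → ℂ → ℂ) (ψ : ι → Polynomial ℂ)
    (hh : ∀ i, DifferentiableOn ℂ (h i) D)
    (hψ : ∀ i, (ψ i).degree < ((S + 1 : ℕ) : WithBot ℕ))
    (hode : ∀ i, ∀ x ∈ D, x ∉ range p → (nodQ p).eval x * deriv (h i) x =
        ∑ k, (Rp p B i k).eval x * h k x - (ψ i).eval x) :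
    (∀ i, ∀ x ∈ D, h i x = 0) ∧ ∀ i, ψ i = 0 := by
  have hode' : ∀ i, ∀ x ∈ D, (nodQ p).eval x * deriv (h i) x =
        ∑ k, (Rp p B i k).eval x * h k x - (ψ i).eval x := by
    intro i x hx
    have hc1 : ContinuousAt (fun x => (nodQ p).eval x * deriv (h i) x) x :=
      (nodQ p).continuousAt.mul (((hh i).deriv hD).continuousOn.continuousAt (hD.mem_nhds hx))
    have hc2 : ContinuousAt (fun x => ∑ k, (Rp p B i k).eval x * h k x - (ψ i).eval x) x := by
      refine ContinuousAt.sub ?_ (ψ i).continuousAt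
      exact tendsto_finsetSum _ fun k _ => ((Rp p B i k).continuousAt (a := x)).mul
        ((hh k).continuousOn.continuousAt (hD.mem_nhds hx))
    have hev : ∀ᶠ y in 𝓝[≠] x, (nodQ p).eval y * deriv (h i) y =
        ∑ k, (Rp p B i k).eval y * h k y - (ψ i).eval y := by
      have hf : ((range p) \ {x})ᶜ ∈ 𝓝 x :=
        ((finite_range p).sdiff).isClosed.isOpen_compl.mem_nhds (by simp)
      filter_upwards [self_mem_nhdsWithin, mem_nhdsWithin_of_mem_nhds hf,
        mem_nhdsWithin_of_mem_nhds (hD.mem_nhds hx)] with y h1 h2 h3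
      exact hode i y h3 fun hy => h2 ⟨hy, h1⟩
    refine tendsto_nhds_unique_of_eventuallyEq (hc1.tendsto.mono_left (nhdsWithin_le_nhds (s := {x}ᶜ)))
      (hc2.tendsto.mono_left nhdsWithin_le_nhds) hev
  have hzero : ∀ i, ∀ x ∈ D, h i x = 0 := by
    intro i x hx
    obtain ⟨L, hL, hxL⟩ := exists_nice p hD hsc hpD (K := {x}) isCompact_singleton
        (singleton_subset_iff.2 hx)
    have hxL' : x ∈ L := interior_subset (singleton_subset_iff.1 hxL)
    have : CompactSpace L := isCompact_iff_compactSpace.1 hL.compact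
    have hr := fun i => runge L D hD hsc hL.sub (h i) (hh i)
    choose hL0 hLm hLx using hr
    let u : ι → PA L := fun i => ⟨hL0 i, hLm i⟩
    have hu : ∀ i, ∀ x ∈ L, exPA L (u i) x = h i x := fun i x hx => by
      rw [exPA_apply _ hx]; exact hLx i ⟨x, hx⟩
    have hsol : SolL p B L 0 u := by
      intro i
      rw [hu i _ (interior_subset (hL.pin 0)), Pi.zero_apply, add_zero]
      refine Gop_of_deriv hp hD hsc hL (h i) (hh i) (ψ i) (hψ i) _ _ (hu i) fun y hy => ?_
      rw [hode' i y (hL.sub hy), exPA_sum, sub_add_cancel]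
      exact Finset.sum_congr rfl fun k _ => by rw [exPA_mul, exPA_ePA _ hy, hu k y hy]
    have h0 := SolL_zero hp hB hL hsol
    rw [← hu i x hxL', h0]
    rw [exPA_apply _ hxL']; rfl
  refine ⟨hzero, fun i => ?_⟩
  have e : ψ i = rpoly p 0 := by
    refine eq_rpoly p hp _ _ ((hψ i).trans (by exact_mod_cast Nat.lt_succ_self _)) fun j => ?_
    have h1 := hode' i (p j) (hpD j)
    rw [nodQ_eval, Finset.prod_eq_zero (Finset.mem_univ j) (sub_self _), zero_mul,
      Finset.sum_eq_zero fun k _ => by rw [hzero k _ (hpD j), mul_zero], zero_sub] at h1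
    exact neg_eq_zero.1 h1.symm
  rw [e, map_zero]

end LinearUniq

section Resonance

variable {d : ℕ}

theorem find_factor (M : Matrix (Fin d) (Fin d) ℂ) (lam : Fin d → ℂ)
    (K : Submodule ℂ (Fin d → ℂ)) (s : Finset (Fin d)) :
    ∀ u, u ∉ K → (Polynomial.aeval M (∏ i ∈ s, (Polynomial.X - Polynomial.C (lam i)))) *ᵥ u ∈ K →
      ∃ v i, v ∉ K ∧ M *ᵥ v - lam i • v ∈ K := by
  classical
  induction s using Finset.induction_on with
  | empty =>
    intro u hu h
    rw [Finset.prod_empty, map_one, Matrix.one_mulVec] at h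
    exact absurd h hu
  | insert i s hi ih =>
    intro u hu h
    rw [Finset.prod_insert hi, map_mul, ← Matrix.mulVec_mulVec] at h
    by_cases hc : (Polynomial.aeval M (∏ i ∈ s, (Polynomial.X - Polynomial.C (lam i)))) *ᵥ u ∈ K
    · exact ih u hu hc
    · refine ⟨_, i, hc, ?_⟩
      rw [map_sub, Polynomial.aeval_X, Polynomial.aeval_C, Matrix.sub_mulVec,
        Algebra.algebraMap_eq_smul_one, Matrix.smul_mulVec, Matrix.one_mulVec] at h
      exact h

theorem eigen_root (M : Matrix (Fin d) (Fin d) ℂ) (lam : Fin d → ℂ)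
    (hM : M.charpoly = ∏ i, (Polynomial.X - Polynomial.C (lam i))) (c : ℂ) (v : Fin d → ℂ)
    (hv : v ≠ 0) (h : c • v = M *ᵥ v) : ∃ i, c = lam i := by
  have h1 : (Matrix.charpoly M).eval c = 0 := by
    rw [Matrix.eval_charpoly]
    refine Matrix.exists_mulVec_eq_zero_iff.1 ⟨v, hv, ?_⟩
    rw [Matrix.sub_mulVec, ← h]
    simp [Matrix.scalar_apply, ← Matrix.smul_one_eq_diagonal, Matrix.smul_mulVec]
  rw [hM, Polynomial.eval_prod, Finset.prod_eq_zero_iff] at h1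
  obtain ⟨i, -, hi⟩ := h1
  refine ⟨i, ?_⟩
  simpa [sub_eq_zero] using hi

theorem resonance (M : Matrix (Fin d) (Fin d) ℂ) (lam : Fin d → ℂ)
    (hM : M.charpoly = ∏ i, (Polynomial.X - Polynomial.C (lam i))) (n : ℕ) :
    ∀ (c : ℂ) (h : (Fin d → ℂ) → (Fin d → ℂ)), ContDiff ℂ ⊤ h →
      (∀ (t : ℂ) w, t ≠ 0 → h (t • w) = t ^ n • h w) → (∃ w, h w ≠ 0) →
      (∀ w, c • h w + fderiv ℂ h w (M *ᵥ w) - M *ᵥ h w = 0) →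
      ∃ (m : Fin d → ℕ) (i : Fin d), ∑ j, m j = n ∧ c + ∑ j, (m j : ℂ) * lam j - lam i = 0 := by
  induction n with
  | zero =>
    intro c h hh hom hne heq
    have hconst : ∀ w, h w = h 0 := by
      intro w
      have h1 : Tendsto (fun t : ℂ => h (t • w)) (𝓝[≠] 0) (𝓝 (h 0)) := by
        have hc : Continuous fun t : ℂ => h (t • w) :=
          hh.continuous.comp (continuous_id.smul continuous_const)
        have := hc.tendsto 0
        rw [zero_smul] at this
        exact this.mono_left nhdsWithin_le_nhds
      have h2 : Tendsto (fun t : ℂ => h (t • w)) (𝓝[≠] 0) (𝓝 (h w)) := by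
        refine tendsto_const_nhds.congr' ?_
        filter_upwards [self_mem_nhdsWithin] with t ht
        rw [hom t w ht, pow_zero, one_smul]
      exact tendsto_nhds_unique h2 h1
    obtain ⟨w, hw⟩ := hne
    have hf : h = fun _ => h 0 := funext hconst
    have e := heq w
    rw [hf] at e
    simp only [fderiv_fun_const, Pi.zero_apply, _root_.zero_apply, add_zero] at e
    rw [hconst w] at hw
    obtain ⟨i, hi⟩ := eigen_root M lam hM c (h 0) hw (sub_eq_zero.1 e)
    exact ⟨0, i, by simp, by simp [hi]⟩
  | succ n ih =>
    intro c h hh hom hne heq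
    have hdiff : Differentiable ℂ h := hh.differentiable (by simp)
    let K : Submodule ℂ (Fin d → ℂ) :=
      { carrier := {v | ∀ w, fderiv ℂ h w v = 0}
        add_mem' := fun {a b} ha hb w => by rw [map_add, ha w, hb w, add_zero]
        zero_mem' := fun w => map_zero _
        smul_mem' := fun c a ha w => by rw [map_smul, ha w, smul_zero] }
    have hKtop : ∃ u, u ∉ K := by
      by_contra hc
      push Not at hc
      have h0 : ∀ w, fderiv ℂ h w = 0 := fun w => ContinuousLinearMap.ext fun v => hc v w
      have hconst := is_const_of_fderiv_eq_zero hdiff h0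
      have hz : h 0 = 0 := by
        have := hom 2 0 two_ne_zero
        rw [smul_zero] at this
        have h2 : ((2 : ℂ) ^ (n + 1) - 1) • h 0 = 0 := by rw [sub_smul, one_smul, ← this, sub_self]
        rcases smul_eq_zero.1 h2 with h3 | h3
        · exfalso
          have h4 : ((2 ^ (n + 1) : ℕ) : ℂ) = ((1 : ℕ) : ℂ) := by push_cast; exact sub_eq_zero.1 h3
          have h5 : 2 ^ (n + 1) = 1 := Nat.cast_injective h4
          have := Nat.one_lt_two_pow (Nat.succ_ne_zero n)
          omega
        · exact h3
      obtain ⟨w, hw⟩ := hne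
      exact hw ((hconst w 0).trans hz)
    obtain ⟨u, hu⟩ := hKtop
    obtain ⟨v, i, hv, hvi⟩ := find_factor M lam K Finset.univ u hu (by
      rw [← hM, Matrix.aeval_self_charpoly, Matrix.zero_mulVec]; exact K.zero_mem)
    have hsmooth : ContDiff ℂ ⊤ (fderiv ℂ h) := hh.fderiv_right (by simp)
    set h2 : (Fin d → ℂ) → (Fin d → ℂ) := fun w => fderiv ℂ h w v with hh2
    have hd1 : Differentiable ℂ (fderiv ℂ h) := hsmooth.differentiable (by simp)
    have hfd2 : ∀ w z, fderiv ℂ h2 w z = fderiv ℂ (fderiv ℂ h) w z v := by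
      intro w z
      have : HasFDerivAt h2 ((ContinuousLinearMap.apply ℂ (Fin d → ℂ) v).comp
          (fderiv ℂ (fderiv ℂ h) w)) w :=
        (ContinuousLinearMap.apply ℂ (Fin d → ℂ) v).hasFDerivAt.comp w (hd1 w).hasFDerivAt
      rw [this.fderiv]; rfl
    have hsym : ∀ w a b, fderiv ℂ (fderiv ℂ h) w a b = fderiv ℂ (fderiv ℂ h) w b a := by
      intro w a b
      exact second_derivative_symmetric (f := h) (fun y => (hdiff y).hasFDerivAt) (hd1 w).hasFDerivAt a b
    have hMc : ∀ y : Fin d → ℂ, M *ᵥ y = LinearMap.toContinuousLinearMap (Matrix.mulVecLin M) y := fun y => rfl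
    obtain ⟨m, i', hm, hres⟩ := ih (c + lam i) h2 (hsmooth.clm_apply contDiff_const) (by
      intro t w ht
      have e1 : (fun w => h (t • w)) = fun w => t ^ (n + 1) • h w := funext fun w => hom t w ht
      have e2 : HasFDerivAt (fun w => h (t • w)) ((fderiv ℂ h (t • w)).comp
          (t • ContinuousLinearMap.id ℂ (Fin d → ℂ))) w := by
        have hb : HasFDerivAt (fun w : Fin d → ℂ => t • w) (t • ContinuousLinearMap.id ℂ (Fin d → ℂ)) w :=
          (hasFDerivAt_id w).const_smul t
        exact (hdiff (t • w)).hasFDerivAt.comp w hb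
      have e3 : HasFDerivAt (fun w => t ^ (n + 1) • h w) (t ^ (n + 1) • fderiv ℂ h w) w :=
        (hdiff w).hasFDerivAt.fun_const_smul _
      rw [e1] at e2
      have e4 := congrArg (fun T => T v) (e2.unique e3)
      have e5 : t • fderiv ℂ h (t • w) v = t ^ (n + 1) • fderiv ℂ h w v := by
        rw [← map_smul]; exact e4
      show fderiv ℂ h (t • w) v = t ^ n • fderiv ℂ h w v
      rw [pow_succ', mul_smul] at e5
      exact smul_right_injective _ ht e5)
      (by
        by_contra hc
        push Not at hc
        exact hv hc)
      (by
        intro w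
        have e1 : (fun w => c • h w + fderiv ℂ h w (M *ᵥ w) - M *ᵥ h w) = fun _ => 0 := funext heq
        have e2 : HasFDerivAt (fun w => c • h w + fderiv ℂ h w (M *ᵥ w) - M *ᵥ h w)
            (c • fderiv ℂ h w + ((fderiv ℂ h w).comp (LinearMap.toContinuousLinearMap (Matrix.mulVecLin M)) +
              (fderiv ℂ (fderiv ℂ h) w).flip (M *ᵥ w)) -
              (LinearMap.toContinuousLinearMap (Matrix.mulVecLin M)).comp (fderiv ℂ h w)) w := by
          refine HasFDerivAt.sub (HasFDerivAt.add ((hdiff w).hasFDerivAt.const_smul c) ?_) ?_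
          · exact (hd1 w).hasFDerivAt.clm_apply
              (LinearMap.toContinuousLinearMap (Matrix.mulVecLin M)).hasFDerivAt
          · exact (LinearMap.toContinuousLinearMap (Matrix.mulVecLin M)).hasFDerivAt.comp w
              (hdiff w).hasFDerivAt
        rw [e1] at e2
        have e3 := congrArg (fun T => T v) (e2.unique (hasFDerivAt_const 0 w))
        have e4 : c • fderiv ℂ h w v + (fderiv ℂ h w (M *ᵥ v) + fderiv ℂ (fderiv ℂ h) w v (M *ᵥ w)) -
          M *ᵥ (fderiv ℂ h w v) = 0 := e3
        have e5 := hvi w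
        rw [map_sub, map_smul, sub_eq_zero] at e5
        rw [hfd2, hsym, add_smul]
        rw [e5] at e4
        show c • fderiv ℂ h w v + lam i • fderiv ℂ h w v + _ - M *ᵥ (fderiv ℂ h w v) = 0
        rw [← e4]; abel)
    refine ⟨m + Pi.single i 1, i', ?_, ?_⟩
    · simp [Finset.sum_add_distrib, hm]
    · rw [← hres]
      simp only [Pi.add_apply, Nat.cast_add, add_mul, Finset.sum_add_distrib]
      have : ∑ j, ((Pi.single i 1 : Fin d → ℕ) j : ℂ) * lam j = lam i := by
        rw [Finset.sum_eq_single i]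
        · simp
        · intro b _ hb; simp [hb]
        · simp
      rw [this]; ring

end Resonance

/-- Index type for the coefficients of a homogeneous vector polynomial of degree n. -/
abbrev Idx (d n : ℕ) := ↥(Finset.piAntidiag (Finset.univ : Finset (Fin d)) n) × Fin d

section homog
variable {d : ℕ}

noncomputable def homI (n : ℕ) (c : Idx d n → ℂ) (w : Fin d → ℂ) : Fin d → ℂ :=
  ∑ m : ↥(Finset.piAntidiag (Finset.univ : Finset (Fin d)) n),
    (∏ i, w i ^ m.1 i) • fun i => c (m, i)

noncomputable def homP (n : ℕ) (c : Idx d n → ℂ) (i : Fin d) : MvPolynomial (Fin d) ℂ :=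
  ∑ m : ↥(Finset.piAntidiag (Finset.univ : Finset (Fin d)) n),
    MvPolynomial.monomial (Finsupp.equivFunOnFinite.symm m.1) (c (m, i))

theorem homI_apply (n : ℕ) (c : Idx d n → ℂ) (w : Fin d → ℂ) (i : Fin d) :
    homI n c w i = MvPolynomial.eval w (homP n c i) := by
  unfold homI homP
  rw [map_sum, Finset.sum_apply]
  refine Finset.sum_congr rfl fun m _ => ?_
  rw [MvPolynomial.eval_monomial, Finsupp.prod_fintype _ _ (by simp)]
  simp [mul_comm]

theorem homP_coeff (n : ℕ) (c : Idx d n → ℂ) (i : Fin d)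
    (m : ↥(Finset.piAntidiag (Finset.univ : Finset (Fin d)) n)) :
    (homP n c i).coeff (Finsupp.equivFunOnFinite.symm m.1) = c (m, i) := by
  classical
  unfold homP
  rw [MvPolynomial.coeff_sum, Finset.sum_eq_single m]
  · simp
  · intro b _ hb
    rw [MvPolynomial.coeff_monomial, if_neg]
    intro h
    exact hb (Subtype.ext (Finsupp.equivFunOnFinite.symm.injective h))
  · simp

theorem degree_symm (m : Fin d → ℕ) :
    (Finsupp.equivFunOnFinite.symm m : Fin d →₀ ℕ).degree = ∑ i, m i := by
  rw [Finsupp.degree_eq_sum]; simp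

theorem homP_homog (n : ℕ) (c : Idx d n → ℂ) (i : Fin d) : (homP n c i).IsHomogeneous n := by
  unfold homP
  refine MvPolynomial.IsHomogeneous.sum _ _ _ fun m _ => ?_
  refine MvPolynomial.isHomogeneous_monomial _ ?_
  rw [degree_symm]
  have := m.2
  rw [Finset.mem_piAntidiag] at this
  exact this.1

theorem homP_of_homog (n : ℕ) (φ : Fin d → MvPolynomial (Fin d) ℂ)
    (h : ∀ i, (φ i).IsHomogeneous n) (i : Fin d) :
    homP n (fun a => (φ a.2).coeff (Finsupp.equivFunOnFinite.symm a.1.1)) i = φ i := by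
  classical
  ext k
  by_cases hk : k.degree = n
  · have hm : (Finsupp.equivFunOnFinite k) ∈ Finset.piAntidiag (Finset.univ : Finset (Fin d)) n := by
      rw [Finset.mem_piAntidiag]
      refine ⟨?_, by simp⟩
      rw [← hk, Finsupp.degree_eq_sum]; rfl
    have := homP_coeff n (fun a => (φ a.2).coeff (Finsupp.equivFunOnFinite.symm a.1.1)) i ⟨_, hm⟩
    simpa using this
  · rw [(homP_homog n _ i).coeff_eq_zero hk, (h i).coeff_eq_zero hk]

theorem homI_inj (n : ℕ) (c : Idx d n → ℂ) (h : ∀ w, homI n c w = 0) : c = 0 := by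
  have h1 : ∀ i, homP n c i = 0 := by
    intro i
    refine MvPolynomial.funext fun w => ?_
    rw [← homI_apply, h]; simp
  funext ⟨m, i⟩
  have := homP_coeff n c i m
  rw [h1] at this
  simpa using this.symm

theorem homI_add (n : ℕ) (c c' : Idx d n → ℂ) (w : Fin d → ℂ) :
    homI n (c + c') w = homI n c w + homI n c' w := by
  unfold homI
  rw [← Finset.sum_add_distrib]
  refine Finset.sum_congr rfl fun m _ => ?_
  rw [← smul_add]; rfl

theorem homI_smul (n : ℕ) (t : ℂ) (c : Idx d n → ℂ) (w : Fin d → ℂ) :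
    homI n (t • c) w = t • homI n c w := by
  unfold homI
  rw [Finset.smul_sum]
  refine Finset.sum_congr rfl fun m _ => ?_
  rw [smul_comm]; rfl

noncomputable def homL (n : ℕ) (w : Fin d → ℂ) : (Idx d n → ℂ) →ₗ[ℂ] (Fin d → ℂ) where
  toFun c := homI n c w
  map_add' c c' := homI_add n c c' w
  map_smul' t c := homI_smul n t c w

theorem homL_apply (n : ℕ) (w : Fin d → ℂ) (c : Idx d n → ℂ) : homL n w c = homI n c w := rfl

theorem homI_hom (n : ℕ) (c : Idx d n → ℂ) (t : ℂ) (w : Fin d → ℂ) :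
    homI n c (t • w) = t ^ n • homI n c w := by
  unfold homI
  rw [Finset.smul_sum]
  refine Finset.sum_congr rfl fun m _ => ?_
  have := m.2
  rw [Finset.mem_piAntidiag] at this
  rw [← smul_assoc]
  congr 1
  simp only [Pi.smul_apply, smul_eq_mul, mul_pow]
  rw [Finset.prod_mul_distrib, Finset.prod_pow_eq_pow_sum, this.1]

theorem hasFDerivAt_mv (φ : MvPolynomial (Fin d) ℂ) (w : Fin d → ℂ) :
    HasFDerivAt (fun w => MvPolynomial.eval w φ)
      (∑ l, (MvPolynomial.eval w (MvPolynomial.pderiv l φ)) •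
        (ContinuousLinearMap.proj l : (Fin d → ℂ) →L[ℂ] ℂ)) w := by
  induction φ using MvPolynomial.induction_on with
  | C a =>
    refine ((hasFDerivAt_const a w).congr_of_eventuallyEq
      (Eventually.of_forall fun w => by simp)).congr_fderiv (ContinuousLinearMap.ext fun v => ?_)
    simp
  | add p q hp hq =>
    refine ((hp.add hq).congr_of_eventuallyEq (Eventually.of_forall fun w => by
      simp)).congr_fderiv (ContinuousLinearMap.ext fun v => ?_)
    simp [_root_.sum_apply, add_mul, Finset.sum_add_distrib]
  | mul_X p i hp =>
    have h1 : HasFDerivAt (fun w : Fin d → ℂ => w i)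
      (ContinuousLinearMap.proj i : (Fin d → ℂ) →L[ℂ] ℂ) w := hasFDerivAt_apply i w
    refine ((hp.mul h1).congr_of_eventuallyEq (Eventually.of_forall fun w => by
      simp)).congr_fderiv (ContinuousLinearMap.ext fun v => ?_)
    have e : ∀ l, MvPolynomial.eval w (MvPolynomial.pderiv l (p * MvPolynomial.X i)) * v l =
        w i * (MvPolynomial.eval w (MvPolynomial.pderiv l p) * v l) +
          (if l = i then MvPolynomial.eval w p * v l else 0) := by
      intro l
      by_cases hl : l = i
      · subst hl
        simp [MvPolynomial.pderiv_mul]; ring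
      · simp [MvPolynomial.pderiv_mul, MvPolynomial.pderiv_X_of_ne (Ne.symm hl), hl]; ring
    have e2 : (∑ l, (MvPolynomial.eval w (MvPolynomial.pderiv l (p * MvPolynomial.X i))) •
        (ContinuousLinearMap.proj l : (Fin d → ℂ) →L[ℂ] ℂ)) v =
        ∑ l, MvPolynomial.eval w (MvPolynomial.pderiv l (p * MvPolynomial.X i)) * v l := by
      rw [_root_.sum_apply]; rfl
    rw [e2, Finset.sum_congr rfl fun l _ => e l, Finset.sum_add_distrib, ← Finset.mul_sum]
    simp [add_comm]

theorem hasFDerivAt_homI (n : ℕ) (c : Idx d n → ℂ) (w : Fin d → ℂ) :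
    HasFDerivAt (homI n c) (ContinuousLinearMap.pi fun i =>
      ∑ l, (MvPolynomial.eval w (MvPolynomial.pderiv l (homP n c i))) •
        (ContinuousLinearMap.proj l : (Fin d → ℂ) →L[ℂ] ℂ)) w := by
  rw [hasFDerivAt_pi']
  intro i
  exact ((hasFDerivAt_mv (homP n c i) w).congr_of_eventuallyEq
    (Eventually.of_forall fun w => homI_apply n c w i)).congr_fderiv (by ext v; simp)

theorem homI_contDiff (n : ℕ) (c : Idx d n → ℂ) : ContDiff ℂ ⊤ (homI n c) := by
  unfold homI
  fun_prop

theorem exists_Lop (n : ℕ) (hn : 1 ≤ n) (M : Matrix (Fin d) (Fin d) ℂ) :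
    ∃ L : Matrix (Idx d n) (Idx d n) ℂ, ∀ c w,
      homI n (L *ᵥ c) w = M *ᵥ homI n c w - fderiv ℂ (homI n c) w (M *ᵥ w) := by
  classical
  let E : (Idx d n → ℂ) → Fin d → MvPolynomial (Fin d) ℂ := fun c i =>
    ∑ k, MvPolynomial.C (M i k) * homP n c k -
      ∑ l, MvPolynomial.pderiv l (homP n c i) * ∑ k, MvPolynomial.C (M l k) * MvPolynomial.X k
  have hPadd : ∀ (c c' : Idx d n → ℂ) (i : Fin d), homP n (c + c') i = homP n c i + homP n c' i := by
    intro c c' i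
    unfold homP
    rw [← Finset.sum_add_distrib]
    exact Finset.sum_congr rfl fun m _ => by rw [Pi.add_apply, map_add]
  have hPsmul : ∀ (t : ℂ) (c : Idx d n → ℂ) (i : Fin d), homP n (t • c) i = t • homP n c i := by
    intro t c i
    unfold homP
    rw [Finset.smul_sum]
    exact Finset.sum_congr rfl fun m _ => by rw [Pi.smul_apply, map_smul]
  have hE : ∀ c i, (E c i).IsHomogeneous n := by
    intro c i
    refine MvPolynomial.IsHomogeneous.sub ?_ ?_
    · refine MvPolynomial.IsHomogeneous.sum _ _ _ fun k _ => ?_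
      have := (MvPolynomial.isHomogeneous_C (Fin d) (M i k)).mul (homP_homog n c k)
      rwa [zero_add] at this
    · refine MvPolynomial.IsHomogeneous.sum _ _ _ fun l _ => ?_
      have h1 := (homP_homog n c i).pderiv (i := l)
      have h2 : (∑ k, MvPolynomial.C (M l k) * MvPolynomial.X k :
          MvPolynomial (Fin d) ℂ).IsHomogeneous 1 := by
        refine MvPolynomial.IsHomogeneous.sum _ _ _ fun k _ => ?_
        have := (MvPolynomial.isHomogeneous_C (Fin d) (M l k)).mul (MvPolynomial.isHomogeneous_X ℂ k)
        rwa [zero_add] at this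
      have := h1.mul h2
      rwa [Nat.sub_add_cancel hn] at this
  let T : (Idx d n → ℂ) →ₗ[ℂ] (Idx d n → ℂ) :=
    { toFun := fun c a => (E c a.2).coeff (Finsupp.equivFunOnFinite.symm a.1.1)
      map_add' := by
        intro c c'
        funext a
        have : E (c + c') a.2 = E c a.2 + E c' a.2 := by
          simp only [E, hPadd, map_add, mul_add, add_mul, Finset.sum_add_distrib]
          ring
        rw [this, MvPolynomial.coeff_add]; rfl
      map_smul' := by
        intro t c
        funext a
        have : E (t • c) a.2 = t • E c a.2 := by
          simp only [E, hPsmul, Derivation.map_smul, mul_smul_comm, smul_mul_assoc, smul_sub, Finset.smul_sum]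
        rw [this, MvPolynomial.coeff_smul]; rfl }
  refine ⟨LinearMap.toMatrix' T, fun c w => ?_⟩
  have h1 : LinearMap.toMatrix' T *ᵥ c = T c := by
    rw [← Matrix.toLin'_apply, Matrix.toLin'_toMatrix']
  rw [h1, (hasFDerivAt_homI n c w).fderiv]
  funext i
  rw [homI_apply]
  have h2 : homP n (T c) i = E c i := homP_of_homog n (E c) (hE c) i
  rw [h2]
  simp only [E, map_sub, map_sum, map_mul, MvPolynomial.eval_C, MvPolynomial.eval_X, Pi.sub_apply,
    Matrix.mulVec, dotProduct, homI_apply]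
  simp [Matrix.mulVec, dotProduct]

theorem Lop_nonres (n : ℕ) (hn : 2 ≤ n) (M : Matrix (Fin d) (Fin d) ℂ)
    (hM : NonlinearlyNonresonant d M) (k : ℕ) (c : Idx d n → ℂ)
    (h : ∀ w, (k : ℂ) • homI n c w - (M *ᵥ homI n c w - fderiv ℂ (homI n c) w (M *ᵥ w)) = 0) :
    c = 0 := by
  by_contra hc
  obtain ⟨lam, h1, h2⟩ := hM
  obtain ⟨m, i, hm, hr⟩ := resonance M lam h1 n k (homI n c) (homI_contDiff n c)
    (fun t w _ => homI_hom n c t w)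
    (by
      by_contra hcon
      push Not at hcon
      exact hc (homI_inj n c hcon))
    (fun w => by rw [← h w]; abel)
  exact h2 k m i (hm ▸ hn) hr

end homog

section taylor
variable {d : ℕ}

theorem homI_bigO_zero (n : ℕ) (c : Idx d n → ℂ)
    (h : (homI n c) =O[𝓝 0] fun w => ‖w‖ ^ (n + 1)) : c = 0 := by
  refine homI_inj n c fun w => ?_
  obtain ⟨K, hK⟩ := h.bound
  have h1 : Tendsto (fun t : ℂ => t • w) (𝓝[≠] 0) (𝓝 0) := by
    have : Tendsto (fun t : ℂ => t • w) (𝓝 0) (𝓝 ((0:ℂ) • w)) :=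
      (continuous_id.smul continuous_const).tendsto 0
    rw [zero_smul] at this
    exact this.mono_left nhdsWithin_le_nhds
  have h2 := h1.eventually hK
  have h3 : ∀ᶠ t : ℂ in 𝓝[≠] 0, ‖homI n c w‖ ≤ K * ‖t‖ * ‖w‖ ^ (n + 1) := by
    filter_upwards [h2, self_mem_nhdsWithin] with t ht ht0
    have ht0' : 0 < ‖t‖ := norm_pos_iff.mpr ht0
    rw [homI_hom, norm_smul, norm_pow, norm_pow, norm_norm, norm_smul, mul_pow] at ht
    have : ‖t‖ ^ n * ‖homI n c w‖ ≤ ‖t‖ ^ n * (K * ‖t‖ * ‖w‖ ^ (n + 1)) := by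
      refine ht.trans (le_of_eq ?_)
      rw [pow_succ ‖t‖]; ring
    exact le_of_mul_le_mul_left this (by positivity)
  have h4 : Tendsto (fun t : ℂ => K * ‖t‖ * ‖w‖ ^ (n + 1)) (𝓝[≠] 0) (𝓝 0) := by
    have : Tendsto (fun t : ℂ => K * ‖t‖ * ‖w‖ ^ (n + 1)) (𝓝 0) (𝓝 (K * ‖(0:ℂ)‖ * ‖w‖ ^ (n + 1))) :=
      ((continuous_const.mul continuous_norm).mul continuous_const).tendsto 0
    simp only [norm_zero, mul_zero, zero_mul] at this
    exact this.mono_left nhdsWithin_le_nhds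
  have := ge_of_tendsto h4 h3
  exact norm_le_zero_iff.mp this

/-- multilinear expansion -/
theorem multilinear_hom (k : ℕ) (q : (Fin d → ℂ) [×k]→L[ℂ] (Fin d → ℂ)) (w : Fin d → ℂ) :
    q (fun _ => w) = homI k (fun a => (∑ r ∈ Finset.univ.filter
      (fun r : Fin k → Fin d => (fun i => (Finset.univ.filter (fun l => r l = i)).card) = a.1.1),
        q (fun l => Pi.single (r l) 1)) a.2) w := by
  classical
  have hw : w = ∑ i, w i • (Pi.single i (1:ℂ) : Fin d → ℂ) := by
    funext j
    simp [Finset.sum_apply, Pi.single_apply]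
  have h1 : q (fun _ => w) = ∑ r : Fin k → Fin d, (∏ l, w (r l)) • q (fun l => Pi.single (r l) 1) := by
    conv_lhs => rw [hw]
    have := q.toMultilinearMap.map_sum (fun (_ : Fin k) (i : Fin d) => w i • (Pi.single i (1:ℂ) : Fin d → ℂ))
    refine this.trans (Finset.sum_congr rfl fun r _ => ?_)
    exact q.toMultilinearMap.map_smul_univ (fun l => w (r l)) (fun l => Pi.single (r l) 1)
  rw [h1]
  unfold homI
  have hmem : ∀ r : Fin k → Fin d, (fun i => (Finset.univ.filter (fun l => r l = i)).card) ∈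
      Finset.piAntidiag (Finset.univ : Finset (Fin d)) k := by
    intro r
    rw [Finset.mem_piAntidiag]
    refine ⟨?_, by simp⟩
    have := Finset.card_eq_sum_card_fiberwise (s := Finset.univ) (t := Finset.univ) (f := r)
      (by simp)
    simpa using this.symm
  rw [← Finset.sum_fiberwise_of_maps_to (s := Finset.univ) (t := Finset.univ)
    (g := fun r : Fin k → Fin d => (⟨_, hmem r⟩ : ↥(Finset.piAntidiag (Finset.univ : Finset (Fin d)) k)))
    (by simp)]
  refine Finset.sum_congr rfl fun m _ => ?_
  have e : (fun i => (∑ r ∈ Finset.univ.filter (fun r : Fin k → Fin d =>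
      (fun i => (Finset.univ.filter (fun l => r l = i)).card) = m.1),
        q (fun l => Pi.single (r l) 1)) i) = ∑ r ∈ Finset.univ.filter (fun r : Fin k → Fin d =>
      (fun i => (Finset.univ.filter (fun l => r l = i)).card) = m.1),
        q (fun l => Pi.single (r l) 1) := rfl
  show _ = (∏ i, w i ^ m.1 i) • (fun i => (∑ r ∈ Finset.univ.filter (fun r : Fin k → Fin d =>
      (fun i => (Finset.univ.filter (fun l => r l = i)).card) = m.1),
        q (fun l => Pi.single (r l) 1)) i)
  rw [e, Finset.smul_sum]
  refine Finset.sum_congr ?_ fun r hr => ?_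
  · ext r
    simp [Subtype.ext_iff]
  · congr 1
    rw [Finset.mem_filter] at hr
    rw [← hr.2]
    rw [← Finset.prod_fiberwise_of_maps_to (s := Finset.univ) (t := Finset.univ) (g := r) (by simp)]
    refine Finset.prod_congr rfl fun i _ => ?_
    rw [Finset.prod_congr rfl (g := fun _ => w i) (fun l hl => by
      rw [(Finset.mem_filter.mp hl).2]), Finset.prod_const]

theorem taylor_step (D : Set ℂ) (F : ℂ × (Fin d → ℂ) → Fin d → ℂ)
    (hF : ∀ x ∈ D, AnalyticAt ℂ F (x, 0)) (n : ℕ) :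
    ∃ g : Idx d n → ℂ → ℂ, (∀ a, AnalyticOnNhd ℂ (g a) D) ∧ ∀ x ∈ D,
      (fun w => F (x, w)) =O[𝓝 0] (fun w => ‖w‖ ^ n) →
      (fun w => F (x, w) - homI n (fun a => g a x) w) =O[𝓝 0] (fun w => ‖w‖ ^ (n + 1)) := by
  classical
  let inr : (Fin d → ℂ) →L[ℂ] ℂ × (Fin d → ℂ) := ContinuousLinearMap.inr ℂ ℂ (Fin d → ℂ)
  let I : ℂ → (Fin d → ℂ) [×n]→L[ℂ] (Fin d → ℂ) := fun x =>
    ((n.factorial : ℂ)⁻¹ • iteratedFDeriv ℂ n F (x, 0)).compContinuousLinearMap (fun _ => inr)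
  refine ⟨fun a x => (∑ r ∈ Finset.univ.filter
      (fun r : Fin n → Fin d => (fun i => (Finset.univ.filter (fun l => r l = i)).card) = a.1.1),
        I x (fun l => Pi.single (r l) 1)) a.2, ?_, ?_⟩
  · intro a x hx
    have hS : AnalyticOnNhd ℂ (iteratedFDeriv ℂ n F) {q | AnalyticAt ℂ F q} :=
      AnalyticOnNhd.iteratedFDeriv (fun q hq => hq) n
    have h1 : AnalyticAt ℂ (fun x : ℂ => iteratedFDeriv ℂ n F (x, (0 : Fin d → ℂ))) x :=
      AnalyticAt.fun_comp (hS (x, 0) (hF x hx)) (AnalyticAt.prod analyticAt_id analyticAt_const)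
    have h2 : ∀ (r : Fin n → Fin d), AnalyticAt ℂ (fun x => I x (fun l => Pi.single (r l) 1) a.2) x := by
      intro r
      have e : (fun x => I x (fun l => Pi.single (r l) 1) a.2) = fun x =>
        (n.factorial : ℂ)⁻¹ • ((ContinuousLinearMap.proj a.2 : (Fin d → ℂ) →L[ℂ] ℂ).comp
          (ContinuousMultilinearMap.apply ℂ (fun _ : Fin n => ℂ × (Fin d → ℂ)) (Fin d → ℂ)
            (fun l => inr (Pi.single (r l) 1)))) (iteratedFDeriv ℂ n F (x, (0 : Fin d → ℂ))) := rfl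
      rw [e]
      exact AnalyticAt.fun_smul analyticAt_const ((ContinuousLinearMap.analyticAt _ _).fun_comp h1)
    have := Finset.analyticAt_fun_sum (Finset.univ.filter
      (fun r : Fin n → Fin d => (fun i => (Finset.univ.filter (fun l => r l = i)).card) = a.1.1))
      (fun r _ => h2 r)
    simpa only [Finset.sum_apply] using this
  · intro x hx hO
    obtain ⟨P, r, hP⟩ := hF x hx
    let q : FormalMultilinearSeries ℂ (Fin d → ℂ) (Fin d → ℂ) := P.compContinuousLinearMap inr
    have hI : ∀ w, homI n _ w = I x (fun _ => w) := fun w => (multilinear_hom n (I x) w).symm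
    have hI2 : ∀ w, I x (fun _ => w) = q n (fun _ => w) := by
      intro w
      have h3 := hP.factorial_smul (inr w) n
      show (n.factorial : ℂ)⁻¹ • iteratedFDeriv ℂ n F (x, 0) (fun _ => inr w) = P n (fun _ => inr w)
      rw [← h3, ← Nat.cast_smul_eq_nsmul ℂ, smul_smul, inv_mul_cancel₀, one_smul]
      exact_mod_cast n.factorial_ne_zero
    have hsum : ∀ k, (fun w => F (x, w) - q.partialSum k w) =O[𝓝 0] fun w : Fin d → ℂ => ‖w‖ ^ k := by
      intro k
      have h4 := hP.hasFPowerSeriesAt.isBigO_sub_partialSum_pow k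
      have h5 : Tendsto inr (𝓝 0) (𝓝 0) := by
        have := inr.continuous.tendsto 0
        rwa [map_zero] at this
      have h6 := h4.comp_tendsto h5
      refine (h6.congr' ?_ ?_)
      · refine Eventually.of_forall fun w => ?_
        simp [Function.comp, inr, FormalMultilinearSeries.partialSum, q,
          FormalMultilinearSeries.compContinuousLinearMap_apply]
        rfl
      · refine Eventually.of_forall fun w => ?_
        simp [Function.comp, inr, Prod.norm_def]
    have hz : ∀ k, k < n → ∀ w, q k (fun _ => w) = 0 := by
      intro k
      induction k using Nat.strong_induction_on with
      | _ k ih =>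
        intro hk w
        refine Asymptotics.IsBigO.continuousMultilinearMap_apply_eq_zero (p := q k) ?_ w
        have e1 : ∀ w, q.partialSum (k + 1) w = q k (fun _ => w) := by
          intro w
          unfold FormalMultilinearSeries.partialSum
          rw [Finset.sum_range_succ, Finset.sum_eq_zero, zero_add]
          intro j hj
          exact ih j (Finset.mem_range.mp hj) ((Finset.mem_range.mp hj).trans hk) w
        have e2 := hsum (k + 1)
        have e3 : (fun w : Fin d → ℂ => ‖w‖ ^ n) =O[𝓝 0] fun w => ‖w‖ ^ (k + 1) := by
          have h1 : (fun w : Fin d → ℂ => ‖w‖ ^ n) = fun w => ‖w‖ ^ (n - (k+1)) * ‖w‖ ^ (k + 1) := by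
            funext w; rw [← pow_add]; congr 1; omega
          rw [h1]
          have h2 : (fun w : Fin d → ℂ => ‖w‖ ^ (n - (k+1))) =O[𝓝 0] fun _ => (1:ℝ) :=
            (Continuous.tendsto (by fun_prop) (0 : Fin d → ℂ)).isBigO_one ℝ
          simpa using h2.mul (isBigO_refl (fun w : Fin d → ℂ => ‖w‖ ^ (k+1)) (𝓝 0))
        have e4 := (hO.trans e3).sub e2
        refine e4.congr' (Eventually.of_forall fun w => ?_) (EventuallyEq.refl _ _)
        show F (x, w) - (F (x, w) - q.partialSum (k+1) w) = _
        rw [sub_sub_cancel, e1]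
    refine (hsum (n + 1)).congr' (Eventually.of_forall fun w => ?_) (EventuallyEq.refl _ _)
    show F (x, w) - q.partialSum (n+1) w = F (x, w) - homI n _ w
    rw [hI, hI2]
    congr 1
    unfold FormalMultilinearSeries.partialSum
    rw [Finset.sum_range_succ, Finset.sum_eq_zero, zero_add]
    intro j hj
    exact hz j (Finset.mem_range.mp hj) w

end taylor

section errs
variable {d : ℕ}

theorem nl_lip (f : (Fin d → ℂ) → Fin d → ℂ) (hf : AnalyticAt ℂ f 0) (hf1 : fderiv ℂ f 0 = 0) :
    ∃ K δ : ℝ, 0 ≤ K ∧ 0 < δ ∧ ∀ ρ ≤ δ, ∀ u v : Fin d → ℂ, ‖u‖ ≤ ρ → ‖v‖ ≤ ρ →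
      ‖f u - f v‖ ≤ K * ρ * ‖u - v‖ := by
  have h1 : (fun y => fderiv ℂ f y - fderiv ℂ f 0) =O[𝓝 0] fun y => y - 0 :=
    hf.fderiv.differentiableAt.isBigO_sub
  simp only [hf1, sub_zero] at h1
  obtain ⟨K, hK0, hK⟩ := h1.exists_nonneg
  have h2 : ∀ᶠ y in 𝓝 (0 : Fin d → ℂ), DifferentiableAt ℂ f y :=
    hf.eventually_analyticAt.mono fun y hy => hy.differentiableAt
  obtain ⟨δ, hδ, hball⟩ := Metric.eventually_nhds_iff_ball.mp (hK.bound.and h2)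
  refine ⟨K, δ / 2, hK0, by linarith, fun ρ hρ u v hu hv => ?_⟩
  have hin : ∀ y ∈ Metric.closedBall (0 : Fin d → ℂ) ρ, y ∈ Metric.ball (0 : Fin d → ℂ) δ := by
    intro y hy
    rw [mem_closedBall_zero_iff] at hy
    rw [mem_ball_zero_iff]; linarith
  refine Convex.norm_image_sub_le_of_norm_fderiv_le (𝕜 := ℂ) (s := Metric.closedBall 0 ρ)
    (fun y hy => (hball y (hin y hy)).2) (fun y hy => ?_) (convex_closedBall _ _)
    (mem_closedBall_zero_iff.mpr hv) (mem_closedBall_zero_iff.mpr hu)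
  refine ((hball y (hin y hy)).1).trans ?_
  exact mul_le_mul_of_nonneg_left (mem_closedBall_zero_iff.mp hy) hK0

theorem homog_bigO {G : Type*} [NormedAddCommGroup G] [NormedSpace ℂ G] (n : ℕ)
    (g : (Fin d → ℂ) → G) (hg : Continuous g)
    (h : ∀ (t : ℂ) w, t ≠ 0 → g (t • w) = t ^ n • g w) : g =O[𝓝 0] fun w => ‖w‖ ^ n := by
  obtain ⟨C, hC⟩ := (isCompact_closedBall (0 : Fin d → ℂ) 1).exists_bound_of_continuousOn hg.continuousOn
  refine IsBigO.of_bound C (Eventually.of_forall fun w => ?_)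
  have hC0 : 0 ≤ C := (norm_nonneg _).trans (hC 0 (by simp))
  by_cases hw : w = 0
  · subst hw
    rcases Nat.eq_zero_or_pos n with hn | hn
    · subst hn
      have := hC 0 (by simp)
      simpa using this
    · have h2 := h 2 0 two_ne_zero
      rw [smul_zero] at h2
      have h3 : ((2:ℂ) ^ n - 1) • g 0 = 0 := by rw [sub_smul, one_smul, ← h2, sub_self]
      have h4 : g 0 = 0 := by
        rcases smul_eq_zero.mp h3 with h5 | h5
        · exfalso
          have h6 : (2:ℂ) ^ n = 1 := by linear_combination h5
          have h7 : (2:ℕ) ^ n = 1 := by exact_mod_cast h6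
          have := Nat.one_lt_two_pow hn.ne'
          omega
        · exact h5
      rw [h4, norm_zero]; positivity
  · have hw0 : (‖w‖ : ℂ) ≠ 0 := by exact_mod_cast (norm_pos_iff.mpr hw).ne'
    have e : w = (‖w‖ : ℂ) • ((‖w‖ : ℂ)⁻¹ • w) := by rw [smul_smul, mul_inv_cancel₀ hw0, one_smul]
    have h1 := h ‖w‖ ((‖w‖ : ℂ)⁻¹ • w) hw0
    rw [← e] at h1
    rw [h1, norm_smul, mul_comm, norm_pow, norm_pow]
    have : ‖((‖w‖ : ℝ) : ℂ)‖ = ‖w‖ := by simp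
    rw [this, norm_norm]
    refine mul_le_mul_of_nonneg_right (hC _ ?_) (by positivity)
    rw [mem_closedBall_zero_iff, norm_smul, norm_inv, this, inv_mul_cancel₀ (norm_pos_iff.mpr hw).ne']

theorem homI_bigO (n : ℕ) (c : Idx d n → ℂ) : homI n c =O[𝓝 0] fun w => ‖w‖ ^ n :=
  homog_bigO n _ (homI_contDiff n c).continuous fun t w _ => homI_hom n c t w

theorem homI_diff (n : ℕ) (c : Idx d n → ℂ) : Differentiable ℂ (homI n c) :=
  (homI_contDiff n c).differentiable (by simp)

theorem fderiv_homI_bigO (n : ℕ) (c : Idx d (n + 1) → ℂ) :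
    fderiv ℂ (homI (n + 1) c) =O[𝓝 0] fun w => ‖w‖ ^ n := by
  refine homog_bigO n _ ((homI_contDiff _ c).continuous_fderiv (by simp)) fun t w ht => ?_
  have e1 : (fun w => homI (n+1) c (t • w)) = fun w => t ^ (n + 1) • homI (n+1) c w :=
    funext fun w => homI_hom (n+1) c t w
  have e2 : HasFDerivAt (fun w => homI (n+1) c (t • w)) ((fderiv ℂ (homI (n+1) c) (t • w)).comp
      (t • ContinuousLinearMap.id ℂ (Fin d → ℂ))) w := by
    have hb : HasFDerivAt (fun w : Fin d → ℂ => t • w) (t • ContinuousLinearMap.id ℂ (Fin d → ℂ)) w :=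
      (hasFDerivAt_id w).const_smul t
    exact (homI_diff _ c (t • w)).hasFDerivAt.comp w hb
  have e3 : HasFDerivAt (fun w => t ^ (n + 1) • homI (n+1) c w) (t ^ (n + 1) • fderiv ℂ (homI (n+1) c) w) w :=
    (homI_diff _ c w).hasFDerivAt.fun_const_smul _
  rw [e1] at e2
  have e4 := e2.unique e3
  have e5 : t • fderiv ℂ (homI (n+1) c) (t • w) = t • (t ^ n • fderiv ℂ (homI (n+1) c) w) := by
    rw [smul_smul, ← pow_succ', ← e4]
    ext v : 1
    simp
  exact smul_right_injective _ ht e5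

/-- A function vanishing to order two at the origin. -/
def Good2 (T : (Fin d → ℂ) → Fin d → ℂ) : Prop :=
  Differentiable ℂ T ∧ (T =O[𝓝 0] fun w => ‖w‖ ^ 2) ∧ (fderiv ℂ T =O[𝓝 0] fun w => ‖w‖ ^ 1)

theorem pow_bigO {k n : ℕ} (h : k ≤ n) :
    (fun w : Fin d → ℂ => ‖w‖ ^ n) =O[𝓝 0] fun w => ‖w‖ ^ k := by
  have h1 : (fun w : Fin d → ℂ => ‖w‖ ^ n) = fun w => ‖w‖ ^ (n - k) * ‖w‖ ^ k := by
    funext w; rw [← pow_add]; congr 1; omega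
  rw [h1]
  have h2 : (fun w : Fin d → ℂ => ‖w‖ ^ (n - k)) =O[𝓝 0] fun _ => (1:ℝ) :=
    (Continuous.tendsto (by fun_prop) (0 : Fin d → ℂ)).isBigO_one ℝ
  simpa using h2.mul (isBigO_refl (fun w : Fin d → ℂ => ‖w‖ ^ k) (𝓝 0))

theorem Good2.zero : Good2 (fun _ : Fin d → ℂ => (0 : Fin d → ℂ)) := by
  refine ⟨differentiable_const _, isBigO_zero _ _, ?_⟩
  rw [fderiv_fun_const]
  exact isBigO_zero _ _

theorem Good2.add_hom {T : (Fin d → ℂ) → Fin d → ℂ} (hT : Good2 T) (n : ℕ) (hn : 1 ≤ n)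
    (c : Idx d (n + 1) → ℂ) : Good2 (fun w => T w + homI (n + 1) c w) := by
  refine ⟨hT.1.add (homI_diff _ _), hT.2.1.add ((homI_bigO _ c).trans (pow_bigO (by omega))), ?_⟩
  have : fderiv ℂ (fun w => T w + homI (n + 1) c w) = fun w => fderiv ℂ T w + fderiv ℂ (homI (n+1) c) w := by
    funext w
    exact fderiv_fun_add (hT.1 w) (homI_diff _ _ w)
  rw [this]
  exact hT.2.2.add ((fderiv_homI_bigO _ c).trans (pow_bigO hn))

theorem nl_diff (f : (Fin d → ℂ) → Fin d → ℂ) (hf : AnalyticAt ℂ f 0) (hf1 : fderiv ℂ f 0 = 0)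
    (T h : (Fin d → ℂ) → Fin d → ℂ) (n : ℕ) (hn : 1 ≤ n) (hT : T =O[𝓝 0] fun w => ‖w‖ ^ 2)
    (hh : h =O[𝓝 0] fun w => ‖w‖ ^ (n + 1)) :
    (fun w => f (w + (T w + h w)) - f (w + T w)) =O[𝓝 0] fun w => ‖w‖ ^ (n + 2) := by
  obtain ⟨K, δ, hK, hδ, hlip⟩ := nl_lip f hf hf1
  have h1 : (fun w : Fin d → ℂ => w) =O[𝓝 0] fun w => ‖w‖ ^ 1 := by
    simp only [pow_one]; exact (isBigO_refl _ _).norm_right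
  have h2 : (fun w => w + T w) =O[𝓝 0] fun w => ‖w‖ ^ 1 := h1.add (hT.trans (pow_bigO (by omega)))
  have h3 : (fun w => w + (T w + h w)) =O[𝓝 0] fun w => ‖w‖ ^ 1 :=
    h1.add ((hT.trans (pow_bigO (by omega))).add (hh.trans (pow_bigO (by omega))))
  obtain ⟨C2, hC2, hb2⟩ := h2.exists_nonneg
  obtain ⟨C3, hC3, hb3⟩ := h3.exists_nonneg
  obtain ⟨C4, hC4, hb4⟩ := hh.exists_nonneg
  have hsmall : ∀ᶠ w : Fin d → ℂ in 𝓝 0, (C2 + C3) * ‖w‖ ≤ δ := by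
    have : Tendsto (fun w : Fin d → ℂ => (C2 + C3) * ‖w‖) (𝓝 0) (𝓝 0) := by
      have := (Continuous.tendsto (f := fun w : Fin d → ℂ => (C2 + C3) * ‖w‖) (by fun_prop) 0)
      simpa using this
    exact (this.eventually (gt_mem_nhds hδ)).mono fun w hw => hw.le
  refine IsBigO.of_bound (K * (C2 + C3) * C4) ?_
  filter_upwards [hb2.bound, hb3.bound, hb4.bound, hsmall] with w e2 e3 e4 e5
  rw [norm_pow, norm_norm] at e2 e3 e4 ⊢
  rw [pow_one] at e2 e3
  have hw := norm_nonneg w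
  have := hlip _ e5 (w + (T w + h w)) (w + T w)
    (e3.trans (mul_le_mul_of_nonneg_right (by linarith) hw))
    (e2.trans (mul_le_mul_of_nonneg_right (by linarith) hw))
  have e6 : w + (T w + h w) - (w + T w) = h w := by abel
  rw [e6] at this
  refine this.trans ?_
  calc K * ((C2 + C3) * ‖w‖) * ‖h w‖ ≤ K * ((C2 + C3) * ‖w‖) * (C4 * ‖w‖ ^ (n + 1)) :=
        mul_le_mul_of_nonneg_left e4 (by positivity)
    _ = _ := by ring

theorem nl_sq (f : (Fin d → ℂ) → Fin d → ℂ) (hf : AnalyticAt ℂ f 0) (hf0 : f 0 = 0)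
    (hf1 : fderiv ℂ f 0 = 0) : f =O[𝓝 0] fun w => ‖w‖ ^ 2 := by
  obtain ⟨K, δ, hK, hδ, hlip⟩ := nl_lip f hf hf1
  refine IsBigO.of_bound K ?_
  filter_upwards [Metric.ball_mem_nhds (0 : Fin d → ℂ) hδ] with w hw
  rw [mem_ball_zero_iff] at hw
  have := hlip ‖w‖ hw.le w 0 le_rfl (by simp)
  rw [hf0, sub_zero, sub_zero] at this
  rw [norm_pow, norm_norm]
  exact this.trans (le_of_eq (by ring))

/-- The error in the conjugacy identity. -/
noncomputable def Err (a : Matrix (Fin d) (Fin d) ℂ) (κ : ℂ) (f T' T P : (Fin d → ℂ) → Fin d → ℂ)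
    (w : Fin d → ℂ) : Fin d → ℂ :=
  T' w + fderiv ℂ T w (a *ᵥ w + κ • P w) - a *ᵥ T w - κ • (f (w + T w) - P w)

theorem clm_apply_bigO {u : (Fin d → ℂ) → ((Fin d → ℂ) →L[ℂ] (Fin d → ℂ))} {v : (Fin d → ℂ) → (Fin d → ℂ)}
    {k l : ℕ} (hu : u =O[𝓝 0] fun w => ‖w‖ ^ k) (hv : v =O[𝓝 0] fun w => ‖w‖ ^ l) :
    (fun w => u w (v w)) =O[𝓝 0] fun w => ‖w‖ ^ (k + l) := by
  have h1 : (fun w => u w (v w)) =O[𝓝 0] fun w => ‖u w‖ * ‖v w‖ :=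
    IsBigO.of_bound 1 (Eventually.of_forall fun w => by
      rw [one_mul]; exact ((u w).le_opNorm _).trans (le_abs_self _))
  simp only [pow_add]
  exact h1.trans (hu.norm_left.mul hv.norm_left)

theorem err_step (a : Matrix (Fin d) (Fin d) ℂ) (κ : ℂ) (f T' T P : (Fin d → ℂ) → Fin d → ℂ)
    (hf : AnalyticAt ℂ f 0) (hf1 : fderiv ℂ f 0 = 0) (hT : Good2 T) (hP : Good2 P)
    (n : ℕ) (hn : 1 ≤ n) (c' c ψ : Idx d (n + 1) → ℂ) :
    (fun w => Err a κ f (fun w => T' w + homI (n+1) c' w) (fun w => T w + homI (n+1) c w)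
        (fun w => P w + homI (n+1) ψ w) w - Err a κ f T' T P w
        - (homI (n+1) c' w - (a *ᵥ homI (n+1) c w - fderiv ℂ (homI (n+1) c) w (a *ᵥ w))
          + κ • homI (n+1) ψ w)) =O[𝓝 0] fun w => ‖w‖ ^ (n + 2) := by
  have h1 : (fun w => fderiv ℂ (homI (n+1) c) w (κ • (P w + homI (n+1) ψ w))) =O[𝓝 0]
      fun w => ‖w‖ ^ (n + 2) :=
    clm_apply_bigO (fderiv_homI_bigO n c) ((hP.add_hom n hn ψ).2.1.const_smul_left κ)
  have h2 : (fun w => fderiv ℂ T w (κ • homI (n+1) ψ w)) =O[𝓝 0] fun w => ‖w‖ ^ (1 + (n + 1)) :=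
    clm_apply_bigO hT.2.2 ((homI_bigO (n+1) ψ).const_smul_left κ)
  rw [show 1 + (n + 1) = n + 2 by omega] at h2
  have h3 := (nl_diff f hf hf1 T (homI (n+1) c) n hn hT.2.1 (homI_bigO (n+1) c)).const_smul_left κ
  refine ((h1.add h2).sub h3).congr' (Eventually.of_forall fun w => ?_) (EventuallyEq.refl _ _)
  unfold Err
  have e : fderiv ℂ (fun w => T w + homI (n + 1) c w) w = fderiv ℂ T w + fderiv ℂ (homI (n+1) c) w :=
    fderiv_fun_add (hT.1 w) (homI_diff _ _ w)
  simp only [e, _root_.add_apply, map_add, map_smul, smul_add, smul_sub, Matrix.mulVec_add, Pi.smul_apply]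
  abel

end errs

section trunc
variable {d : ℕ}

theorem mem_truncSet (n : ℕ) (m : Fin d → ℕ) :
    m ∈ (Finset.Iic (fun _ => n : Fin d → ℕ)).filter
      (fun m => 2 ≤ ∑ i, m i ∧ ∑ i, m i ≤ n) ↔ 2 ≤ ∑ i, m i ∧ ∑ i, m i ≤ n := by
  rw [Finset.mem_filter, Finset.mem_Iic]
  refine ⟨fun h => h.2, fun h => ⟨fun i => ?_, h⟩⟩
  exact (Finset.single_le_sum (f := m) (fun _ _ => Nat.zero_le _) (Finset.mem_univ i)).trans h.2

theorem mem_piA (n : ℕ) (m : Fin d → ℕ) :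
    m ∈ Finset.piAntidiag (Finset.univ : Finset (Fin d)) n ↔ ∑ i, m i = n := by
  rw [Finset.mem_piAntidiag]; simp

theorem trunc_one (H : (Fin d → ℕ) → ℂ → Fin d → ℂ) (x : ℂ) (w : Fin d → ℂ) :
    truncSeries d 1 H x w = 0 := by
  unfold truncSeries
  refine Finset.sum_eq_zero fun m hm => ?_
  rw [mem_truncSet] at hm
  omega

theorem trunc_succ (n : ℕ) (hn : 1 ≤ n) (H : (Fin d → ℕ) → ℂ → Fin d → ℂ) (x : ℂ) (w : Fin d → ℂ) :
    truncSeries d (n + 1) H x w = truncSeries d n H x w +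
      homI (n + 1) (fun a => H a.1.1 x a.2) w := by
  classical
  unfold truncSeries homI
  rw [Finset.sum_coe_sort (Finset.piAntidiag (Finset.univ : Finset (Fin d)) (n+1))
    (fun m => (∏ i, w i ^ m i) • fun i => H m x i), ← Finset.sum_union]
  · refine Finset.sum_congr ?_ fun _ _ => rfl
    ext m
    rw [Finset.mem_union, mem_truncSet, mem_truncSet, mem_piA]
    omega
  · rw [Finset.disjoint_left]
    intro m hm hm2
    rw [mem_truncSet] at hm
    rw [mem_piA] at hm2
    omega

theorem trunc_congr (n : ℕ) (H H' : (Fin d → ℕ) → ℂ → Fin d → ℂ) (x : ℂ) 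
    (h : ∀ m, ∑ i, m i ≤ n → H m x = H' m x) (w : Fin d → ℂ) :
    truncSeries d n H x w = truncSeries d n H' x w := by
  unfold truncSeries
  refine Finset.sum_congr rfl fun m hm => ?_
  rw [mem_truncSet] at hm
  rw [h m hm.2]

theorem trunc_good (n : ℕ) (hn : 1 ≤ n) (H : (Fin d → ℕ) → ℂ → Fin d → ℂ) (x : ℂ) :
    Good2 (fun w => truncSeries d n H x w) := by
  induction n, hn using Nat.le_induction with
  | base => simp only [trunc_one]; exact Good2.zero
  | succ n hn ih =>
    simp only [trunc_succ n hn]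
    exact ih.add_hom n hn _

theorem trunc_deriv (n : ℕ) (H : (Fin d → ℕ) → ℂ → Fin d → ℂ) (x : ℂ)
    (hH : ∀ m, DifferentiableAt ℂ (H m) x) (w : Fin d → ℂ) :
    deriv (fun t => truncSeries d n H t w) x = truncSeries d n (fun m => deriv (H m)) x w := by
  unfold truncSeries
  refine HasDerivAt.deriv ?_
  exact HasDerivAt.fun_sum fun m _ => (hH m).hasDerivAt.fun_const_smul _

theorem trunc_analytic (n : ℕ) (H : (Fin d → ℕ) → ℂ → Fin d → ℂ) (x : ℂ)
    (hH : ∀ m, AnalyticAt ℂ (H m) x) (w : Fin d → ℂ) :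
    AnalyticAt ℂ (fun q : ℂ × (Fin d → ℂ) => truncSeries d n H q.1 q.2) (x, w) := by
  unfold truncSeries
  refine Finset.analyticAt_fun_sum _ fun m _ => ?_
  refine AnalyticAt.fun_smul (Finset.analyticAt_fun_prod _ fun i _ => ?_) ?_
  · refine AnalyticAt.fun_pow ?_ _
    exact ((ContinuousLinearMap.proj i : (Fin d → ℂ) →L[ℂ] ℂ).comp
      (ContinuousLinearMap.snd ℂ ℂ (Fin d → ℂ))).analyticAt _
  · exact AnalyticAt.fun_comp (f := Prod.fst) (g := H m) (x := (x, w)) (hH m) analyticAt_fst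

theorem trunc_zero (n : ℕ) (hn : 1 ≤ n) (H : (Fin d → ℕ) → ℂ → Fin d → ℂ) (x : ℂ) :
    truncSeries d n H x 0 = 0 := by
  have := (trunc_good n hn H x).2.1
  obtain ⟨C, hC⟩ := this.bound
  have := hC.self_of_nhds
  simpa using this

theorem fderiv_slice {F : ℂ × (Fin d → ℂ) → Fin d → ℂ} {x : ℂ} {w : Fin d → ℂ}
    (hF : AnalyticAt ℂ F (x, w)) (v : Fin d → ℂ) :
    fderiv ℂ (fun v => F (x, v)) w v = fderiv ℂ F (x, w) (0, v) := by
  have h1 : HasFDerivAt (fun v : Fin d → ℂ => (x, v)) (ContinuousLinearMap.inr ℂ ℂ (Fin d → ℂ)) w :=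
    (hasFDerivAt_const x w).prodMk (hasFDerivAt_id w)
  have h2 := hF.differentiableAt.hasFDerivAt.comp w h1
  rw [show (fun v => F (x, v)) = F ∘ fun v => (x, v) from rfl, h2.fderiv]
  rfl

end trunc

section main
variable {d S : ℕ} {p : Fin (S + 2) → ℂ} {D : Set ℂ}

theorem Rp_eval {ι : Type*} [Fintype ι] (B : Fin (S + 2) → Matrix ι ι ℂ) (x : ℂ) (hx : x ∉ range p)
    (i k : ι) : (Rp p B i k).eval x = (∏ j, (x - p j)) * (∑ j, (x - p j)⁻¹ • B j) i k := by
  unfold Rp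
  rw [Polynomial.eval_finsetSum, Matrix.sum_apply, Finset.mul_sum]
  refine Finset.sum_congr rfl fun j _ => ?_
  have hj : x - p j ≠ 0 := fun h => hx ⟨j, (sub_eq_zero.mp h).symm⟩
  rw [← Finset.mul_prod_erase Finset.univ _ (Finset.mem_univ j)]
  simp only [Polynomial.eval_mul, Polynomial.eval_C, Polynomial.eval_prod, Polynomial.eval_sub,
    Polynomial.eval_X, Matrix.smul_apply, smul_eq_mul]
  field_simp

theorem Q_ne (x : ℂ) (hx : x ∉ range p) : (∏ j, (x - p j)) ≠ 0 :=
  Finset.prod_ne_zero_iff.mpr fun j _ h => hx ⟨j, (sub_eq_zero.mp h).symm⟩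

theorem Lcomb {n : ℕ} (A : Fin (S + 2) → Matrix (Fin d) (Fin d) ℂ)
    (B : Fin (S + 2) → Matrix (Idx d n) (Idx d n) ℂ)
    (hB : ∀ j c w, homI n (B j *ᵥ c) w = A j *ᵥ homI n c w - fderiv ℂ (homI n c) w (A j *ᵥ w))
    (κ : Fin (S + 2) → ℂ) (c : Idx d n → ℂ) (w : Fin d → ℂ) :
    homI n ((∑ j, κ j • B j) *ᵥ c) w = (∑ j, κ j • A j) *ᵥ homI n c w -
      fderiv ℂ (homI n c) w ((∑ j, κ j • A j) *ᵥ w) := by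
  rw [Matrix.sum_mulVec, Matrix.sum_mulVec, Matrix.sum_mulVec, ← homL_apply, map_sum, map_sum,
    ← Finset.sum_sub_distrib]
  refine Finset.sum_congr rfl fun j _ => ?_
  rw [Matrix.smul_mulVec, Matrix.smul_mulVec, Matrix.smul_mulVec, map_smul, map_smul, homL_apply, hB,
    smul_sub]

theorem exists_B (A : Fin (S + 2) → Matrix (Fin d) (Fin d) ℂ)
    (hAinf : NonlinearlyNonresonant d (∑ j, A j)) (n : ℕ) (hn : 2 ≤ n) :
    ∃ B : Fin (S + 2) → Matrix (Idx d n) (Idx d n) ℂ,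
      (∀ j c w, homI n (B j *ᵥ c) w = A j *ᵥ homI n c w - fderiv ℂ (homI n c) w (A j *ᵥ w)) ∧
      (∀ (k : ℕ) (a : Idx d n → ℂ), (k : ℂ) • a - (∑ j, B j) *ᵥ a = 0 → a = 0) := by
  choose L hL using fun M => exists_Lop (d := d) n (by omega) M
  refine ⟨fun j => L (A j), fun j => hL (A j), fun k a ha => ?_⟩
  refine Lop_nonres n hn (∑ j, A j) hAinf k a fun w => ?_
  have h1 := Lcomb A (fun j => L (A j)) (fun j => hL (A j)) (fun _ => 1) a w
  simp only [one_smul] at h1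
  rw [← h1, ← homI_smul, ← homL_apply, ← homL_apply, ← map_sub, ha, map_zero]

/-- The error of order n at x. -/
noncomputable def ErrN (p : Fin (S + 2) → ℂ) (A : Fin (S + 2) → Matrix (Fin d) (Fin d) ℂ)
    (f : ℂ → (Fin d → ℂ) → Fin d → ℂ)
    (H : (Fin d → ℕ) → ℂ → Fin d → ℂ) (Psi : (Fin d → ℕ) → Fin d → Polynomial ℂ)
    (n : ℕ) (x : ℂ) : (Fin d → ℂ) → Fin d → ℂ :=
  Err (∑ j, (x - p j)⁻¹ • A j) (∏ j, (x - p j))⁻¹ (f x)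
    (fun w => truncSeries d n (fun m => deriv (H m)) x w) (fun w => truncSeries d n H x w)
    (fun w => truncSeries d n (fun m t i => (Psi m i).eval t) x w)

theorem ErrN_step (A : Fin (S + 2) → Matrix (Fin d) (Fin d) ℂ)
    (f : ℂ → (Fin d → ℂ) → Fin d → ℂ) (x : ℂ) (hx : x ∉ range p)
    (hf : AnalyticAt ℂ (f x) 0) (hf1 : fderiv ℂ (f x) 0 = 0)
    (H : (Fin d → ℕ) → ℂ → Fin d → ℂ) (Psi : (Fin d → ℕ) → Fin d → Polynomial ℂ) (n : ℕ) (hn : 1 ≤ n)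
    (B : Fin (S + 2) → Matrix (Idx d (n+1)) (Idx d (n+1)) ℂ)
    (hB : ∀ j c w, homI (n+1) (B j *ᵥ c) w =
      A j *ᵥ homI (n+1) c w - fderiv ℂ (homI (n+1) c) w (A j *ᵥ w)) :
    (fun w => ErrN p A f H Psi (n+1) x w - ErrN p A f H Psi n x w -
      (∏ j, (x - p j))⁻¹ • homI (n+1) (fun a => (nodQ p).eval x * deriv (H a.1.1) x a.2 -
        ∑ b : Idx d (n+1), (Rp p B a b).eval x * H b.1.1 x b.2 + (Psi a.1.1 a.2).eval x) w)
      =O[𝓝 0] fun w => ‖w‖ ^ (n + 2) := by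
  have h := err_step (∑ j, (x - p j)⁻¹ • A j) (∏ j, (x - p j))⁻¹ (f x)
    (fun w => truncSeries d n (fun m => deriv (H m)) x w) (fun w => truncSeries d n H x w)
    (fun w => truncSeries d n (fun m t i => (Psi m i).eval t) x w) hf hf1 (trunc_good n hn _ x)
    (trunc_good n hn _ x) n hn (fun a => deriv (H a.1.1) x a.2) (fun a => H a.1.1 x a.2)
    (fun a => (Psi a.1.1 a.2).eval x)
  refine h.congr' (Eventually.of_forall fun w => ?_) (EventuallyEq.refl _ _)
  have hQ := Q_ne (p := p) x hx
  unfold ErrN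
  simp only [trunc_succ n hn]
  congr 1
  rw [← Lcomb A B hB, ← homI_smul, ← homI_smul, ← homL_apply, ← homL_apply, ← homL_apply, ← homL_apply,
    ← map_sub, ← map_add]
  congr 1
  funext a
  simp only [Pi.smul_apply, Pi.add_apply, Pi.sub_apply, smul_eq_mul, Rp_eval B x hx, nodQ_eval,
    Matrix.mulVec, dotProduct, mul_assoc, ← Finset.mul_sum]
  field_simp

end main

section main
variable {d S : ℕ} {p : Fin (S + 2) → ℂ} {D : Set ℂ}

theorem slice_analytic (f : ℂ → (Fin d → ℂ) → Fin d → ℂ) (x : ℂ)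
    (hf : AnalyticAt ℂ (fun q : ℂ × (Fin d → ℂ) => f q.1 q.2) (x, 0)) : AnalyticAt ℂ (f x) 0 :=
  AnalyticAt.fun_comp (g := fun q : ℂ × (Fin d → ℂ) => f q.1 q.2) (f := fun w => (x, w)) hf
    (AnalyticAt.prod analyticAt_const analyticAt_id)

theorem analytic_fst (φ : ℂ → ℂ) (x : ℂ) (w : Fin d → ℂ) (h : AnalyticAt ℂ φ x) :
    AnalyticAt ℂ (fun q : ℂ × (Fin d → ℂ) => φ q.1) (x, w) :=
  AnalyticAt.fun_comp (f := Prod.fst) (g := φ) (x := (x, w)) h analyticAt_fst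

theorem poly_analytic (P : Polynomial ℂ) (x : ℂ) : AnalyticAt ℂ (fun t => P.eval t) x :=
  (P.differentiable.analyticAt x)

theorem mulVec_analytic (R : Fin d → Fin d → Polynomial ℂ) (v : ℂ × (Fin d → ℂ) → Fin d → ℂ) (x : ℂ)
    (w : Fin d → ℂ) (hv : AnalyticAt ℂ v (x, w)) :
    AnalyticAt ℂ (fun q : ℂ × (Fin d → ℂ) => (Matrix.of fun i k => (R i k).eval q.1) *ᵥ v q) (x, w) := by
  rw [analyticAt_pi_iff]
  intro i
  have : (fun q : ℂ × (Fin d → ℂ) => ((Matrix.of fun i k => (R i k).eval q.1) *ᵥ v q) i) =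
      fun q => ∑ k, (R i k).eval q.1 * v q k := rfl
  rw [this]
  refine Finset.analyticAt_fun_sum _ fun k _ => ?_
  exact AnalyticAt.fun_mul (analytic_fst _ x w (poly_analytic _ x)) (analyticAt_pi_iff.mp hv k)

/-- Q times the error is jointly analytic. -/
theorem exists_G (A : Fin (S + 2) → Matrix (Fin d) (Fin d) ℂ)
    (f : ℂ → (Fin d → ℂ) → Fin d → ℂ) (hD : IsOpen D)
    (hf : ∀ x ∈ D, AnalyticAt ℂ (fun q : ℂ × (Fin d → ℂ) => f q.1 q.2) (x, 0))
    (H : (Fin d → ℕ) → ℂ → Fin d → ℂ) (Psi : (Fin d → ℕ) → Fin d → Polynomial ℂ)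
    (hH : ∀ m, AnalyticOnNhd ℂ (H m) D) (n : ℕ) (hn : 1 ≤ n) :
    ∃ G : ℂ × (Fin d → ℂ) → Fin d → ℂ, (∀ x ∈ D, AnalyticAt ℂ G (x, 0)) ∧
      ∀ x ∈ D, x ∉ range p → ∀ w, G (x, w) = (∏ j, (x - p j)) • ErrN p A f H Psi n x w := by
  let R : ℂ → Matrix (Fin d) (Fin d) ℂ := fun x => Matrix.of fun i k => (Rp p A i k).eval x
  let T : ℂ × (Fin d → ℂ) → Fin d → ℂ := fun q => truncSeries d n H q.1 q.2
  let T' : ℂ × (Fin d → ℂ) → Fin d → ℂ := fun q => truncSeries d n (fun m => deriv (H m)) q.1 q.2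
  let P : ℂ × (Fin d → ℂ) → Fin d → ℂ := fun q =>
    truncSeries d n (fun m t i => (Psi m i).eval t) q.1 q.2
  have hT : ∀ x ∈ D, ∀ w, AnalyticAt ℂ T (x, w) := fun x hx w =>
    trunc_analytic n H x (fun m => hH m x hx) w
  have hT' : ∀ x ∈ D, ∀ w, AnalyticAt ℂ T' (x, w) := fun x hx w =>
    trunc_analytic n _ x (fun m => (hH m x hx).deriv) w
  have hP : ∀ x ∈ D, ∀ w, AnalyticAt ℂ P (x, w) := fun x hx w =>
    trunc_analytic n _ x (fun m => analyticAt_pi_iff.mpr fun i => poly_analytic _ x) w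
  refine ⟨fun q => (∏ j, (q.1 - p j)) • T' q + fderiv ℂ T q (0, R q.1 *ᵥ q.2 + P q) - R q.1 *ᵥ T q -
    (f q.1 (q.2 + T q) - P q), ?_, ?_⟩
  · intro x hx
    have a1 : AnalyticAt ℂ (fun q : ℂ × (Fin d → ℂ) => (∏ j, (q.1 - p j)) • T' q) (x, 0) := by
      refine AnalyticAt.fun_smul ?_ (hT' x hx 0)
      have := analytic_fst (d := d) _ x 0 (poly_analytic (nodQ p) x)
      simpa only [nodQ_eval] using this
    have a2 : AnalyticAt ℂ (fun q : ℂ × (Fin d → ℂ) => fderiv ℂ T q (0, R q.1 *ᵥ q.2 + P q)) (x, 0) := by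
      have hv : AnalyticAt ℂ (fun q : ℂ × (Fin d → ℂ) => ((0 : ℂ), R q.1 *ᵥ q.2 + P q)) (x, 0) := by
        refine AnalyticAt.prod analyticAt_const ?_
        exact AnalyticAt.fun_add (mulVec_analytic _ _ x 0 analyticAt_snd) (hP x hx 0)
      exact AnalyticAt.fun_comp (ContinuousLinearMap.analyticAt_bilinear
        (ContinuousLinearMap.id ℂ ((ℂ × (Fin d → ℂ)) →L[ℂ] (Fin d → ℂ))) _)
        (AnalyticAt.prod (hT x hx 0).fderiv hv)
    have a3 : AnalyticAt ℂ (fun q : ℂ × (Fin d → ℂ) => R q.1 *ᵥ T q) (x, 0) :=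
      mulVec_analytic _ _ x 0 (hT x hx 0)
    have a4 : AnalyticAt ℂ (fun q : ℂ × (Fin d → ℂ) => f q.1 (q.2 + T q)) (x, 0) := by
      have hb : AnalyticAt ℂ (fun q : ℂ × (Fin d → ℂ) => (q.1, q.2 + T q)) (x, 0) :=
        AnalyticAt.prod analyticAt_fst (AnalyticAt.fun_add analyticAt_snd (hT x hx 0))
      have h0 : (fun q : ℂ × (Fin d → ℂ) => (q.1, q.2 + T q)) (x, 0) = (x, 0) := by
        show (x, 0 + truncSeries d n H x 0) = (x, 0)
        rw [trunc_zero n hn, add_zero]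
      exact AnalyticAt.fun_comp (g := fun q : ℂ × (Fin d → ℂ) => f q.1 q.2)
        (f := fun q : ℂ × (Fin d → ℂ) => (q.1, q.2 + T q)) (by
          have h1 := hf x hx
          rw [← h0] at h1
          exact h1) hb
    exact AnalyticAt.fun_sub (AnalyticAt.fun_sub (AnalyticAt.fun_add a1 a2) a3)
      (AnalyticAt.fun_sub a4 (hP x hx 0))
  · intro x hx hxp w
    have hQ := Q_ne (p := p) x hxp
    have hR : R x = (∏ j, (x - p j)) • ∑ j, (x - p j)⁻¹ • A j := by
      ext i k
      exact Rp_eval A x hxp i k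
    show (∏ j, (x - p j)) • T' (x, w) + fderiv ℂ T (x, w) (0, R x *ᵥ w + P (x, w)) - R x *ᵥ T (x, w) -
      (f x (w + T (x, w)) - P (x, w)) = _
    rw [← fderiv_slice (hT x hx w), hR]
    unfold ErrN Err
    show _ = (∏ j, (x - p j)) • (T' (x, w) + fderiv ℂ (fun v => T (x, v)) w
      ((∑ j, (x - p j)⁻¹ • A j) *ᵥ w + (∏ j, (x - p j))⁻¹ • P (x, w)) -
        (∑ j, (x - p j)⁻¹ • A j) *ᵥ T (x, w) - (∏ j, (x - p j))⁻¹ • (f x (w + T (x, w)) - P (x, w)))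
    rw [smul_sub, smul_sub, smul_add, smul_smul, mul_inv_cancel₀ hQ, one_smul, ← map_smul, smul_add,
      smul_smul, mul_inv_cancel₀ hQ, one_smul, Matrix.smul_mulVec, Matrix.smul_mulVec]

/-- Data solving the problem up to order n. -/
def Sol (p : Fin (S + 2) → ℂ) (A : Fin (S + 2) → Matrix (Fin d) (Fin d) ℂ) (D : Set ℂ)
    (f : ℂ → (Fin d → ℂ) → Fin d → ℂ) (n : ℕ)
    (s : ((Fin d → ℕ) → ℂ → Fin d → ℂ) × ((Fin d → ℕ) → Fin d → Polynomial ℂ)) : Prop :=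
  (∀ m, ∑ i, m i < 2 → s.1 m = 0) ∧ (∀ m, ∑ i, m i < 2 → s.2 m = 0) ∧
  (∀ m, AnalyticOnNhd ℂ (s.1 m) D) ∧ (∀ m i, (s.2 m i).degree ≤ (S : ℕ)) ∧
  ∀ x ∈ D \ range p, ErrN p A f s.1 s.2 n x =O[𝓝 0] fun w => ‖w‖ ^ (n + 1)

theorem exists_step (hp : Function.Injective p) (A : Fin (S + 2) → Matrix (Fin d) (Fin d) ℂ)
    (hAinf : NonlinearlyNonresonant d (∑ j, A j)) (hD : IsOpen D)
    (hDsc : SimplyConnectedSpace D) (hpD : ∀ j, p j ∈ D)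
    (f : ℂ → (Fin d → ℂ) → Fin d → ℂ)
    (hf : ∀ x ∈ D, AnalyticAt ℂ (fun q : ℂ × (Fin d → ℂ) => f q.1 q.2) (x, 0))
    (hf2 : ∀ x ∈ D, fderiv ℂ (f x) 0 = 0) (n : ℕ) (hn : 1 ≤ n)
    (s : ((Fin d → ℕ) → ℂ → Fin d → ℂ) × ((Fin d → ℕ) → Fin d → Polynomial ℂ))
    (hs : Sol p A D f n s) :
    ∃ s' : ((Fin d → ℕ) → ℂ → Fin d → ℂ) × ((Fin d → ℕ) → Fin d → Polynomial ℂ),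
      Sol p A D f (n + 1) s' ∧ ∀ m, ∑ i, m i ≤ n → s'.1 m = s.1 m ∧ s'.2 m = s.2 m := by
  classical
  obtain ⟨H, Psi⟩ := s
  obtain ⟨hH0, hPsi0, hH, hPsi, hE⟩ := hs
  simp only at hH0 hPsi0 hH hPsi hE
  obtain ⟨B, hB, hBn⟩ := exists_B A hAinf (n + 1) (by omega)
  obtain ⟨G, hG, hGE⟩ := exists_G (p := p) A f hD hf H Psi hH n hn
  obtain ⟨g, hg, hgO⟩ := taylor_step D G hG (n + 1)
  obtain ⟨h, ψ, hh, hψ, hode⟩ := linear_exists hp B hBn hD hDsc hpD (fun a x => - g a x)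
    (fun a => ((hg a).differentiableOn).fun_neg)
  let H' : (Fin d → ℕ) → ℂ → Fin d → ℂ := fun m =>
    if hm : m ∈ Finset.piAntidiag (Finset.univ : Finset (Fin d)) (n+1) then
      fun x i => h (⟨m, hm⟩, i) x else H m
  let Psi' : (Fin d → ℕ) → Fin d → Polynomial ℂ := fun m =>
    if hm : m ∈ Finset.piAntidiag (Finset.univ : Finset (Fin d)) (n+1) then
      fun i => ψ (⟨m, hm⟩, i) else Psi m
  have hne : ∀ m : Fin d → ℕ, ∑ i, m i ≤ n →
      m ∉ Finset.piAntidiag (Finset.univ : Finset (Fin d)) (n+1) := by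
    intro m hm hm2
    rw [mem_piA] at hm2
    omega
  have hH'old : ∀ m : Fin d → ℕ, ∑ i, m i ≤ n → H' m = H m := fun m hm => dif_neg (hne m hm)
  have hP'old : ∀ m : Fin d → ℕ, ∑ i, m i ≤ n → Psi' m = Psi m := fun m hm => dif_neg (hne m hm)
  have hH'new : ∀ a : Idx d (n+1), H' a.1.1 = fun x i => h (a.1, i) x := fun a => dif_pos a.1.2
  have hP'new : ∀ a : Idx d (n+1), Psi' a.1.1 = fun i => ψ (a.1, i) := fun a => dif_pos a.1.2
  refine ⟨(H', Psi'), ⟨?_, ?_, ?_, ?_, ?_⟩, fun m hm => ⟨hH'old m hm, hP'old m hm⟩⟩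
  · intro m hm
    show H' m = 0
    rw [hH'old m (by omega), hH0 m hm]
  · intro m hm
    show Psi' m = 0
    rw [hP'old m (by omega), hPsi0 m hm]
  · intro m
    show AnalyticOnNhd ℂ (H' m) D
    by_cases hm : m ∈ Finset.piAntidiag (Finset.univ : Finset (Fin d)) (n+1)
    · have : H' m = fun x i => h (⟨m, hm⟩, i) x := dif_pos hm
      rw [this]
      intro x hx
      exact analyticAt_pi_iff.mpr fun i => (hh _).analyticAt (hD.mem_nhds hx)
    · have : H' m = H m := dif_neg hm
      rw [this]; exact hH m
  · intro m i
    show (Psi' m i).degree ≤ (S : ℕ)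
    by_cases hm : m ∈ Finset.piAntidiag (Finset.univ : Finset (Fin d)) (n+1)
    · have : Psi' m = fun i => ψ (⟨m, hm⟩, i) := dif_pos hm
      rw [this]
      exact Order.lt_succ_iff.mp (hψ _)
    · have : Psi' m = Psi m := dif_neg hm
      rw [this]; exact hPsi m i
  · intro x hx
    show ErrN p A f H' Psi' (n+1) x =O[𝓝 0] fun w => ‖w‖ ^ (n + 1 + 1)
    have hstep := ErrN_step (p := p) A f x hx.2 (slice_analytic f x (hf x hx.1)) (hf2 x hx.1) H' Psi' n hn B hB
    have hQ := Q_ne (p := p) x hx.2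
    have hold : ErrN p A f H' Psi' n x = ErrN p A f H Psi n x := by
      unfold ErrN
      have e1 : (fun w => truncSeries d n (fun m => deriv (H' m)) x w) =
          fun w => truncSeries d n (fun m => deriv (H m)) x w := funext fun w =>
        trunc_congr n _ _ x (fun m hm => by rw [hH'old m hm]) w
      have e2 : (fun w => truncSeries d n H' x w) = fun w => truncSeries d n H x w := funext fun w =>
        trunc_congr n _ _ x (fun m hm => by rw [hH'old m hm]) w
      have e3 : (fun w => truncSeries d n (fun m t i => (Psi' m i).eval t) x w) =
          fun w => truncSeries d n (fun m t i => (Psi m i).eval t) x w := funext fun w =>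
        trunc_congr n _ _ x (fun m hm => by rw [hP'old m hm]) w
      rw [e1, e2, e3]
    have hGx : (fun w => G (x, w)) = fun w => (∏ j, (x - p j)) • ErrN p A f H Psi n x w :=
      funext fun w => hGE x hx.1 hx.2 w
    have hO := hgO x hx.1 (by rw [hGx]; exact (hE x hx).const_smul_left (∏ j, (x - p j)))
    have hO2 := hO.const_smul_left (∏ j, (x - p j))⁻¹
    refine (hstep.add hO2).congr' (Eventually.of_forall fun w => ?_) (EventuallyEq.refl _ _)
    have hcoef : (fun a : Idx d (n+1) => (nodQ p).eval x * deriv (H' a.1.1) x a.2 -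
        ∑ b : Idx d (n+1), (Rp p B a b).eval x * H' b.1.1 x b.2 + (Psi' a.1.1 a.2).eval x) =
        - fun a => g a x := by
      funext a
      have hda : deriv (H' a.1.1) x a.2 = deriv (h a) x := by
        rw [hH'new a, deriv_pi fun i => ((hh (a.1, i)).differentiableAt (hD.mem_nhds hx.1))]
      have hb : ∀ b : Idx d (n+1), H' b.1.1 x b.2 = h b x := fun b => by rw [hH'new b]
      have hc : Psi' a.1.1 a.2 = ψ a := by rw [hP'new a]
      rw [hda, hc, hode a x hx.1]
      simp only [hb]
      rw [Pi.neg_apply]; ring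
    show ErrN p A f H' Psi' (n+1) x w - ErrN p A f H' Psi' n x w - _ +
      (∏ j, (x - p j))⁻¹ • (G (x, w) - homI (n+1) (fun a => g a x) w) = _
    rw [hcoef, hold, hGE x hx.1 hx.2 w, ← homL_apply, ← homL_apply, map_neg, smul_sub, smul_smul,
      inv_mul_cancel₀ hQ, one_smul, smul_neg]
    abel

end main

section main
variable {d S : ℕ} {p : Fin (S + 2) → ℂ} {D : Set ℂ}

theorem ErrN_congr (A : Fin (S + 2) → Matrix (Fin d) (Fin d) ℂ)
    (f : ℂ → (Fin d → ℂ) → Fin d → ℂ) (hD : IsOpen D) (n : ℕ)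
    (H1 H2 : (Fin d → ℕ) → ℂ → Fin d → ℂ) (P1 P2 : (Fin d → ℕ) → Fin d → Polynomial ℂ)
    (h : ∀ m, ∑ i, m i ≤ n → (∀ x ∈ D, H1 m x = H2 m x) ∧ P1 m = P2 m) (x : ℂ) (hx : x ∈ D) :
    ErrN p A f H1 P1 n x = ErrN p A f H2 P2 n x := by
  unfold ErrN
  have e1 : (fun w => truncSeries d n (fun m => deriv (H1 m)) x w) =
      fun w => truncSeries d n (fun m => deriv (H2 m)) x w := funext fun w =>
    trunc_congr n _ _ x (fun m hm => by
      refine Filter.EventuallyEq.deriv_eq ?_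
      filter_upwards [hD.mem_nhds hx] with t ht
      exact (h m hm).1 t ht) w
  have e2 : (fun w => truncSeries d n H1 x w) = fun w => truncSeries d n H2 x w := funext fun w =>
    trunc_congr n _ _ x (fun m hm => (h m hm).1 x hx) w
  have e3 : (fun w => truncSeries d n (fun m t i => (P1 m i).eval t) x w) =
      fun w => truncSeries d n (fun m t i => (P2 m i).eval t) x w := funext fun w =>
    trunc_congr n _ _ x (fun m hm => by rw [(h m hm).2]) w
  rw [e1, e2, e3]

theorem sol_unique (hp : Function.Injective p) (A : Fin (S + 2) → Matrix (Fin d) (Fin d) ℂ)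
    (hAinf : NonlinearlyNonresonant d (∑ j, A j)) (hD : IsOpen D)
    (hDsc : SimplyConnectedSpace D) (hpD : ∀ j, p j ∈ D)
    (f : ℂ → (Fin d → ℂ) → Fin d → ℂ)
    (hf : ∀ x ∈ D, AnalyticAt ℂ (fun q : ℂ × (Fin d → ℂ) => f q.1 q.2) (x, 0))
    (hf2 : ∀ x ∈ D, fderiv ℂ (f x) 0 = 0)
    (H1 H2 : (Fin d → ℕ) → ℂ → Fin d → ℂ) (P1 P2 : (Fin d → ℕ) → Fin d → Polynomial ℂ)
    (h1 : ∀ n, 2 ≤ n → Sol p A D f n (H1, P1)) (h2 : ∀ n, 2 ≤ n → Sol p A D f n (H2, P2)) (n : ℕ)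
    (hn : 1 ≤ n) :
    ∀ m : Fin d → ℕ, ∑ i, m i ≤ n → (∀ x ∈ D, H1 m x = H2 m x) ∧ P1 m = P2 m := by
  induction n, hn using Nat.le_induction with
  | base =>
    intro m hm
    have a1 := h1 2 le_rfl
    have a2 := h2 2 le_rfl
    refine ⟨fun x _ => ?_, ?_⟩
    · rw [show H1 m = 0 from a1.1 m (by omega), show H2 m = 0 from a2.1 m (by omega)]
    · rw [show P1 m = 0 from a1.2.1 m (by omega), show P2 m = 0 from a2.2.1 m (by omega)]
  | succ n hn ih =>
    intro m hm
    rcases Nat.lt_or_ge n (∑ i, m i) with hlt | hle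
    swap
    · exact ih m hle
    have hmn : m ∈ Finset.piAntidiag (Finset.univ : Finset (Fin d)) (n+1) := by
      rw [mem_piA]; omega
    obtain ⟨B, hB, hBn⟩ := exists_B A hAinf (n + 1) (by omega)
    obtain ⟨-, -, hH1, hP1, hE1⟩ := h1 (n+1) (by omega)
    obtain ⟨-, -, hH2, hP2, hE2⟩ := h2 (n+1) (by omega)
    simp only at hH1 hP1 hE1 hH2 hP2 hE2
    have hd1 : ∀ m i, DifferentiableOn ℂ (fun x => H1 m x i) D := fun m i x hx =>
      (analyticAt_pi_iff.mp (hH1 m x hx) i).differentiableAt.differentiableWithinAt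
    have hd2 : ∀ m i, DifferentiableOn ℂ (fun x => H2 m x i) D := fun m i x hx =>
      (analyticAt_pi_iff.mp (hH2 m x hx) i).differentiableAt.differentiableWithinAt
    have key := linear_unique hp B hBn hD hDsc hpD
      (fun a x => H1 a.1.1 x a.2 - H2 a.1.1 x a.2) (fun a => P1 a.1.1 a.2 - P2 a.1.1 a.2)
      (fun a => (hd1 _ _).fun_sub (hd2 _ _))
      (fun a => by
        refine lt_of_le_of_lt (Polynomial.degree_sub_le _ _) ?_
        refine lt_of_le_of_lt (max_le (hP1 _ _) (hP2 _ _)) ?_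
        exact_mod_cast Nat.lt_succ_self S)
      (by
        intro a x hx hxp
        have hQ := Q_ne (p := p) x hxp
        have s1 := ErrN_step (p := p) A f x hxp (slice_analytic f x (hf x hx)) (hf2 x hx) H1 P1 n hn B hB
        have s2 := ErrN_step (p := p) A f x hxp (slice_analytic f x (hf x hx)) (hf2 x hx) H2 P2 n hn B hB
        have hcongr := ErrN_congr (p := p) A f hD n H1 H2 P1 P2 ih x hx
        have s3 := ((hE1 x ⟨hx, hxp⟩).sub (hE2 x ⟨hx, hxp⟩)).sub (s1.sub s2)
        have s4 := s3.const_smul_left (∏ j, (x - p j))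
        set c1 := (fun a : Idx d (n+1) => (nodQ p).eval x * deriv (H1 a.1.1) x a.2 -
          ∑ b : Idx d (n+1), (Rp p B a b).eval x * H1 b.1.1 x b.2 + (P1 a.1.1 a.2).eval x) with hc1
        set c2 := (fun a : Idx d (n+1) => (nodQ p).eval x * deriv (H2 a.1.1) x a.2 -
          ∑ b : Idx d (n+1), (Rp p B a b).eval x * H2 b.1.1 x b.2 + (P2 a.1.1 a.2).eval x) with hc2
        have s5 : homI (n+1) (c1 - c2) =O[𝓝 0] fun w => ‖w‖ ^ (n + 1 + 1) := by
          refine s4.congr' (Eventually.of_forall fun w => ?_) (EventuallyEq.refl _ _)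
          show (∏ j, (x - p j)) • (ErrN p A f H1 P1 (n+1) x w - ErrN p A f H2 P2 (n+1) x w -
            ((ErrN p A f H1 P1 (n+1) x w - ErrN p A f H1 P1 n x w - (∏ j, (x - p j))⁻¹ • homI (n+1) c1 w) -
            (ErrN p A f H2 P2 (n+1) x w - ErrN p A f H2 P2 n x w -
              (∏ j, (x - p j))⁻¹ • homI (n+1) c2 w))) = _
          rw [hcongr]
          have e : ∀ (a b c u v : Fin d → ℂ), a - b - ((a - c - u) - (b - c - v)) = u - v := by
            intros; abel
          rw [e, ← smul_sub, smul_smul, mul_inv_cancel₀ hQ, one_smul, ← homL_apply, ← homL_apply,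
            ← homL_apply, map_sub]
        have s6 := congrFun (homI_bigO_zero (n+1) _ s5) a
        have f1 : deriv (H1 a.1.1) x a.2 = deriv (fun x => H1 a.1.1 x a.2) x := by
          rw [deriv_pi fun i => ((hd1 a.1.1 i).differentiableAt (hD.mem_nhds hx))]
        have f2 : deriv (H2 a.1.1) x a.2 = deriv (fun x => H2 a.1.1 x a.2) x := by
          rw [deriv_pi fun i => ((hd2 a.1.1 i).differentiableAt (hD.mem_nhds hx))]
        have f3 : deriv (fun x => H1 a.1.1 x a.2 - H2 a.1.1 x a.2) x =
            deriv (H1 a.1.1) x a.2 - deriv (H2 a.1.1) x a.2 := by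
          rw [f1, f2]
          exact deriv_fun_sub ((hd1 a.1.1 a.2).differentiableAt (hD.mem_nhds hx))
            ((hd2 a.1.1 a.2).differentiableAt (hD.mem_nhds hx))
        rw [f3]
        simp only [mul_sub, Finset.sum_sub_distrib, Polynomial.eval_sub]
        rw [Pi.sub_apply, hc1, hc2, Pi.zero_apply] at s6
        linear_combination s6)
    refine ⟨fun x hx => ?_, ?_⟩
    · funext i
      exact sub_eq_zero.mp (key.1 (⟨m, hmn⟩, i) x hx)
    · funext i
      exact sub_eq_zero.mp (key.2 (⟨m, hmn⟩, i))

theorem sol_exists (hp : Function.Injective p) (A : Fin (S + 2) → Matrix (Fin d) (Fin d) ℂ)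
    (hAinf : NonlinearlyNonresonant d (∑ j, A j)) (hD : IsOpen D)
    (hDsc : SimplyConnectedSpace D) (hpD : ∀ j, p j ∈ D)
    (f : ℂ → (Fin d → ℂ) → Fin d → ℂ)
    (hf : ∀ x ∈ D, AnalyticAt ℂ (fun q : ℂ × (Fin d → ℂ) => f q.1 q.2) (x, 0))
    (hf0 : ∀ x ∈ D, f x 0 = 0) (hf2 : ∀ x ∈ D, fderiv ℂ (f x) 0 = 0) :
    ∃ s : ((Fin d → ℕ) → ℂ → Fin d → ℂ) × ((Fin d → ℕ) → Fin d → Polynomial ℂ),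
      ∀ n, 1 ≤ n → Sol p A D f n s := by
  have hbase : Sol p A D f 1 (fun _ => 0, fun _ => 0) := by
    refine ⟨fun _ _ => rfl, fun _ _ => rfl, fun _ => analyticOnNhd_const, fun _ _ => by simp, ?_⟩
    intro x hx
    refine ((nl_sq (f x) (slice_analytic f x (hf x hx.1)) (hf0 x hx.1) (hf2 x hx.1)).const_smul_left
      (-(∏ j, (x - p j))⁻¹)).congr' (Eventually.of_forall fun w => ?_) (EventuallyEq.refl _ _)
    unfold ErrN Err
    simp only [trunc_one]
    simp
  have hstep := fun n (hn : 1 ≤ n) s (hs : Sol p A D f n s) =>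
    exists_step hp A hAinf hD hDsc hpD f hf hf2 n hn s hs
  choose nx hnx hag using hstep
  let st : ∀ n : ℕ, {s // Sol p A D f (n + 1) s} := fun n =>
    Nat.rec ⟨_, hbase⟩ (fun n s => ⟨nx (n+1) (by omega) s.1 s.2, hnx _ _ _ _⟩) n
  have hst : ∀ n, (st (n+1)).1 = nx (n+1) (by omega) (st n).1 (st n).2 := fun n => rfl
  have hag1 : ∀ n m, ∑ i, m i ≤ n + 1 →
      (st (n+1)).1.1 m = (st n).1.1 m ∧ (st (n+1)).1.2 m = (st n).1.2 m := by
    intro n m hm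
    rw [hst]
    exact hag (n+1) (by omega) (st n).1 (st n).2 m hm
  have hag2 : ∀ n k m, ∑ i, m i ≤ n + 1 →
      (st (n+k)).1.1 m = (st n).1.1 m ∧ (st (n+k)).1.2 m = (st n).1.2 m := by
    intro n k m hm
    induction k with
    | zero => exact ⟨rfl, rfl⟩
    | succ k ih =>
      have := hag1 (n+k) m (by omega)
      exact ⟨this.1.trans ih.1, this.2.trans ih.2⟩
  refine ⟨(fun m => (st (∑ i, m i)).1.1 m, fun m => (st (∑ i, m i)).1.2 m), fun n hn => ?_⟩
  refine ⟨fun m hm => (st (∑ i, m i)).2.1 m hm, fun m hm => (st (∑ i, m i)).2.2.1 m hm,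
    fun m => (st (∑ i, m i)).2.2.2.1 m, fun m i => (st (∑ i, m i)).2.2.2.2.1 m i, ?_⟩
  intro x hx
  obtain ⟨n, rfl⟩ : ∃ k, n = k + 1 := ⟨n - 1, by omega⟩
  have h5 := (st n).2.2.2.2.2 x hx
  rw [ErrN_congr (p := p) A f hD (n+1) _ (st n).1.1 _ (st n).1.2 ?_ x hx.1]
  · exact h5
  · intro m hm
    have a1 := hag2 (∑ i, m i) (n + 1 - ∑ i, m i) m (by omega)
    have a2 := hag2 n 1 m hm
    rw [show ∑ i, m i + (n + 1 - ∑ i, m i) = n + 1 by omega] at a1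
    refine ⟨fun t _ => congrFun (a1.1.symm.trans a2.1) t, a1.2.symm.trans a2.2⟩

end main

/-- Theorem 3 of the paper (formal normal forms): for the system
`u' = A(x) u + Q(x)⁻¹ f(x,u)` with Fuchsian linear part, all residue matrices and
`A_∞` nonlinearly nonresonant, there is a unique family `(ψ_m)_{|m| ≥ 2}` of
`ℂᵈ`-valued polynomials of degree at most `S` such that the system is formally
equivalent to the normal form `w' = A(x) w + Q(x)⁻¹ ψ(x,w)` by
`u = w + Σ_{|m| ≥ 2} h_m(x) wᵐ` with `h_m` analytic on `D`; the conjugacy identity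
`∂ₓh + (d_w h)(A w + Q⁻¹ ψ(x,w)) = A h + Q⁻¹ (f(x, w+h) − ψ(x,w))` holds order by
order, i.e. for every `n ≥ 2` the identity for the degree-`n` truncations has an
error which is `O(‖w‖^{n+1})` as `w → 0`. -/
theorem stmt_2 (d S : ℕ) (hd : 1 ≤ d)
    (p : Fin (S + 2) → ℂ) (hp : Function.Injective p)
    (A : Fin (S + 2) → Matrix (Fin d) (Fin d) ℂ)
    (hA : ∀ j, NonlinearlyNonresonant d (A j))
    (hAinf : NonlinearlyNonresonant d (∑ j, A j))
    (D : Set ℂ) (hD : IsOpen D) (hDc : IsPreconnected D)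
    (hDsc : SimplyConnectedSpace D) (hpD : ∀ j, p j ∈ D)
    (R : ℝ) (hR : 0 < R)
    (f : ℂ → (Fin d → ℂ) → Fin d → ℂ)
    (hf : AnalyticOnNhd ℂ (fun q : ℂ × (Fin d → ℂ) => f q.1 q.2)
      (D ×ˢ Metric.ball 0 R))
    (hf2 : ∀ x ∈ D, f x 0 = 0 ∧ fderiv ℂ (f x) 0 = 0) :
    ∃! Psi : (Fin d → ℕ) → Fin d → Polynomial ℂ,
      ((∀ m, ∑ i, m i < 2 → Psi m = 0) ∧
        (∀ m i, (Psi m i).degree ≤ (S : ℕ))) ∧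
      ∃ H : (Fin d → ℕ) → ℂ → Fin d → ℂ,
        (∀ m, ∑ i, m i < 2 → H m = 0) ∧
        (∀ m, AnalyticOnNhd ℂ (H m) D) ∧
        ∀ n : ℕ, 2 ≤ n → ∀ x ∈ D \ Set.range p,
          (fun w : Fin d → ℂ =>
              deriv (fun t => truncSeries d n H t w) x
                + (fderiv ℂ (fun v => truncSeries d n H x v) w)
                    ((∑ j, (x - p j)⁻¹ • A j) *ᵥ w
                      + (∏ j, (x - p j))⁻¹ •
                          truncSeries d n (fun m t i => (Psi m i).eval t) x w)
                - (∑ j, (x - p j)⁻¹ • A j) *ᵥ truncSeries d n H x w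
                - (∏ j, (x - p j))⁻¹ •
                    (f x (w + truncSeries d n H x w)
                      - truncSeries d n (fun m t i => (Psi m i).eval t) x w))
            =O[𝓝 (0 : Fin d → ℂ)] fun w => ‖w‖ ^ (n + 1) := by
  have hf' : ∀ x ∈ D, AnalyticAt ℂ (fun q : ℂ × (Fin d → ℂ) => f q.1 q.2) (x, 0) := fun x hx =>
    hf (x, 0) ⟨hx, Metric.mem_ball_self hR⟩
  obtain ⟨s, hs⟩ := sol_exists hp A hAinf hD hDsc hpD f hf' (fun x hx => (hf2 x hx).1)
    (fun x hx => (hf2 x hx).2)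
  have hs2 := hs 2 (by omega)
  refine ⟨s.2, ⟨⟨hs2.2.1, hs2.2.2.2.1⟩, s.1, hs2.1, hs2.2.2.1, fun n hn x hx => ?_⟩, ?_⟩
  · have h5 := (hs n (by omega)).2.2.2.2 x hx
    refine h5.congr' (Eventually.of_forall fun w => ?_) (EventuallyEq.refl _ _)
    unfold ErrN Err
    beta_reduce
    rw [trunc_deriv n s.1 x (fun m => (hs2.2.2.1 m x hx.1).differentiableAt) w]
  · rintro Psi ⟨⟨hP0, hPd⟩, H, hH0, hH, hE⟩
    have hsol : ∀ n, 2 ≤ n → Sol p A D f n (H, Psi) := by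
      intro n hn
      refine ⟨hH0, hP0, hH, hPd, fun x hx => ?_⟩
      refine (hE n hn x hx).congr' (Eventually.of_forall fun w => ?_) (EventuallyEq.refl _ _)
      unfold ErrN Err
      beta_reduce
      rw [trunc_deriv n H x (fun m => (hH m x hx.1).differentiableAt) w]
    funext m
    exact (sol_unique hp A hAinf hD hDsc hpD f hf' (fun x hx => (hf2 x hx).2) H s.1 Psi s.2 hsol
      (fun n hn => hs n (by omega)) (∑ i, m i + 1) (by omega) m (by omega)).2
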